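/- Let i, j, k ≥ 6. There exists ρ₀ ≥ max(i,j,k) such that for all integers ρ ≥ ρ₀ the following holds: let x = (ab⁻¹)³(a²b⁻¹)³ · (ab⁻¹)³(a²b⁻¹)⁴ ⋯ (ab⁻¹)³(a²b⁻¹)^{ρ+2} (the concatenation of (ab⁻¹)³(a²b⁻¹)^m for m = 3, …, ρ+2) and y = (ab⁻¹)³(a²b⁻¹)^{ρ+3} ⋯ (ab⁻¹)³(a²b⁻¹)^{2ρ+2} (the concatenation of (ab⁻¹)³(a²b⁻¹)^m for m = ρ+3, …, 2ρ+2), words in the free group F(a,b). Then the subgroup M of T_{i,j,k} = ⟨a, b; a^i, b^j, (ab)^k⟩ generated by the images of x and y is malnormal in T_{i,j,k} and is free of rank two. -/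

import Mathlib

/-- A subgroup `M ≤ H` is malnormal if `g⁻¹Mg ∩ M ≠ 1` implies `g ∈ M`. -/
def Malnormal {H : Type*} [Group H] (M : Subgroup H) : Prop :=
  ∀ g : H, (∃ x ∈ M, x ≠ 1 ∧ g⁻¹ * x * g ∈ M) → g ∈ M

/-- The relators of the triangle group `T_{i,j,k}`. -/
def triangleRels (i j k : ℕ) : Set (FreeGroup (Fin 2)) :=
  {FreeGroup.of 0 ^ i, FreeGroup.of 1 ^ j, (FreeGroup.of 0 * FreeGroup.of 1) ^ k}

/-- The triangle group `T_{i,j,k} = ⟨a, b; a^i, b^j, (ab)^k⟩`. -/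
abbrev TriangleGroup (i j k : ℕ) := PresentedGroup (triangleRels i j k)

/-- The generator `a` of the free group of rank two. -/
def fa : FreeGroup (Fin 2) := FreeGroup.of 0

/-- The generator `b` of the free group of rank two. -/
def fb : FreeGroup (Fin 2) := FreeGroup.of 1

/-- The word `x = (ab⁻¹)³(a²b⁻¹)³ (ab⁻¹)³(a²b⁻¹)⁴ ⋯ (ab⁻¹)³(a²b⁻¹)^{ρ+2}`. -/
def wordX (ρ : ℕ) : FreeGroup (Fin 2) :=
  (((List.range ρ).map fun m => (fa * fb⁻¹) ^ 3 * (fa ^ 2 * fb⁻¹) ^ (m + 3))).prod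

/-- The word `y = (ab⁻¹)³(a²b⁻¹)^{ρ+3} ⋯ (ab⁻¹)³(a²b⁻¹)^{2ρ+2}`. -/
def wordY (ρ : ℕ) : FreeGroup (Fin 2) :=
  (((List.range ρ).map fun m => (fa * fb⁻¹) ^ 3 * (fa ^ 2 * fb⁻¹) ^ (m + ρ + 3))).prod


namespace TG

/-- Lorentzian 3-space. -/
abbrev E3 := ℝ × ℝ × ℝ

/-- The Lorentzian form. -/
def LB (u v : E3) : ℝ := -u.1 * v.1 + u.2.1 * v.2.1 + u.2.2 * v.2.2

theorem LB_comm (u v : E3) : LB u v = LB v u := by unfold LB; ring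

theorem LB_add (u v w : E3) : LB (u + v) w = LB u w + LB v w := by
  simp [LB]; ring

theorem LB_smul (r : ℝ) (v w : E3) : LB (r • v) w = r * LB v w := by
  simp [LB]; ring

theorem LB_sub (u v w : E3) : LB (u - v) w = LB u w - LB v w := by
  simp [LB]; ring

/-- Reflection. -/
def rf (α u : E3) : E3 := u - (2 * LB u α) • α

theorem rf_rf {α : E3} (h : LB α α = 1) (u : E3) : rf α (rf α u) = u := by
  unfold rf
  rw [LB_sub, LB_smul, h]
  have : 2 * (LB u α - 2 * LB u α * 1) = -(2 * LB u α) := by ring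
  rw [this]; simp

/-- Reflection as a permutation. -/
def rp (α : E3) (h : LB α α = 1) : Equiv.Perm E3 :=
  ⟨rf α, rf α, rf_rf h, rf_rf h⟩

theorem LB_rf {α : E3} (h : LB α α = 1) (u : E3) : LB (rf α u) (rf α u) = LB u u := by
  unfold rf
  rw [LB_sub, LB_smul, LB_comm u, LB_comm α, LB_sub, LB_smul, LB_sub, LB_smul, h, LB_comm α u]
  ring

open Complex in
/-- The complex coordinate. -/
noncomputable def zt (α β : E3) (θ : ℝ) (u : E3) : ℂ := (LB u α : ℂ) + exp (θ * I) * (LB u β : ℂ)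

section two
variable {α β : E3} {θ : ℝ}

open Complex in
theorem zt_step (hα : LB α α = 1) (hβ : LB β β = 1) (hαβ : LB α β = -Real.cos θ)
    (u : E3) :
    zt α β θ (rp α hα (rp β hβ u)) = exp (2 * θ * I) * zt α β θ u := by
  have h1 : LB (rp α hα (rp β hβ u)) α = -LB u α - 2 * Real.cos θ * LB u β := by
    show LB (rf α (rf β u)) α = _
    unfold rf
    simp only [LB_sub, LB_smul, hα, hαβ, LB_comm β α]; ring
  have h2 : LB (rp α hα (rp β hβ u)) β = -LB u β + 2 * Real.cos θ * LB u α
      + 4 * Real.cos θ ^ 2 * LB u β := by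
    show LB (rf α (rf β u)) β = _
    unfold rf
    simp only [LB_sub, LB_smul, hβ, hαβ, LB_comm β α]; ring
  unfold zt
  rw [h1, h2]
  have hz : exp (2 * θ * I) = exp (θ * I) ^ 2 := by rw [← exp_nat_mul]; congr 1; push_cast; ring
  have hc : (2 : ℂ) * Real.cos θ * exp (θ * I) = exp (θ * I) ^ 2 + 1 := by
    rw [ofReal_cos, two_cos, ← exp_nat_mul]
    rw [add_mul, ← exp_add, ← exp_add]
    simp; congr 1; ring
  rw [hz]
  set ζ := exp (θ * I)
  push_cast at hc ⊢
  set C := cos (θ : ℂ)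
  set p := (LB u α : ℂ)
  set q := (LB u β : ℂ)
  have h4 : 4 * C ^ 2 * ζ = 2 * C * (ζ ^ 2 + 1) := by rw [← hc]; ring
  have h5 : 2 * C * ζ ^ 2 = ζ * (ζ ^ 2 + 1) := by rw [← hc]; ring
  linear_combination p * hc + q * h4 + q * h5

open Complex in
theorem zt_pow (hα : LB α α = 1) (hβ : LB β β = 1) (hαβ : LB α β = -Real.cos θ)
    (n : ℕ) (u : E3) :
    zt α β θ (((rp α hα * rp β hβ) ^ n) u) = exp (2 * n * θ * I) * zt α β θ u := by
  induction n with
  | zero => simp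
  | succ n ih =>
    rw [pow_succ', Equiv.Perm.mul_apply, Equiv.Perm.mul_apply, zt_step hα hβ hαβ, ih, ← mul_assoc,
      ← exp_add]
    congr 2; push_cast; ring

theorem pow_span (hα : LB α α = 1) (hβ : LB β β = 1)
    (n : ℕ) (u : E3) :
    ∃ p q : ℝ, ((rp α hα * rp β hβ) ^ n) u = u + p • α + q • β := by
  induction n with
  | zero => exact ⟨0, 0, by simp⟩
  | succ n ih =>
    obtain ⟨p, q, h⟩ := ih
    rw [pow_succ', Equiv.Perm.mul_apply, h, Equiv.Perm.mul_apply]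
    show ∃ p' q', rf α (rf β _) = _
    generalize hw : u + p • α + q • β = w
    refine ⟨p - 2 * LB (rf β w) α, q - 2 * LB w β, ?_⟩
    have : rf α (rf β w) = w - (2 * LB w β) • β - (2 * LB (rf β w) α) • α := rfl
    rw [this, ← hw]; module

theorem zt_inj (hα : LB α α = 1) (hβ : LB β β = 1) (hαβ : LB α β = -Real.cos θ)
    (hs : Real.sin θ ≠ 0) (p q : ℝ) (h : zt α β θ (p • α + q • β) = 0) :
    p = 0 ∧ q = 0 := by
  unfold zt at h
  simp only [LB_add, LB_smul, hα, hβ, hαβ, LB_comm β α] at h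
  have hi := congrArg Complex.im h
  have hr := congrArg Complex.re h
  rw [Complex.exp_mul_I, ← Complex.ofReal_cos, ← Complex.ofReal_sin] at hi hr
  simp at hi hr
  have e2 : -(p * Real.cos θ) + q = 0 := by
    rcases hi with h | h
    · exact absurd h hs
    · exact h
  rw [Complex.cos_ofReal_re, e2] at hr
  have e1 : p + -(q * Real.cos θ) = 0 := by linarith
  have hq : q = p * Real.cos θ := by linarith
  have h3 : p * Real.sin θ ^ 2 = 0 := by
    rw [Real.sin_sq]; rw [hq] at e1; linarith
  have hp : p = 0 := by
    rcases mul_eq_zero.1 h3 with h | h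
    · exact h
    · exact absurd (pow_eq_zero_iff (two_ne_zero) |>.1 h) hs
  exact ⟨hp, by rw [hq, hp]; ring⟩

theorem rot_pow (hα : LB α α = 1) (hβ : LB β β = 1) (hαβ : LB α β = -Real.cos θ)
    {n : ℕ} (hn : 2 ≤ n) (hθ : θ = Real.pi / n) : (rp α hα * rp β hβ) ^ n = 1 := by
  have hn0 : (n : ℝ) ≠ 0 := by positivity
  have hs : Real.sin θ ≠ 0 := by
    have : 0 < Real.sin θ := by
      apply Real.sin_pos_of_pos_of_lt_pi
      · rw [hθ]; positivity
      · rw [hθ]; apply div_lt_self Real.pi_pos; exact_mod_cast hn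
    exact this.ne'
  ext1 u
  obtain ⟨p, q, h⟩ := pow_span hα hβ n u
  have h2 := zt_pow hα hβ hαβ n u
  have : Complex.exp (2 * n * θ * Complex.I) = 1 := by
    rw [← Complex.exp_two_pi_mul_I]; congr 2
    rw [hθ]; push_cast
    have : (n : ℂ) ≠ 0 := by exact_mod_cast hn0
    field_simp
  rw [this, h, one_mul] at h2
  have h3 : zt α β θ (p • α + q • β) = 0 := by
    have : zt α β θ (u + p • α + q • β) = zt α β θ u + zt α β θ (p • α + q • β) := by
      unfold zt; simp only [LB_add]; push_cast; ring
    rw [this] at h2; simpa using h2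
  obtain ⟨hp, hq⟩ := zt_inj hα hβ hαβ hs p q h3
  rw [h, hp, hq]; simp

theorem rot_ord (hα : LB α α = 1) (hβ : LB β β = 1) (hαβ : LB α β = -Real.cos θ)
    {n : ℕ} (hn : 2 ≤ n) (hθ : θ = Real.pi / n) (d : ℕ)
    (h : (rp α hα * rp β hβ) ^ d = 1) : n ∣ d := by
  have hn0 : (n : ℝ) ≠ 0 := by positivity
  have hs : Real.sin θ ≠ 0 := by
    have : 0 < Real.sin θ := by
      apply Real.sin_pos_of_pos_of_lt_pi
      · rw [hθ]; positivity
      · rw [hθ]; apply div_lt_self Real.pi_pos; exact_mod_cast hn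
    exact this.ne'
  have h2 := zt_pow hα hβ hαβ d α
  rw [h] at h2
  have hz : zt α β θ α ≠ 0 := by
    intro h0
    have := zt_inj hα hβ hαβ hs 1 0 (by simpa using h0)
    simp at this
  have h3 : Complex.exp (2 * d * θ * Complex.I) = 1 := by
    have : (Complex.exp (2 * d * θ * Complex.I) - 1) * zt α β θ α = 0 := by
      rw [sub_mul, ← h2]; simp
    rcases mul_eq_zero.1 this with h | h
    · linear_combination h
    · exact absurd h hz
  rw [Complex.exp_eq_one_iff] at h3
  obtain ⟨m, hm⟩ := h3
  have h4 : (d : ℝ) = m * n := by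
    have hpi : (Real.pi : ℂ) ≠ 0 := by exact_mod_cast Real.pi_ne_zero
    have hnc : (n : ℂ) ≠ 0 := by exact_mod_cast hn0
    rw [hθ] at hm
    have : (d : ℂ) = m * n := by
      push_cast at hm
      have h5 : (2 * Real.pi * Complex.I : ℂ) * (d - m * n) = 0 := by
        field_simp at hm
        linear_combination 2 * (Real.pi : ℂ) * Complex.I * hm
      have h6 := mul_eq_zero.1 h5
      rcases h6 with h | h
      · exact absurd h Complex.two_pi_I_ne_zero
      · linear_combination h
    exact_mod_cast this
  have h5 : (d : ℤ) = m * n := by exact_mod_cast h4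
  have : (n : ℤ) ∣ d := ⟨m, by rw [h5]; ring⟩
  exact_mod_cast this

end two

end TG


namespace TG

section trig

theorem cos_mono {k : ℕ} (hk : 1 ≤ k) {γ : ℝ} (hγ : γ = Real.pi / k) (r m : ℕ) (h1 : r ≤ m)
    (h2 : m + r ≤ 2 * k) : Real.cos (m * γ) ≤ Real.cos (r * γ) := by
  have hk0 : (0 : ℝ) < k := by exact_mod_cast hk
  have hkγ : k * γ = Real.pi := by rw [hγ]; field_simp
  have hγ0 : 0 < γ := by rw [hγ]; exact div_pos Real.pi_pos hk0
  have h1' : (r : ℝ) ≤ m := by exact_mod_cast h1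
  have h2' : (m : ℝ) + r ≤ 2 * k := by exact_mod_cast h2
  have hr0 : (0 : ℝ) ≤ r * γ := by positivity
  by_cases hm : m ≤ k
  · apply Real.cos_le_cos_of_nonneg_of_le_pi hr0
    · rw [← hkγ]; gcongr
    · gcongr
  · have : Real.cos (m * γ) = Real.cos ((2 * k - m : ℝ) * γ) := by
      rw [sub_mul, mul_assoc, hkγ, Real.cos_two_pi_sub]
    rw [this]
    have hm' : (k : ℝ) ≤ m := by exact_mod_cast (not_le.1 hm).le
    apply Real.cos_le_cos_of_nonneg_of_le_pi hr0
    · rw [← hkγ]; nlinarith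
    · nlinarith

/-- The boundary vectors of the polygon around the base point. -/
noncomputable def be (x y γ : ℝ) (l : ℕ) : ℝ × ℝ :=
  if l % 2 = 0 then
    (x * Real.cos (l * γ) + y * Real.cos (l * γ - γ), x * Real.sin (l * γ) + y * Real.sin (l * γ - γ))
  else
    (x * Real.cos (l * γ - γ) + y * Real.cos (l * γ), x * Real.sin (l * γ - γ) + y * Real.sin (l * γ))

theorem be_normSq (x y γ : ℝ) (l : ℕ) :
    (be x y γ l).1 ^ 2 + (be x y γ l).2 ^ 2 = x ^ 2 + y ^ 2 + 2 * x * y * Real.cos γ := by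
  have h : Real.cos γ = Real.cos (l * γ) * Real.cos (l * γ - γ)
      + Real.sin (l * γ) * Real.sin (l * γ - γ) := by
    rw [← Real.cos_sub]; congr 1; ring
  have h1 := Real.sin_sq_add_cos_sq (l * γ)
  have h2 := Real.sin_sq_add_cos_sq (l * γ - γ)
  unfold be
  split_ifs
  · rw [h]; linear_combination x ^ 2 * h1 + y ^ 2 * h2
  · rw [h]; linear_combination x ^ 2 * h2 + y ^ 2 * h1

theorem be_dot {k : ℕ} (hk : 6 ≤ k) {γ : ℝ} (hγ : γ = Real.pi / k) {x y : ℝ} (hx : 0 ≤ x) (hy : 0 ≤ y)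
    (l l' : ℕ) (h1 : l + 2 ≤ l') (h2 : l' + 2 ≤ l + 2 * k) :
    (be x y γ l).1 * (be x y γ l').1 + (be x y γ l).2 * (be x y γ l').2 ≤
      (x ^ 2 + y ^ 2 + 2 * x * y * Real.cos γ) * Real.cos (2 * γ) := by
  obtain ⟨e, rfl⟩ := Nat.exists_eq_add_of_le (show l ≤ l' by omega)
  have hxy : 0 ≤ x * y := mul_nonneg hx hy
  have hx2 := sq_nonneg x
  have hy2 := sq_nonneg y
  have c2 : ∀ m : ℕ, 2 ≤ m → m + 2 ≤ 2 * k → Real.cos (m * γ) ≤ Real.cos (2 * γ) := by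
    intro m ha hb
    have := cos_mono (by omega : 1 ≤ k) hγ 2 m ha hb
    exact_mod_cast this
  have c3 : ∀ m : ℕ, 3 ≤ m → m + 3 ≤ 2 * k → Real.cos (m * γ) ≤ Real.cos γ * Real.cos (2 * γ) := by
    intro m ha hb
    have := cos_mono (by omega : 1 ≤ k) hγ 3 m ha hb
    refine this.trans ?_
    have hkr : (6 : ℝ) ≤ k := by exact_mod_cast hk
    have hk0 : (0 : ℝ) < k := by linarith
    have hγ0 : 0 < γ := by rw [hγ]; exact div_pos Real.pi_pos hk0
    have hkγ : k * γ = Real.pi := by rw [hγ]; field_simp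
    have e3 : ((3 : ℕ) : ℝ) * γ = γ + 2 * γ := by push_cast; ring
    rw [e3, Real.cos_add]
    have s1 : 0 ≤ Real.sin γ := Real.sin_nonneg_of_nonneg_of_le_pi hγ0.le (by nlinarith)
    have s2 : 0 ≤ Real.sin (2 * γ) :=
      Real.sin_nonneg_of_nonneg_of_le_pi (by linarith) (by nlinarith)
    nlinarith [mul_nonneg s1 s2]
  rcases Nat.even_or_odd' l with ⟨n, rfl | rfl⟩ <;> rcases Nat.even_or_odd' e with ⟨d, rfl | rfl⟩
  · have p1 : (2 * n) % 2 = 0 := by omega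
    have p2 : (2 * n + 2 * d) % 2 = 0 := by omega
    unfold be
    simp only [p1, p2, if_true]
    have := c2 (2 * d) (by omega) (by omega)
    have hD : 0 ≤ x ^ 2 + y ^ 2 + 2 * x * y * Real.cos γ := by
      rw [← be_normSq x y γ 0]; positivity
    refine le_trans (le_of_eq ?_) (mul_le_mul_of_nonneg_left this hD)
    have E1 : ((2 * n + 2 * d : ℕ) : ℝ) * γ = (2 * n : ℕ) * γ + (2 * d : ℕ) * γ := by
      push_cast; ring
    rw [E1]
    generalize ((2 * n : ℕ) : ℝ) * γ = A
    generalize ((2 * d : ℕ) : ℝ) * γ = B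
    have t1 : Real.cos A * Real.cos (A + B) + Real.sin A * Real.sin (A + B) = Real.cos B := by
      rw [← Real.cos_sub, ← Real.cos_neg]; congr 1; ring
    have t2 : Real.cos (A - γ) * Real.cos (A + B - γ) + Real.sin (A - γ) * Real.sin (A + B - γ)
        = Real.cos B := by
      rw [← Real.cos_sub, ← Real.cos_neg]; congr 1; ring
    have t3 : Real.cos A * Real.cos (A + B - γ) + Real.sin A * Real.sin (A + B - γ)
        = Real.cos (B - γ) := by
      rw [← Real.cos_sub, ← Real.cos_neg]; congr 1; ring
    have t4 : Real.cos (A - γ) * Real.cos (A + B) + Real.sin (A - γ) * Real.sin (A + B)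
        = Real.cos (B + γ) := by
      rw [← Real.cos_sub, ← Real.cos_neg]; congr 1; ring
    rw [Real.cos_sub B γ] at t3
    rw [Real.cos_add B γ] at t4
    linear_combination x ^ 2 * t1 + y ^ 2 * t2 + x * y * t3 + x * y * t4
  · have p1 : (2 * n) % 2 = 0 := by omega
    have p2 : ¬ (2 * n + (2 * d + 1)) % 2 = 0 := by omega
    unfold be
    simp only [p1, p2, if_true, if_false]
    have a1 := mul_le_mul_of_nonneg_left (c2 (2 * d) (by omega) (by omega)) hx2
    have a2 := mul_le_mul_of_nonneg_left (c2 (2 * d + 2) (by omega) (by omega)) hy2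
    have a3 := mul_le_mul_of_nonneg_left (c3 (2 * d + 1) (by omega) (by omega)) hxy
    have E1 : ((2 * n + (2 * d + 1) : ℕ) : ℝ) * γ = (2 * n : ℕ) * γ + (2 * d : ℕ) * γ + γ := by
      push_cast; ring
    have E2 : ((2 * d + 2 : ℕ) : ℝ) * γ = (2 * d : ℕ) * γ + 2 * γ := by push_cast; ring
    have E3 : ((2 * d + 1 : ℕ) : ℝ) * γ = (2 * d : ℕ) * γ + γ := by push_cast; ring
    rw [E1]; rw [E2] at a2; rw [E3] at a3
    generalize ((2 * n : ℕ) : ℝ) * γ = A at *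
    generalize ((2 * d : ℕ) : ℝ) * γ = B at *
    have t1 : Real.cos A * Real.cos (A + B + γ - γ) + Real.sin A * Real.sin (A + B + γ - γ)
        = Real.cos B := by
      rw [← Real.cos_sub, ← Real.cos_neg]; congr 1; ring
    have t2 : Real.cos (A - γ) * Real.cos (A + B + γ) + Real.sin (A - γ) * Real.sin (A + B + γ)
        = Real.cos (B + 2 * γ) := by
      rw [← Real.cos_sub, ← Real.cos_neg]; congr 1; ring
    have t3 : Real.cos A * Real.cos (A + B + γ) + Real.sin A * Real.sin (A + B + γ)
        = Real.cos (B + γ) := by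
      rw [← Real.cos_sub, ← Real.cos_neg]; congr 1; ring
    have t4 : Real.cos (A - γ) * Real.cos (A + B + γ - γ)
        + Real.sin (A - γ) * Real.sin (A + B + γ - γ) = Real.cos (B + γ) := by
      rw [← Real.cos_sub, ← Real.cos_neg]; congr 1; ring
    rw [← t1] at a1; rw [← t2] at a2
    have a4 := a3
    rw [← t3] at a3; rw [← t4] at a4
    linarith
  · have p1 : ¬ (2 * n + 1) % 2 = 0 := by omega
    have p2 : ¬ (2 * n + 1 + 2 * d) % 2 = 0 := by omega
    unfold be
    simp only [p1, p2, if_false]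
    have := c2 (2 * d) (by omega) (by omega)
    have hD : 0 ≤ x ^ 2 + y ^ 2 + 2 * x * y * Real.cos γ := by
      rw [← be_normSq x y γ 0]; positivity
    refine le_trans (le_of_eq ?_) (mul_le_mul_of_nonneg_left this hD)
    have E1 : ((2 * n + 1 + 2 * d : ℕ) : ℝ) * γ = (2 * n + 1 : ℕ) * γ + (2 * d : ℕ) * γ := by
      push_cast; ring
    rw [E1]
    generalize ((2 * n + 1 : ℕ) : ℝ) * γ = A
    generalize ((2 * d : ℕ) : ℝ) * γ = B
    have t1 : Real.cos A * Real.cos (A + B) + Real.sin A * Real.sin (A + B) = Real.cos B := by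
      rw [← Real.cos_sub, ← Real.cos_neg]; congr 1; ring
    have t2 : Real.cos (A - γ) * Real.cos (A + B - γ) + Real.sin (A - γ) * Real.sin (A + B - γ)
        = Real.cos B := by
      rw [← Real.cos_sub, ← Real.cos_neg]; congr 1; ring
    have t3 : Real.cos A * Real.cos (A + B - γ) + Real.sin A * Real.sin (A + B - γ)
        = Real.cos (B - γ) := by
      rw [← Real.cos_sub, ← Real.cos_neg]; congr 1; ring
    have t4 : Real.cos (A - γ) * Real.cos (A + B) + Real.sin (A - γ) * Real.sin (A + B)
        = Real.cos (B + γ) := by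
      rw [← Real.cos_sub, ← Real.cos_neg]; congr 1; ring
    rw [Real.cos_sub B γ] at t3
    rw [Real.cos_add B γ] at t4
    linear_combination y ^ 2 * t1 + x ^ 2 * t2 + x * y * t3 + x * y * t4
  · have p1 : ¬ (2 * n + 1) % 2 = 0 := by omega
    have p2 : (2 * n + 1 + (2 * d + 1)) % 2 = 0 := by omega
    unfold be
    simp only [p1, p2, if_true, if_false]
    have a1 := mul_le_mul_of_nonneg_left (c2 (2 * d) (by omega) (by omega)) hy2
    have a2 := mul_le_mul_of_nonneg_left (c2 (2 * d + 2) (by omega) (by omega)) hx2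
    have a3 := mul_le_mul_of_nonneg_left (c3 (2 * d + 1) (by omega) (by omega)) hxy
    have E1 : ((2 * n + 1 + (2 * d + 1) : ℕ) : ℝ) * γ = (2 * n + 1 : ℕ) * γ + (2 * d : ℕ) * γ + γ := by
      push_cast; ring
    have E2 : ((2 * d + 2 : ℕ) : ℝ) * γ = (2 * d : ℕ) * γ + 2 * γ := by push_cast; ring
    have E3 : ((2 * d + 1 : ℕ) : ℝ) * γ = (2 * d : ℕ) * γ + γ := by push_cast; ring
    rw [E1]; rw [E2] at a2; rw [E3] at a3
    generalize ((2 * n + 1 : ℕ) : ℝ) * γ = A at *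
    generalize ((2 * d : ℕ) : ℝ) * γ = B at *
    have t1 : Real.cos A * Real.cos (A + B + γ - γ) + Real.sin A * Real.sin (A + B + γ - γ)
        = Real.cos B := by
      rw [← Real.cos_sub, ← Real.cos_neg]; congr 1; ring
    have t2 : Real.cos (A - γ) * Real.cos (A + B + γ) + Real.sin (A - γ) * Real.sin (A + B + γ)
        = Real.cos (B + 2 * γ) := by
      rw [← Real.cos_sub, ← Real.cos_neg]; congr 1; ring
    have t3 : Real.cos A * Real.cos (A + B + γ) + Real.sin A * Real.sin (A + B + γ)
        = Real.cos (B + γ) := by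
      rw [← Real.cos_sub, ← Real.cos_neg]; congr 1; ring
    have t4 : Real.cos (A - γ) * Real.cos (A + B + γ - γ)
        + Real.sin (A - γ) * Real.sin (A + B + γ - γ) = Real.cos (B + γ) := by
      rw [← Real.cos_sub, ← Real.cos_neg]; congr 1; ring
    rw [← t1] at a1; rw [← t2] at a2
    have a4 := a3
    rw [← t3] at a3; rw [← t4] at a4
    linarith

/-- Two far apart sides cannot both be bad. -/
theorem not_both_bad {k : ℕ} (hk : 6 ≤ k) {γ : ℝ} (hγ : γ = Real.pi / k) {x y τ : ℝ} (hx : 0 ≤ x)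
    (hy : 0 ≤ y) (hτ : 0 < τ) (hD : x ^ 2 + y ^ 2 + 2 * x * y * Real.cos γ = τ ^ 2 + 1)
    (hD2 : (τ ^ 2 + 1) * Real.cos (2 * γ) ≤ τ ^ 2 - 1)
    {s z1 z2 : ℝ} (hs : 0 < s) (hz : z1 ^ 2 + z2 ^ 2 < s ^ 2)
    (l l' : ℕ) (h1 : l + 2 ≤ l') (h2 : l' + 2 ≤ l + 2 * k)
    (b1 : s * τ ≤ z1 * (be x y γ l).1 + z2 * (be x y γ l).2)
    (b2 : s * τ ≤ z1 * (be x y γ l').1 + z2 * (be x y γ l').2) : False := by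
  have n1 := be_normSq x y γ l
  have n2 := be_normSq x y γ l'
  have n3 := be_dot hk hγ hx hy l l' h1 h2
  rw [hD] at n1 n2 n3
  generalize (be x y γ l).1 = p1 at *
  generalize (be x y γ l).2 = p2 at *
  generalize (be x y γ l').1 = q1 at *
  generalize (be x y γ l').2 = q2 at *
  have hn : (p1 + q1) ^ 2 + (p2 + q2) ^ 2 ≤ 4 * τ ^ 2 := by nlinarith
  have hsum : 2 * (s * τ) ≤ z1 * (p1 + q1) + z2 * (p2 + q2) := by linarith
  have hsτ : 0 < s * τ := mul_pos hs hτ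
  have hsq : (2 * (s * τ)) ^ 2 ≤ (z1 * (p1 + q1) + z2 * (p2 + q2)) ^ 2 :=
    pow_le_pow_left₀ (by linarith) hsum 2
  have hcs : (z1 * (p1 + q1) + z2 * (p2 + q2)) ^ 2 ≤ (z1 ^ 2 + z2 ^ 2) * (4 * τ ^ 2) := by
    have : (z1 * (p1 + q1) + z2 * (p2 + q2)) ^ 2 ≤
        (z1 ^ 2 + z2 ^ 2) * ((p1 + q1) ^ 2 + (p2 + q2) ^ 2) := by
      nlinarith [sq_nonneg (z1 * (p2 + q2) - z2 * (p1 + q1))]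
    refine this.trans (mul_le_mul_of_nonneg_left hn (by positivity))
  have : (z1 ^ 2 + z2 ^ 2) * (4 * τ ^ 2) < s ^ 2 * (4 * τ ^ 2) :=
    mul_lt_mul_of_pos_right hz (by positivity)
  nlinarith

theorem good_window {k : ℕ} (hk : 6 ≤ k) (bad : ℕ → Prop)
    (h : ∀ l l', l + 2 ≤ l' → l' + 2 ≤ l + 2 * k → bad l → bad l' → False) :
    ∃ m, ∀ l, m ≤ l → l < m + (2 * k - 2) → ¬ bad l := by
  by_cases hb : ∃ l0, bad l0
  · obtain ⟨l0, h0⟩ := hb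
    by_cases h1 : bad (l0 + 1)
    · refine ⟨l0 + 2, fun l ha hb hl => ?_⟩
      by_cases he : l + 2 ≤ l0 + 2 * k
      · exact h l0 l (by omega) (by omega) h0 hl
      · exact h (l0 + 1) l (by omega) (by omega) h1 hl
    · refine ⟨l0 + 1, fun l ha hb hl => ?_⟩
      by_cases he : l = l0 + 1
      · subst he; exact h1 hl
      · exact h l0 l (by omega) (by omega) h0 hl
  · push Not at hb
    exact ⟨0, fun l _ _ => hb l⟩

end trig
end TG


namespace TG

/-- Everything we use about the triangle group. -/
structure Geo {T : Type} [Group T] (a b : T) (i j k : ℕ) : Prop where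
  hi : 6 ≤ i
  hj : 6 ≤ j
  hk : 6 ≤ k
  ai : a ^ i = 1
  bj : b ^ j = 1
  ck : (a * b) ^ k = 1
  univ : ∀ (G : Type) [Group G] (A B : G), A ^ i = 1 → B ^ j = 1 → (A * B) ^ k = 1 →
    ∃ f : T →* G, f a = A ∧ f b = B
  gen : Subgroup.closure {a, b} = ⊤
  ord_a : ∀ d : ℕ, a ^ d = 1 → i ∣ d
  ord_b : ∀ d : ℕ, b ^ d = 1 → j ∣ d
  ca : ∀ (d : ℕ) (e : ℤ), (a * b) ^ d = a ^ e → k ∣ d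
  cb : ∀ (d : ℕ) (e : ℤ), (a * b) ^ d = b ^ e → k ∣ d
  height : ∃ H : T → ℝ, (∀ t, H (t * (a * b)) = H t) ∧ ∀ p, ∃ m : ℕ, ∀ n : ℕ,
    (m ≤ 2 * n → 2 * n < m + (2 * k - 2) → H p < H (p * (a * b) ^ n * a⁻¹)) ∧
    (m ≤ 2 * n + 1 → 2 * n + 1 < m + (2 * k - 2) → H p < H (p * (a * b) ^ n * a))

theorem rp_apply (α : E3) (h : LB α α = 1) (u : E3) : rp α h u = rf α u := rfl

/-- A vector orthogonal to both roots is fixed. -/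
theorem fix_of_orth {α β v : E3} (hα : LB α α = 1) (hβ : LB β β = 1) (h1 : LB v α = 0)
    (h2 : LB v β = 0) (e : ℤ) : ((rp α hα * rp β hβ) ^ e) v = v := by
  have : (rp α hα * rp β hβ) v = v := by
    rw [Equiv.Perm.mul_apply, rp_apply β, rf, h2]
    simp only [mul_zero, zero_smul, sub_zero]
    rw [rp_apply, rf, h1]; simp
  exact Equiv.Perm.zpow_apply_eq_self_of_apply_eq_self this e

/-- future timelike cone -/
def Fut (u : E3) : Prop := 0 < u.1 ∧ LB u u < 0

theorem Fut_rf {α : E3} (h : LB α α = 1) {u : E3} (hu : Fut u) : Fut (rf α u) := by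
  refine ⟨?_, by rw [LB_rf h]; exact hu.2⟩
  obtain ⟨h1, h2⟩ := hu
  have h3 : LB (rf α u) (rf α u) < 0 := by rw [LB_rf h]; exact h2
  have h4 : LB (rf α u) u < 0 := by
    unfold rf
    rw [LB_sub, LB_smul, LB_comm α u]
    nlinarith [sq_nonneg (LB u α)]
  generalize rf α u = v at *
  unfold LB at h2 h3 h4
  by_contra hv
  push Not at hv
  have hcs : (v.2.1 * u.2.1 + v.2.2 * u.2.2) ^ 2 ≤ (v.2.1 ^ 2 + v.2.2 ^ 2) * (u.2.1 ^ 2 + u.2.2 ^ 2) := by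
    nlinarith [sq_nonneg (v.2.1 * u.2.2 - v.2.2 * u.2.1)]
  have hlt : v.2.1 * u.2.1 + v.2.2 * u.2.2 < v.1 * u.1 := by linarith
  have hle : v.1 * u.1 ≤ 0 := mul_nonpos_of_nonpos_of_nonneg hv h1.le
  have : (v.1 * u.1) ^ 2 < (v.2.1 * u.2.1 + v.2.2 * u.2.2) ^ 2 := by nlinarith
  have h5 : (v.2.1 ^ 2 + v.2.2 ^ 2) * (u.2.1 ^ 2 + u.2.2 ^ 2) ≤ v.1 ^ 2 * u.1 ^ 2 := by
    apply mul_le_mul <;> first | positivity | nlinarith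
  nlinarith

/-- a rotation about the base point -/
noncomputable def rot (φ : ℝ) (u : E3) : E3 :=
  (u.1, u.2.1 * Real.cos φ - u.2.2 * Real.sin φ, u.2.1 * Real.sin φ + u.2.2 * Real.cos φ)

theorem rot_rot (φ ψ : ℝ) (u : E3) : rot φ (rot ψ u) = rot (φ + ψ) u := by
  simp only [rot, Real.cos_add, Real.sin_add]
  ext <;> simp <;> ring

theorem rot_zero (u : E3) : rot 0 u = u := by simp [rot]

set_option maxHeartbeats 2000000 in
theorem exists_geo (i j k : ℕ) (hi : 6 ≤ i) (hj : 6 ≤ j) (hk : 6 ≤ k)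
    {T : Type} [Group T] (a b : T) 
    (ai : a ^ i = 1) (bj : b ^ j = 1) (ck : (a * b) ^ k = 1)
    (univ : ∀ (G : Type) [Group G] (A B : G), A ^ i = 1 → B ^ j = 1 → (A * B) ^ k = 1 →
      ∃ f : T →* G, f a = A ∧ f b = B)
    (gen : Subgroup.closure {a, b} = ⊤) : Geo a b i j k := by
  have key : ∀ n : ℕ, 6 ≤ n → 0 < Real.pi / n ∧ Real.pi / n ≤ Real.pi / 6 ∧
      √3 / 2 ≤ Real.cos (Real.pi / n) := by
    intro n hn
    have hn' : (6 : ℝ) ≤ n := by exact_mod_cast hn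
    have h0 : 0 < Real.pi / n := div_pos Real.pi_pos (by linarith)
    have h1 : Real.pi / n ≤ Real.pi / 6 := div_le_div_of_nonneg_left Real.pi_pos.le (by norm_num) hn'
    refine ⟨h0, h1, ?_⟩
    rw [← Real.cos_pi_div_six]
    apply Real.cos_le_cos_of_nonneg_of_le_pi h0.le _ h1
    linarith [Real.pi_pos]
  obtain ⟨-, -, hqi⟩ := key i hi
  obtain ⟨-, -, hpj⟩ := key j hj
  obtain ⟨hγ0, hγ6, hck⟩ := key k hk
  obtain ⟨γ, hγ⟩ : ∃ γ, γ = Real.pi / k := ⟨_, rfl⟩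
  obtain ⟨p, hp⟩ : ∃ p, p = Real.cos (Real.pi / j) := ⟨_, rfl⟩
  obtain ⟨q, hq⟩ : ∃ q, q = Real.cos (Real.pi / i) := ⟨_, rfl⟩
  rw [← hγ] at hγ0 hγ6 hck
  rw [← hp] at hpj
  rw [← hq] at hqi
  have hsin : 0 < Real.sin γ := Real.sin_pos_of_pos_of_lt_pi hγ0 (by linarith [Real.pi_pos])
  have h3 : √3 ^ 2 = 3 := Real.sq_sqrt (by norm_num)
  have h30 : 0 < √3 := by positivity
  have hsc := Real.sin_sq_add_cos_sq γ
  have hs4 : Real.sin γ ^ 2 ≤ 1 / 4 := by nlinarith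
  set x := p / Real.sin γ with hx
  set y := q / Real.sin γ with hy
  have hxs : x * Real.sin γ = p := by rw [hx]; field_simp
  have hys : y * Real.sin γ = q := by rw [hy]; field_simp
  have hx0 : 0 ≤ x := div_nonneg (by linarith) hsin.le
  have hy0 : 0 ≤ y := div_nonneg (by linarith) hsin.le
  obtain ⟨D, hD⟩ : ∃ D, D = x ^ 2 + y ^ 2 + 2 * x * y * Real.cos γ := ⟨_, rfl⟩
  have hDs : 1 ≤ D * Real.sin γ ^ 2 := by
    have : D * Real.sin γ ^ 2 = p ^ 2 + q ^ 2 + 2 * (p * q) * Real.cos γ := by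
      rw [hD, ← hxs, ← hys]; ring
    rw [this]
    have h5 : 0 ≤ 2 * (p * q) * Real.cos γ := by
      apply mul_nonneg
      · apply mul_nonneg (by norm_num); apply mul_nonneg <;> linarith
      · linarith
    nlinarith
  have hD1 : 1 < D := by
    by_contra h
    push Not at h
    have : D * Real.sin γ ^ 2 ≤ 1 * (1 / 4) := by
      apply mul_le_mul h hs4 (by positivity) (by norm_num)
    linarith
  obtain ⟨τ, hτdef⟩ : ∃ τ, τ = √(D - 1) := ⟨_, rfl⟩
  have hτ : 0 < τ := by rw [hτdef]; exact Real.sqrt_pos.2 (by linarith)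
  have hτ2 : D = τ ^ 2 + 1 := by rw [hτdef, Real.sq_sqrt (by linarith)]; ring
  have hD2 : (τ ^ 2 + 1) * Real.cos (2 * γ) ≤ τ ^ 2 - 1 := by
    rw [← hτ2, Real.cos_two_mul, ← sub_eq_iff_eq_add'.2 hsc.symm]
    linarith
  -- roots
  set αA : E3 := (0, -Real.sin γ, -Real.cos γ) with hαA
  set αB : E3 := (0, 0, 1) with hαB
  set αC : E3 := (τ, x + y * Real.cos γ, -(y * Real.sin γ)) with hαC
  have nA : LB αA αA = 1 := by simp [LB, hαA]; linarith
  have nB : LB αB αB = 1 := by simp [LB, hαB]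
  have nC : LB αC αC = 1 := by 
    simp only [LB, hαC]
    have : -τ * τ = 1 - D := by rw [hτ2]; ring
    rw [this, hD]
    linear_combination (y ^ 2) * hsc
  have nBC : LB αB αC = -Real.cos (Real.pi / i) := by
    rw [← hq, ← hys]; simp [LB, hαB, hαC]
  have nCA : LB αC αA = -Real.cos (Real.pi / j) := by
    rw [← hp, ← hxs]; simp [LB, hαA, hαC]; ring
  have nBA : LB αB αA = -Real.cos γ := by simp [LB, hαB, hαA]
  set PA := rp αA nA with hPA
  set PB := rp αB nB with hPB
  set PC := rp αC nC with hPC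
  have CC : PC * PC = 1 := by ext1 u; exact rf_rf nC u
  have BB : PB * PB = 1 := by ext1 u; exact rf_rf nB u
  have AA : PA * PA = 1 := by ext1 u; exact rf_rf nA u
  have eab : (PB * PC) * (PC * PA) = PB * PA := by
    rw [mul_assoc, ← mul_assoc PC, CC, one_mul]
  obtain ⟨ψ, ψa, ψb⟩ := univ (Equiv.Perm E3) (PB * PC) (PC * PA)
    (rot_pow nB nC nBC (by omega) rfl) (rot_pow nC nA nCA (by omega) rfl)
    (by rw [eab]; exact rot_pow nB nA nBA (by omega) hγ)
  have ψc : ψ (a * b) = PB * PA := by rw [map_mul, ψa, ψb, eab]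
  have ψcr : ∀ u, ψ (a * b) u = rot (2 * γ) u := by
    intro u
    rw [ψc, Equiv.Perm.mul_apply]
    show rf αB (rf αA u) = _
    simp only [rf, LB, rot, hαA, hαB, Real.cos_two_mul, Real.sin_two_mul]
    ext <;> simp
    · linear_combination (-2 * u.2.1) * hsc
    · ring
  have ψcn : ∀ (n : ℕ) u, ψ ((a * b) ^ n) u = rot (2 * γ * n) u := by
    intro n u
    induction n with
    | zero => simp [rot_zero]
    | succ n ih =>
      rw [pow_succ', map_mul, Equiv.Perm.mul_apply, ih, ψcr, rot_rot]
      congr 1; push_cast; ring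
  have ψcni : ∀ (n : ℕ) u, ψ ((a * b) ^ n)⁻¹ u = rot (-(2 * γ * n)) u := by
    intro n u
    rw [map_inv, Equiv.Perm.inv_eq_iff_eq, ψcn, rot_rot]; simp [rot_zero]
  have k0 : (k : ℝ) ≠ 0 := by have : (6 : ℝ) ≤ k := by exact_mod_cast hk
                              linarith
  have hdvd : ∀ d : ℕ, ∀ v : E3, v.2.1 ^ 2 + v.2.2 ^ 2 ≠ 0 → ψ ((a * b) ^ d) v = v → k ∣ d := by
    intro d v hv hf
    rw [ψcn] at hf
    have e1 := congrArg (fun w : E3 => w.2.1) hf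
    have e2 := congrArg (fun w : E3 => w.2.2) hf
    simp only [rot] at e1 e2
    have : (v.2.1 ^ 2 + v.2.2 ^ 2) * (Real.cos (2 * γ * d) - 1) = 0 := by
      linear_combination v.2.1 * e1 + v.2.2 * e2
    have hc : Real.cos (2 * γ * d) = 1 := by
      rcases mul_eq_zero.1 this with h | h
      · exact absurd h hv
      · linarith
    rw [Real.cos_eq_one_iff] at hc
    obtain ⟨m, hm⟩ := hc
    have h4 : (d : ℝ) = m * k := by
      rw [hγ] at hm
      field_simp at hm
      linarith
    have h5 : (d : ℤ) = m * k := by exact_mod_cast h4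
    have : (k : ℤ) ∣ d := ⟨m, by rw [h5]; ring⟩
    exact_mod_cast this
  -- future cone
  have hfut : ∀ t : T, Fut (ψ t (1, 0, 0)) := by
    have hF : ∀ t : T, ∀ u, Fut u → Fut (ψ t u) := by
      intro t
      have ht : t ∈ Subgroup.closure {a, b} := by rw [gen]; trivial
      induction ht using Subgroup.closure_induction'' with
      | one => intro u hu; simpa using hu
      | mem t ht =>
        intro u hu
        rcases ht with rfl | rfl
        · rw [ψa]; exact Fut_rf nB (Fut_rf nC hu)
        · rw [ψb]; exact Fut_rf nC (Fut_rf nA hu)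
      | inv_mem t ht =>
        intro u hu
        rcases ht with rfl | rfl
        · rw [map_inv, ψa, show (PB * PC)⁻¹ = PC * PB by
            rw [inv_eq_iff_mul_eq_one, mul_assoc, ← mul_assoc PC, CC, one_mul, BB]]
          exact Fut_rf nC (Fut_rf nB hu)
        · rw [map_inv, ψb, show (PC * PA)⁻¹ = PA * PC by
            rw [inv_eq_iff_mul_eq_one, mul_assoc, ← mul_assoc PA, AA, one_mul, CC]]
          exact Fut_rf nA (Fut_rf nC hu)
      | mul s t _ _ h1 h2 =>
        intro u hu
        rw [map_mul]; exact h1 _ (h2 _ hu)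
    intro t
    exact hF t _ ⟨by norm_num, by simp [LB]⟩
  refine ⟨hi, hj, hk, ai, bj, ck, univ, gen, ?_, ?_, ?_, ?_, ?_⟩
  · intro d hd
    have := congrArg ψ hd
    rw [map_pow, ψa, map_one] at this
    exact rot_ord nB nC nBC (by omega) rfl d this
  · intro d hd
    have := congrArg ψ hd
    rw [map_pow, ψb, map_one] at this
    exact rot_ord nC nA nCA (by omega) rfl d this
  · intro d e hd
    apply hdvd d (x + y * Real.cos γ, τ, 0) (by simp; exact hτ.ne')
    rw [hd, map_zpow, ψa]
    apply fix_of_orth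
    · simp [LB, hαB]
    · simp [LB, hαC]; ring
  · intro d e hd
    apply hdvd d (x * Real.cos γ + y, τ * Real.cos γ, -(τ * Real.sin γ))
    · have : (τ * Real.cos γ) ^ 2 + (-(τ * Real.sin γ)) ^ 2 = τ ^ 2 := by
        linear_combination τ ^ 2 * hsc
      simp only [this]; positivity
    rw [hd, map_zpow, ψb]
    apply fix_of_orth
    · simp [LB, hαC]; linear_combination (y * τ) * hsc
    · simp [LB, hαA]; ring
  · refine ⟨fun t => (ψ t⁻¹ (1, 0, 0)).1, ?_, ?_⟩
    · intro t
      show (ψ (t * (a * b))⁻¹ (1, 0, 0)).1 = (ψ t⁻¹ (1, 0, 0)).1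
      have h1 := ψcni 1 (ψ t⁻¹ (1, 0, 0))
      rw [mul_inv_rev, map_mul, Equiv.Perm.mul_apply]
      rw [pow_one] at h1
      rw [h1]; rfl
    · intro p
      obtain ⟨u, hu⟩ : ∃ u, u = ψ p⁻¹ (1, 0, 0) := ⟨_, rfl⟩
      have hFu : Fut u := by rw [hu]; exact hfut _
      obtain ⟨hu0, hu1⟩ := hFu
      unfold LB at hu1
      obtain ⟨m, hm⟩ := good_window hk
        (fun l => u.1 * τ ≤ u.2.1 * (be x y γ l).1 + u.2.2 * (be x y γ l).2)
        (fun l l' h1 h2 h3 h4 => not_both_bad hk hγ hx0 hy0 hτ (hD.symm.trans hτ2) hD2 hu0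
          (by nlinarith) l l' h1 h2 h3 h4)
      refine ⟨m, fun n => ⟨fun h1 h2 => ?_, fun h1 h2 => ?_⟩⟩
      · have h := not_le.1 (hm _ h1 h2)
        have pm : (2 * n) % 2 = 0 := by omega
        simp only [be, pm, if_true] at h
        show (ψ p⁻¹ (1, 0, 0)).1 < (ψ (p * (a * b) ^ n * a⁻¹)⁻¹ (1, 0, 0)).1
        rw [mul_inv_rev, mul_inv_rev, inv_inv, map_mul, map_mul, Equiv.Perm.mul_apply,
          Equiv.Perm.mul_apply, ← hu, ψcni, ψa]
        show u.1 < (rf αB (rf αC _)).1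
        simp only [rf, LB, hαB, hαC, rot, Real.cos_neg, Real.sin_neg]
        have eA : ((2 * n : ℕ) : ℝ) * γ = 2 * γ * n := by push_cast; ring
        rw [eA] at h
        simp only [Real.cos_sub, Real.sin_sub] at h
        generalize 2 * γ * n = A at *
        simp
        linarith [mul_pos hτ (sub_pos.2 h)]
      · have h := not_le.1 (hm _ h1 h2)
        have pm : ¬ (2 * n + 1) % 2 = 0 := by omega
        simp only [be, pm, if_false] at h
        show (ψ p⁻¹ (1, 0, 0)).1 < (ψ (p * (a * b) ^ n * a)⁻¹ (1, 0, 0)).1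
        rw [mul_inv_rev, mul_inv_rev, map_mul, map_mul, Equiv.Perm.mul_apply,
          Equiv.Perm.mul_apply, ← hu, ψcni, map_inv, ψa, show (PB * PC)⁻¹ = PC * PB by
            rw [inv_eq_iff_mul_eq_one, mul_assoc, ← mul_assoc PC, CC, one_mul, BB]]
        show u.1 < (rf αC (rf αB _)).1
        simp only [rf, LB, hαB, hαC, rot, Real.cos_neg, Real.sin_neg]
        have eA : ((2 * n + 1 : ℕ) : ℝ) * γ = 2 * γ * n + γ := by push_cast; ring
        rw [eA] at h
        rw [add_sub_cancel_right] at h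
        simp only [Real.cos_add, Real.sin_add] at h
        generalize 2 * γ * n = A at *
        simp
        linarith [mul_pos hτ (sub_pos.2 h)]

end TG


namespace TG

section chains
variable {T : Type} [Group T]

/-- Vertices of the coset graph. -/
abbrev Vt (a b : T) := (T ⧸ Subgroup.zpowers a) ⊕ (T ⧸ Subgroup.zpowers b)

/-- the `a`-vertex of an edge -/
def VA (a b t : T) : Vt a b := Sum.inl (QuotientGroup.mk t)
/-- the `b`-vertex of an edge -/
def VB (a b t : T) : Vt a b := Sum.inr (QuotientGroup.mk t)

/-- the generator of the stabilizer at a vertex -/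
def gn {a b : T} (v : Vt a b) : T := Sum.elim (fun _ => a) (fun _ => b) v

@[simp] theorem gn_VA (a b t : T) : gn (VA a b t) = a := rfl
@[simp] theorem gn_VB (a b t : T) : gn (VB a b t) = b := rfl

/-- the edge `t` joins `u` and `v` -/
def Jn {a b : T} (t : T) (u v : Vt a b) : Prop :=
  (u = VA a b t ∧ v = VB a b t) ∨ (u = VB a b t ∧ v = VA a b t)

theorem Jn.symm {a b t : T} {u v : Vt a b} (h : Jn t u v) : Jn t v u := by
  rcases h with ⟨h1, h2⟩ | ⟨h1, h2⟩
  · exact Or.inr ⟨h2, h1⟩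
  · exact Or.inl ⟨h2, h1⟩

theorem VA_ne_VB (a b t s : T) : VA a b t ≠ VB a b s := by simp [VA, VB]

theorem Jn.ne {a b t : T} {u v : Vt a b} (h : Jn t u v) : u ≠ v := by
  rcases h with ⟨rfl, rfl⟩ | ⟨rfl, rfl⟩
  · exact VA_ne_VB _ _ _ _
  · exact (VA_ne_VB _ _ _ _).symm

theorem VA_eq {a b t s : T} : VA a b t = VA a b s ↔ ∃ n : ℤ, s = t * a ^ n := by
  unfold VA
  rw [Sum.inl_injective.eq_iff, QuotientGroup.eq, Subgroup.mem_zpowers_iff]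
  constructor
  · rintro ⟨n, h⟩; exact ⟨n, by rw [h]; group⟩
  · rintro ⟨n, h⟩; exact ⟨n, by rw [h]; group⟩

theorem VB_eq {a b t s : T} : VB a b t = VB a b s ↔ ∃ n : ℤ, s = t * b ^ n := by
  unfold VB
  rw [Sum.inr_injective.eq_iff, QuotientGroup.eq, Subgroup.mem_zpowers_iff]
  constructor
  · rintro ⟨n, h⟩; exact ⟨n, by rw [h]; group⟩
  · rintro ⟨n, h⟩; exact ⟨n, by rw [h]; group⟩

theorem VA_mul (a b t : T) : VA a b (t * a) = VA a b t :=
  (VA_eq.2 ⟨1, by simp⟩).symm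

theorem VB_mul (a b t : T) : VB a b (t * b) = VB a b t :=
  (VB_eq.2 ⟨1, by simp⟩).symm

theorem smul_VA (a b g t : T) : g • VA a b t = VA a b (g * t) := rfl
theorem smul_VB (a b g t : T) : g • VB a b t = VB a b (g * t) := rfl

theorem gn_smul {a b : T} (g : T) (v : Vt a b) : gn (g • v) = gn v := by
  rcases v with v | v <;> rfl

theorem Jn.smul {a b t : T} {u v : Vt a b} (g : T) (h : Jn t u v) : Jn (g * t) (g • u) (g • v) := by
  rcases h with ⟨rfl, rfl⟩ | ⟨rfl, rfl⟩
  · exact Or.inl ⟨rfl, rfl⟩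
  · exact Or.inr ⟨rfl, rfl⟩

/-- mod 2 chains on edges -/
abbrev Ch (T : Type) := T →₀ ZMod 2

/-- boundaries of unions of faces -/
def Qs (a b : T) : AddSubgroup (Ch T) where
  carrier := {f | ∃ γ : Ch T, (∀ t, γ (t * (a * b)) = γ t) ∧ ∀ t, f t = γ (t * a⁻¹) + γ t}
  add_mem' := by
    rintro f f' ⟨γ, h1, h2⟩ ⟨γ', h1', h2'⟩
    refine ⟨γ + γ', fun t => ?_, fun t => ?_⟩
    · simp [h1, h1']
    · simp [h2, h2']; ring
  zero_mem' := ⟨0, by simp, by simp⟩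
  neg_mem' := by
    rintro f ⟨γ, h1, h2⟩
    refine ⟨-γ, fun t => ?_, fun t => ?_⟩
    · simp [h1]
    · simp [h2]; ring

/-- the single edge chain -/
noncomputable def sg (t : T) : Ch T := Finsupp.single t 1

theorem two_ch (f : Ch T) : f + f = 0 := by
  ext t; simp; exact CharTwo.add_self_eq_zero _

theorem neg_ch (f : Ch T) : -f = f := neg_eq_of_add_eq_zero_right (two_ch f)

/-- chains modulo face boundaries -/
abbrev VQ (a b : T) := Ch T ⧸ Qs a b

theorem two_vq {a b : T} (v : VQ a b) : v + v = 0 := by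
  induction v using QuotientAddGroup.induction_on with
  | H f => rw [← QuotientAddGroup.mk_add, two_ch]; rfl

/-- the class of an edge -/
noncomputable def cl (a b t : T) : VQ a b := QuotientAddGroup.mk (sg t)

/-- right translation by `a` -/
noncomputable def σa (a b : T) : Equiv.Perm (VQ a b × T) where
  toFun x := (x.1 + cl a b (x.2 * a) + cl a b x.2, x.2 * a)
  invFun x := (x.1 + cl a b (x.2 * a⁻¹) + cl a b x.2, x.2 * a⁻¹)
  left_inv x := by
    ext1
    · simp only [mul_inv_cancel_right]
      have h1 := two_vq (cl a b (x.2 * a))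
      have h2 := two_vq (cl a b x.2)
      calc _ = x.1 + (cl a b (x.2 * a) + cl a b (x.2 * a)) + (cl a b x.2 + cl a b x.2) := by abel
        _ = x.1 := by rw [h1, h2]; simp
    · simp
  right_inv x := by
    ext1
    · simp only [inv_mul_cancel_right]
      have h1 := two_vq (cl a b (x.2 * a⁻¹))
      have h2 := two_vq (cl a b x.2)
      calc _ = x.1 + (cl a b (x.2 * a⁻¹) + cl a b (x.2 * a⁻¹)) + (cl a b x.2 + cl a b x.2) := by abel
        _ = x.1 := by rw [h1, h2]; simp
    · simp

/-- right translation by `b` -/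
def σb (a b : T) : Equiv.Perm (VQ a b × T) where
  toFun x := (x.1, x.2 * b)
  invFun x := (x.1, x.2 * b⁻¹)
  left_inv x := by simp
  right_inv x := by simp

theorem σa_pow (a b : T) (n : ℕ) (x : VQ a b × T) :
    (σa a b ^ n) x = (x.1 + cl a b (x.2 * a ^ n) + cl a b x.2, x.2 * a ^ n) := by
  induction n with
  | zero => ext1 <;> simp [add_assoc, two_vq]
  | succ n ih =>
    rw [pow_succ', Equiv.Perm.mul_apply, ih]
    show (_ + cl a b (x.2 * a ^ n * a) + cl a b (x.2 * a ^ n), x.2 * a ^ n * a) = _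
    rw [mul_assoc, ← pow_succ]
    ext1
    · have h1 := two_vq (cl a b (x.2 * a ^ n))
      show x.1 + cl a b (x.2 * a ^ n) + cl a b x.2 + cl a b (x.2 * a ^ (n + 1)) + cl a b (x.2 * a ^ n) = _
      calc _ = x.1 + cl a b (x.2 * a ^ (n + 1)) + cl a b x.2 +
            (cl a b (x.2 * a ^ n) + cl a b (x.2 * a ^ n)) := by abel
        _ = _ := by rw [h1]; simp
    · rfl

theorem σb_pow (a b : T) (n : ℕ) (x : VQ a b × T) : (σb a b ^ n) x = (x.1, x.2 * b ^ n) := by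
  induction n with
  | zero => simp
  | succ n ih =>
    rw [pow_succ', Equiv.Perm.mul_apply, ih]
    show (x.1, x.2 * b ^ n * b) = _
    rw [mul_assoc, ← pow_succ]

theorem σba_pow (a b : T) (n : ℕ) (x : VQ a b × T) : ((σb a b * σa a b) ^ n) x =
    (x.1 + QuotientAddGroup.mk (∑ l ∈ Finset.range n, (sg (x.2 * (a * b) ^ l * a) + sg (x.2 * (a * b) ^ l))),
      x.2 * (a * b) ^ n) := by
  induction n with
  | zero => simp
  | succ n ih =>
    rw [pow_succ', Equiv.Perm.mul_apply, ih, Finset.sum_range_succ]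
    show (_ + cl a b (x.2 * (a * b) ^ n * a) + cl a b (x.2 * (a * b) ^ n), x.2 * (a * b) ^ n * a * b) = _
    ext1
    · simp only [QuotientAddGroup.mk_add, cl]; abel
    · simp only [pow_succ, mul_assoc]

theorem face_mem {a b : T} {k : ℕ} (hc : (a * b) ^ k = 1) (p : T) :
    ∑ l ∈ Finset.range k, (sg (p * (a * b) ^ l * a) + sg (p * (a * b) ^ l)) ∈ Qs a b := by
  classical
  refine ⟨∑ l ∈ Finset.range k, sg (p * (a * b) ^ l), fun t => ?_, fun t => ?_⟩
  · simp only [Finsupp.finsetSum_apply, sg]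
    rcases k with _ | k
    · simp
    · rw [Finset.sum_range_succ', Finset.sum_range_succ _ k]
      congr 1
      · apply Finset.sum_congr rfl
        intro l _
        rw [Finsupp.single_apply, Finsupp.single_apply]
        simp only [pow_succ, ← mul_assoc, mul_left_inj]
      · rw [Finsupp.single_apply, Finsupp.single_apply]
        congr 1
        rw [pow_succ, ← eq_inv_iff_mul_eq_one] at hc
        rw [hc]
        apply propext
        rw [pow_zero, mul_one, mul_inv_eq_iff_eq_mul]
  · simp only [Finsupp.finsetSum_apply, sg, ← Finset.sum_add_distrib]
    apply Finset.sum_congr rfl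
    intro l _
    rw [Finsupp.add_apply]
    congr 1
    rw [Finsupp.single_apply, Finsupp.single_apply]
    congr 1
    apply propext
    rw [eq_mul_inv_iff_mul_eq]

/-- existence of potentials -/
theorem exists_z {a b : T} {i j k : ℕ} (hG : Geo a b i j k) :
    ∃ z : T → VQ a b, (∀ g, z (g * a) = z g + cl a b (g * a) + cl a b g) ∧ ∀ g, z (g * b) = z g := by
  obtain ⟨Φ, hΦa, hΦb⟩ := hG.univ (Equiv.Perm (VQ a b × T)) (σa a b)⁻¹ (σb a b)⁻¹
    (by
      rw [inv_pow, inv_eq_one]; ext1 x; rw [σa_pow, hG.ai]; ext1 <;> simp [add_assoc, two_vq])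
    (by rw [inv_pow, inv_eq_one]; ext1 x; rw [σb_pow, hG.bj]; simp)
    (by
      rw [← mul_inv_rev, inv_pow, inv_eq_one]; ext1 x; rw [σba_pow, hG.ck,
        (QuotientAddGroup.eq_zero_iff _).2 (face_mem hG.ck x.2)]; simp)
  have ha : ∀ g, Φ ((g * a)⁻¹) (0, 1) = σa a b (Φ g⁻¹ (0, 1)) := by
    intro g
    rw [mul_inv_rev, map_mul, map_inv Φ a, hΦa]; simp
  have hb : ∀ g, Φ ((g * b)⁻¹) (0, 1) = σb a b (Φ g⁻¹ (0, 1)) := by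
    intro g
    rw [mul_inv_rev, map_mul, map_inv Φ b, hΦb]; simp
  have h2 : ∀ g, (Φ g⁻¹ (0, 1)).2 = g := by
    have key : ∀ g, ∀ x, (Φ g⁻¹ x).2 = x.2 * g := by
      intro g
      have hg : g ∈ Subgroup.closure {a, b} := by rw [hG.gen]; trivial
      induction hg using Subgroup.closure_induction'' with
      | one => intro x; simp
      | mem t ht =>
        intro x
        rcases ht with rfl | rfl
        · rw [map_inv, hΦa, inv_inv]; rfl
        · rw [map_inv, hΦb, inv_inv]; rfl
      | inv_mem t ht =>
        intro x
        rcases ht with rfl | rfl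
        · rw [inv_inv, hΦa]; rfl
        · rw [inv_inv, hΦb]; rfl
      | mul s t _ _ h1 h2 =>
        intro x
        rw [mul_inv_rev, map_mul, Equiv.Perm.mul_apply, h2, h1, mul_assoc]
    intro g; rw [key]; simp
  refine ⟨fun g => (Φ g⁻¹ (0, 1)).1, fun g => ?_, fun g => ?_⟩
  · show (Φ (g * a)⁻¹ (0, 1)).1 = _
    rw [ha]
    show _ + cl a b ((Φ g⁻¹ (0, 1)).2 * a) + cl a b (Φ g⁻¹ (0, 1)).2 = _
    rw [h2]
  · show (Φ (g * b)⁻¹ (0, 1)).1 = _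
    rw [hb]; rfl

theorem exists_Z {a b : T} {i j k : ℕ} (hG : Geo a b i j k) :
    ∃ Z : Vt a b → VQ a b, ∀ t u v, Jn t u v → Z u + Z v = cl a b t := by
  obtain ⟨z, za, zb⟩ := exists_z hG
  have zbz : ∀ (n : ℤ) g, z (g * b ^ n) = z g := by
    intro n
    induction n with
    | zero => simp
    | succ n ih => intro g; rw [zpow_add_one, ← mul_assoc, zb, ih]
    | pred n ih => intro g; rw [← zb, mul_assoc, ← zpow_add_one, sub_add_cancel, ih]
  have za' : ∀ g, z (g * a) + cl a b (g * a) = z g + cl a b g := by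
    intro g
    rw [za]
    calc _ = z g + cl a b g + (cl a b (g * a) + cl a b (g * a)) := by abel
      _ = _ := by rw [two_vq]; simp
  have zaz : ∀ (n : ℤ) g, z (g * a ^ n) + cl a b (g * a ^ n) = z g + cl a b g := by
    intro n
    induction n with
    | zero => simp
    | succ n ih => intro g; rw [zpow_add_one, ← mul_assoc, za', ih]
    | pred n ih => intro g; rw [← za', mul_assoc, ← zpow_add_one, sub_add_cancel, ih]
  let Z : Vt a b → VQ a b := Sum.elim
    (fun q => z q.out + cl a b q.out) (fun q => z q.out)
  have ZA : ∀ t, Z (VA a b t) = z t + cl a b t := by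
    intro t
    obtain ⟨n, hn⟩ := (VA_eq (b := b)).1 (show VA a b t = VA a b (Quotient.out (QuotientGroup.mk t : T ⧸ Subgroup.zpowers a)) by
      unfold VA; rw [QuotientGroup.out_eq'])
    show z _ + cl a b _ = _
    rw [hn, zaz]
  have ZB : ∀ t, Z (VB a b t) = z t := by
    intro t
    obtain ⟨n, hn⟩ := (VB_eq (a := a)).1 (show VB a b t = VB a b (Quotient.out (QuotientGroup.mk t : T ⧸ Subgroup.zpowers b)) by
      unfold VB; rw [QuotientGroup.out_eq'])
    show z _ = _
    rw [hn, zbz]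
  refine ⟨Z, ?_⟩
  rintro t u v (⟨rfl, rfl⟩ | ⟨rfl, rfl⟩)
  · rw [ZA, ZB]
    calc _ = (z t + z t) + cl a b t := by abel
      _ = _ := by rw [two_vq]; simp
  · rw [ZA, ZB, ← add_assoc, two_vq]; simp

/-- a window -/
structure Win {a b : T} (W : ℕ) (S : T → Prop) (w : ℕ → Vt a b) (g : ℕ → T) : Prop where
  inj : ∀ l l', l ≤ W → l' ≤ W → w l = w l' → l = l'
  jn : ∀ l, l < W → Jn (g l) (w l) (w (l + 1))
  supp : ∀ l, l < W → S (g l)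
  turn : ∀ l, l + 1 < W → g (l + 1) = g l * gn (w (l + 1))
  close : ∃ x t t', Jn t (w W) x ∧ Jn t' x (w 0)

theorem window {a b : T} {i j k : ℕ} (hG : Geo a b i j k) {f : Ch T} (hf : f ∈ Qs a b) (h0 : f ≠ 0) :
    ∃ (w : ℕ → Vt a b) (g : ℕ → T), Win (2 * k - 2) (fun t => f t ≠ 0) w g := by
  obtain ⟨γ, hγc, hγ⟩ := hf
  have hk := hG.hk
  have hne : γ.support.Nonempty := by
    rw [Finsupp.support_nonempty_iff]
    rintro rfl
    apply h0; ext t; simp [hγ]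
  obtain ⟨H, hHc, hH⟩ := hG.height
  obtain ⟨p, hp, hmax⟩ := Finset.exists_max_image γ.support H hne
  obtain ⟨m, hm⟩ := hH p
  have hγcn : ∀ n : ℕ, ∀ t, γ (t * (a * b) ^ n) = γ t := by
    intro n; induction n with
    | zero => simp
    | succ n ih => intro t; rw [pow_succ, ← mul_assoc, hγc, ih]
  have hz : ∀ t, H p < H t → γ t = 0 := by
    intro t ht
    by_contra h
    exact absurd (hmax t (Finsupp.mem_support_iff.2 h)) (not_le.2 ht)
  have hp' : γ p ≠ 0 := Finsupp.mem_support_iff.1 hp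
  let F : ℕ → Vt a b := fun l => if l % 2 = 0 then VB a b (p * (a * b) ^ (l / 2)) else
    VA a b (p * (a * b) ^ (l / 2))
  let E : ℕ → T := fun l => if l % 2 = 0 then (p * (a * b) ^ (l / 2)) else
    (p * (a * b) ^ (l / 2)) * a
  have hF0 : ∀ n, F (2 * n) = VB a b (p * (a * b) ^ n) := by
    intro n
    have h1 : (2 * n) % 2 = 0 := by omega
    have h2 : (2 * n) / 2 = n := by omega
    simp only [F, h1, h2, if_true]
  have hF1 : ∀ n, F (2 * n + 1) = VA a b (p * (a * b) ^ n) := by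
    intro n
    have h1 : ¬ (2 * n + 1) % 2 = 0 := by omega
    have h2 : (2 * n + 1) / 2 = n := by omega
    simp only [F, h1, h2, if_false]
  have hE0 : ∀ n, E (2 * n) = p * (a * b) ^ n := by
    intro n
    have h1 : (2 * n) % 2 = 0 := by omega
    have h2 : (2 * n) / 2 = n := by omega
    simp only [E, h1, h2, if_true]
  have hE1 : ∀ n, E (2 * n + 1) = p * (a * b) ^ n * a := by
    intro n
    have h1 : ¬ (2 * n + 1) % 2 = 0 := by omega
    have h2 : (2 * n + 1) / 2 = n := by omega
    simp only [E, h1, h2, if_false]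
  have hJ : ∀ l, Jn (E l) (F l) (F (l + 1)) := by
    intro l
    rcases Nat.even_or_odd' l with ⟨n, rfl | rfl⟩
    · rw [hE0, hF0, hF1]; exact Or.inr ⟨rfl, rfl⟩
    · rw [hE1, hF1, show 2 * n + 1 + 1 = 2 * (n + 1) by ring, hF0]
      refine Or.inl ⟨(VA_mul _ _ _).symm, ?_⟩
      rw [← VB_mul a b (p * (a * b) ^ n * a), pow_succ]; simp only [mul_assoc]
  have hFinj : ∀ l l', l ≤ l' → l' + 2 ≤ l + 2 * k → F l = F l' → l = l' := by
    intro l l' h1 h2 h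
    rcases Nat.even_or_odd' l with ⟨n, rfl | rfl⟩ <;> rcases Nat.even_or_odd' l' with ⟨n', rfl | rfl⟩
    · rw [hF0, hF0, VB_eq] at h
      obtain ⟨e, he⟩ := h
      have := hG.cb (n' - n) e (by
        rw [mul_assoc, mul_right_inj] at he
        have h6 : b ^ e = ((a*b)^n)⁻¹ * (a*b)^n' := by rw [he]; group
        rw [pow_sub _ (by omega), h6]
        exact (((Commute.refl (a*b)).pow_pow n n').inv_left).eq.symm)
      have := Nat.eq_zero_of_dvd_of_lt this (by omega)
      omega
    · rw [hF0, hF1] at h; exact absurd h (VA_ne_VB _ _ _ _).symm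
    · rw [hF0, hF1] at h; exact absurd h (VA_ne_VB _ _ _ _)
    · rw [hF1, hF1, VA_eq] at h
      obtain ⟨e, he⟩ := h
      have := hG.ca (n' - n) e (by
        rw [mul_assoc, mul_right_inj] at he
        have h6 : a ^ e = ((a*b)^n)⁻¹ * (a*b)^n' := by rw [he]; group
        rw [pow_sub _ (by omega), h6]
        exact (((Commute.refl (a*b)).pow_pow n n').inv_left).eq.symm)
      have := Nat.eq_zero_of_dvd_of_lt this (by omega)
      omega
  refine ⟨fun l => F (m + l), fun l => E (m + l), ?_, ?_, ?_, ?_, ?_⟩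
  · intro l l' h1 h2 h
    rcases le_total l l' with h3 | h3
    · have := hFinj _ _ (by omega) (by omega) h; omega
    · have := hFinj _ _ (by omega) (by omega) h.symm; omega
  · intro l _; exact hJ _
  · intro l hl
    show f (E (m + l)) ≠ 0
    rcases Nat.even_or_odd' (m + l) with ⟨n, h | h⟩
    · rw [h, hE0, hγ, hz _ ((hm n).1 (by omega) (by omega)), hγcn]; simpa using hp'
    · rw [h, hE1, hγ, hz (p * (a * b) ^ n * a) ((hm n).2 (by omega) (by omega)), mul_inv_cancel_right, hγcn]
      simpa using hp'
  · intro l hl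
    show E (m + (l + 1)) = E (m + l) * gn (F (m + (l + 1)))
    rw [← add_assoc]
    rcases Nat.even_or_odd' (m + l) with ⟨n, h | h⟩
    · rw [h, hE1, hE0, hF1]; rfl
    · rw [h, show 2 * n + 1 + 1 = 2 * (n + 1) by ring, hE0, hE1, hF0, gn_VB, pow_succ]
      simp only [mul_assoc]
  · refine ⟨F (m + (2 * k - 1)), E (m + (2 * k - 2)), E (m + (2 * k - 1)), ?_, ?_⟩
    · have := hJ (m + (2 * k - 2))
      rwa [show m + (2 * k - 2) + 1 = m + (2 * k - 1) by omega] at this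
    · have := hJ (m + (2 * k - 1))
      rw [show m + (2 * k - 1) + 1 = m + 2 * k by omega] at this
      have h2 : F (m + 2 * k) = F (m + 0) := by
        rcases Nat.even_or_odd' m with ⟨n, h | h⟩
        · rw [h, show 2 * n + 2 * k = 2 * (n + k) by ring, show 2 * n + 0 = 2 * n from rfl, hF0, hF0, pow_add,
            hG.ck, mul_one]
        · rw [h, show 2 * n + 1 + 2 * k = 2 * (n + k) + 1 by ring, show 2 * n + 1 + 0 = 2 * n + 1 from rfl,
            hF1, hF1, pow_add, hG.ck, mul_one]
      rwa [h2] at this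

end chains
end TG


namespace TG

section rays
variable {T : Type} [Group T] {a b : T} {i j k : ℕ}

theorem gn_ord (hG : Geo a b i j k) (v : Vt a b) (d : ℤ) (h : gn v ^ d = 1) (hd : -6 < d) (hd' : d < 6) :
    d = 0 := by
  have key : ∀ (x : T) (n : ℕ), 6 ≤ n → n ∣ orderOf x → x ^ d = 1 → d = 0 := by
    intro x n hn h1 h2
    have h3 : (n : ℤ) ∣ d := (Int.natCast_dvd_natCast.2 h1).trans (orderOf_dvd_iff_zpow_eq_one.2 h2)
    apply Int.eq_zero_of_abs_lt_dvd h3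
    rw [abs_lt]; omega
  rcases v with v | v
  · exact key a i hG.hi (hG.ord_a _ (pow_orderOf_eq_one a)) h
  · exact key b j hG.hj (hG.ord_b _ (pow_orderOf_eq_one b)) h

theorem gn_inj (hG : Geo a b i j k) (v : Vt a b) (d d' : ℤ) (h : gn v ^ d = gn v ^ d') (hd : -6 < d - d')
    (hd' : d - d' < 6) : d = d' := by
  have := gn_ord hG v (d - d') (by rw [zpow_sub, h, mul_inv_cancel]) hd hd'
  omega

theorem Jn.cases {t : T} {u v u' v' : Vt a b} (h : Jn t u v) (h' : Jn t u' v') :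
    (u = u' ∧ v = v') ∨ (u = v' ∧ v = u') := by
  rcases h with ⟨rfl, rfl⟩ | ⟨rfl, rfl⟩ <;> rcases h' with ⟨rfl, rfl⟩ | ⟨rfl, rfl⟩ <;> simp

/-- sum of the edges of a segment -/
noncomputable def seg (e : ℕ → T) (n q : ℕ) : Ch T := ∑ l ∈ Finset.Ico n q, sg (e l)

theorem seg_apply_ne {e : ℕ → T} {n q : ℕ} {t : T} (h : seg e n q t ≠ 0) :
    ∃ l, n ≤ l ∧ l < q ∧ e l = t := by
  classical
  unfold seg at h
  rw [Finsupp.finsetSum_apply] at h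
  obtain ⟨l, hl, h⟩ := Finset.exists_ne_zero_of_sum_ne_zero h
  rw [Finset.mem_Ico] at hl
  refine ⟨l, hl.1, hl.2, ?_⟩
  by_contra h2
  apply h
  rw [sg, Finsupp.single_apply, if_neg h2]

theorem seg_apply_eq {e : ℕ → T} {n q l : ℕ} (h1 : n ≤ l) (h2 : l < q)
    (h : ∀ l', n ≤ l' → l' < q → e l' = e l → l' = l) : seg e n q (e l) = 1 := by
  classical
  unfold seg
  rw [Finsupp.finsetSum_apply, Finset.sum_eq_single l]
  · simp [sg]
  · intro l' hl' hne
    rw [Finset.mem_Ico] at hl'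
    rw [sg, Finsupp.single_apply, if_neg]
    intro h3; exact hne (h l' hl'.1 hl'.2 h3)
  · intro h3; exact absurd (Finset.mem_Ico.2 ⟨h1, h2⟩) h3

theorem seg_mk {Z : Vt a b → VQ a b} (hZ : ∀ t u v, Jn t u v → Z u + Z v = cl a b t)
    {v : ℕ → Vt a b} {e : ℕ → T} {n q : ℕ} (hnq : n ≤ q)
    (h : ∀ l, n ≤ l → l < q → Jn (e l) (v l) (v (l + 1))) :
    (QuotientAddGroup.mk (seg e n q) : VQ a b) = Z (v n) + Z (v q) := by
  induction q, hnq using Nat.le_induction with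
  | base => simp [seg, two_vq]
  | succ q hq ih =>
    unfold seg at ih ⊢
    rw [Finset.sum_Ico_succ_top hq, QuotientAddGroup.mk_add, ih (fun l h1 h2 => h l h1 (by omega))]
    have := hZ _ _ _ (h q hq (by omega))
    change _ + cl a b (e q) = _
    rw [← this]
    calc _ = Z (v n) + Z (v (q + 1)) + (Z (v q) + Z (v q)) := by abel
      _ = _ := by rw [two_vq]; simp

theorem Win.edge_inj {W : ℕ} {S : T → Prop} {w : ℕ → Vt a b} {g : ℕ → T} (hw : Win W S w g)
    {l l' : ℕ} (h1 : l < W) (h2 : l' < W) (h : g l = g l') : l = l' := by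
  have j1 := hw.jn l h1
  have j2 := hw.jn l' h2
  rw [← h] at j2
  rcases j1.cases j2 with ⟨h3, h4⟩ | ⟨h3, h4⟩
  · exact hw.inj _ _ (by omega) (by omega) h3
  · have := hw.inj _ _ (by omega) (by omega) h3
    have := hw.inj _ _ (by omega) (by omega) h4
    omega

theorem edge_uniq (hG : Geo a b i j k) {t t' : T} {u v : Vt a b} (h : Jn t u v) (h' : Jn t' u v) :
    t = t' := by
  classical
  by_contra hne
  obtain ⟨Z, hZ⟩ := exists_Z hG
  have hf : sg t + sg t' ∈ Qs a b := by
    rw [← QuotientAddGroup.eq_zero_iff, QuotientAddGroup.mk_add]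
    show cl a b t + cl a b t' = 0
    rw [← hZ _ _ _ h, ← hZ _ _ _ h', two_vq]
  have h0 : sg t + sg t' ≠ 0 := by
    intro h0
    have := DFunLike.congr_fun h0 t
    rw [Finsupp.add_apply, sg, sg, Finsupp.single_eq_same, Finsupp.single_apply, if_neg (Ne.symm hne)] at this
    simp at this
  obtain ⟨w, g, hw⟩ := window hG hf h0
  have hk := hG.hk
  have key : ∀ l, l < 2 * k - 2 → g l = t ∨ g l = t' := by
    intro l hl
    have := hw.supp l hl
    by_contra hcon
    push Not at hcon
    apply this
    rw [Finsupp.add_apply, sg, sg, Finsupp.single_apply, Finsupp.single_apply, if_neg (Ne.symm hcon.1),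
      if_neg (Ne.symm hcon.2)]; simp
  have h01 : g 0 ≠ g 1 := fun h => by have := hw.edge_inj (by omega) (by omega) h; omega
  have h02 : g 0 ≠ g 2 := fun h => by have := hw.edge_inj (by omega) (by omega) h; omega
  have h12 : g 1 ≠ g 2 := fun h => by have := hw.edge_inj (by omega) (by omega) h; omega
  have k0 := key 0 (by omega)
  have k1 := key 1 (by omega)
  have k2 := key 2 (by omega)
  rcases k0 with k0 | k0 <;> rcases k1 with k1 | k1 <;> rcases k2 with k2 | k2 <;>
    simp_all

/-- rigid rays -/
structure Ray (v : ℕ → Vt a b) (e : ℕ → T) (p : ℕ → ℤ) : Prop where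
  jn : ∀ n, Jn (e n) (v n) (v (n + 1))
  step : ∀ n, e (n + 1) = e n * gn (v (n + 1)) ^ p n
  exps : ∀ n, p n = 1 ∨ p n = -1 ∨ p n = 2 ∨ p n = -2
  rig1 : ∀ n, ¬ (p n = 1 ∧ p (n + 1) = 1 ∧ p (n + 2) = 1)
  rig2 : ∀ n, ¬ (p n = -1 ∧ p (n + 1) = -1 ∧ p (n + 2) = -1)

theorem Ray.e_succ_ne (hG : Geo a b i j k) {v : ℕ → Vt a b} {e : ℕ → T} {p : ℕ → ℤ} (hR : Ray v e p) (n : ℕ) :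
    e (n + 1) ≠ e n := by
  intro h
  rw [hR.step, mul_eq_left] at h
  have := hR.exps n
  have := gn_ord hG _ _ h (by omega) (by omega)
  omega

/-- uniqueness of the index of a vertex -/
def Uq (v : ℕ → Vt a b) (lo hi : ℕ) (u : Vt a b) : Prop :=
  ∀ l l', lo ≤ l → l ≤ hi → lo ≤ l' → l' ≤ hi → v l = u → v l' = u → l = l'

theorem Ray.junction {v : ℕ → Vt a b} {e : ℕ → T} {p : ℕ → ℤ} (hR : Ray v e p)
    {W : ℕ} {S : T → Prop} {w : ℕ → Vt a b} {g : ℕ → T} (hw : Win W S w g) {l : ℕ} (hl : l + 1 < W)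
    {lo hi x y : ℕ} (hx : lo ≤ x) (hx' : x < hi) (hy : lo ≤ y) (hy' : y < hi)
    (ex : g l = e x) (ey : g (l + 1) = e y) (hu : Uq v lo hi (w (l + 1))) :
    (y = x + 1 ∧ v y = w (l + 1)) ∨ (x = y + 1 ∧ v x = w (l + 1)) := by
  have hne : x ≠ y := by
    rintro rfl
    have := hw.edge_inj (l := l) (l' := l + 1) (by omega) hl (by rw [ex, ey])
    omega
  have jx := hR.jn x
  have jy := hR.jn y
  rw [← ex] at jx
  rw [← ey] at jy
  have j1 := hw.jn l (by omega)
  have j2 := hw.jn (l + 1) hl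
  rcases jx.cases j1 with ⟨h1, h2⟩ | ⟨h1, h2⟩ <;> rcases jy.cases j2 with ⟨h3, h4⟩ | ⟨h3, h4⟩
  · have := hu (x + 1) y (by omega) (by omega) (by omega) (by omega) h2 h3
    exact Or.inl ⟨this.symm, h3⟩
  · have := hu (x + 1) (y + 1) (by omega) (by omega) (by omega) (by omega) h2 h4
    omega
  · have := hu x y (by omega) (by omega) (by omega) (by omega) h1 h3
    omega
  · have := hu x (y + 1) (by omega) (by omega) (by omega) (by omega) h1 h4
    exact Or.inr ⟨this, h1⟩

theorem Ray.no_four (hG : Geo a b i j k) {v : ℕ → Vt a b} {e : ℕ → T} {p : ℕ → ℤ} (hR : Ray v e p)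
    {W : ℕ} {S : T → Prop} {w : ℕ → Vt a b} {g : ℕ → T} (hw : Win W S w g) {l : ℕ} (hl : l + 3 < W)
    {lo hi : ℕ} (h : ∀ s, s ≤ 3 → ∃ x, lo ≤ x ∧ x < hi ∧ g (l + s) = e x)
    (hu : ∀ s, 1 ≤ s → s ≤ 3 → Uq v lo hi (w (l + s))) : False := by
  obtain ⟨x0, l0, u0, e0⟩ := h 0 (by omega)
  obtain ⟨x1, l1, u1, e1⟩ := h 1 (by omega)
  obtain ⟨x2, l2, u2, e2⟩ := h 2 (by omega)
  obtain ⟨x3, l3, u3, e3⟩ := h 3 (by omega)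
  have j1 := hR.junction hw (l := l) (by omega) l0 u0 l1 u1 e0 e1 (hu 1 (by omega) (by omega))
  have j2 := hR.junction hw (l := l + 1) (by omega) l1 u1 l2 u2 e1 e2 (hu 2 (by omega) (by omega))
  have j3 := hR.junction hw (l := l + 2) (by omega) l2 u2 l3 u3 e2 e3 (hu 3 (by omega) (by omega))
  have n02 : x0 ≠ x2 := by
    rintro rfl
    have := hw.edge_inj (l := l + 0) (l' := l + 2) (by omega) (by omega) (by rw [e0, e2]); omega
  have n13 : x1 ≠ x3 := by
    rintro rfl
    have := hw.edge_inj (l := l + 1) (l' := l + 3) (by omega) (by omega) (by rw [e1, e3]); omega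
  have t1 := hw.turn l (by omega)
  have t2 := hw.turn (l + 1) (by omega)
  have t3 := hw.turn (l + 2) (by omega)
  have up : ∀ m x y, g (m + 1) = g m * gn (w (m + 1)) → g m = e x → g (m + 1) = e y → y = x + 1 →
      v y = w (m + 1) → p x = 1 := by
    rintro m x y ht h1 h2 rfl h4
    rw [h1, h2, hR.step, h4, mul_right_inj] at ht
    have := hR.exps x
    exact gn_inj hG _ _ 1 (by rw [ht, zpow_one]) (by omega) (by omega)
  have dn : ∀ m x y, g (m + 1) = g m * gn (w (m + 1)) → g m = e x → g (m + 1) = e y → x = y + 1 →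
      v x = w (m + 1) → p y = -1 := by
    rintro m x y ht h1 h2 rfl h4
    rw [h1, h2, hR.step, h4, mul_assoc, left_eq_mul, ← zpow_add_one] at ht
    have := hR.exps y
    have := gn_ord hG _ _ ht (by omega) (by omega)
    omega
  rcases j1 with ⟨j1, k1⟩ | ⟨j1, k1⟩
  · obtain ⟨j2, k2⟩ : x2 = x1 + 1 ∧ v x2 = w (l + 1 + 1) := by
      rcases j2 with j2 | j2
      · exact j2
      · omega
    obtain ⟨j3, k3⟩ : x3 = x2 + 1 ∧ v x3 = w (l + 2 + 1) := by
      rcases j3 with j3 | j3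
      · exact j3
      · omega
    have q1 := up _ _ _ t1 e0 e1 j1 k1
    have q2 := up _ _ _ t2 e1 e2 j2 k2
    have q3 := up _ _ _ t3 e2 e3 j3 k3
    subst j3 j2 j1
    exact hR.rig1 _ ⟨q1, q2, q3⟩
  · obtain ⟨j2, k2⟩ : x1 = x2 + 1 ∧ v x1 = w (l + 1 + 1) := by
      rcases j2 with j2 | j2
      · omega
      · exact j2
    obtain ⟨j3, k3⟩ : x2 = x3 + 1 ∧ v x2 = w (l + 2 + 1) := by
      rcases j3 with j3 | j3
      · omega
      · exact j3
    have q1 := dn _ _ _ t1 e0 e1 j1 k1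
    have q2 := dn _ _ _ t2 e1 e2 j2 k2
    have q3 := dn _ _ _ t3 e2 e3 j3 k3
    subst j1 j2 j3
    exact hR.rig2 _ ⟨q3, q2, q1⟩

theorem Ray.inj (hG : Geo a b i j k) {v : ℕ → Vt a b} {e : ℕ → T} {p : ℕ → ℤ} (hR : Ray v e p) :
    Function.Injective v := by
  classical
  by_contra hcon
  have hex : ∃ d, 0 < d ∧ ∃ n, v n = v (n + d) := by
    unfold Function.Injective at hcon
    push Not at hcon
    obtain ⟨x, y, h, hne⟩ := hcon
    rcases lt_or_gt_of_ne hne with h1 | h1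
    · exact ⟨y - x, by omega, x, by rw [h]; congr 1; omega⟩
    · exact ⟨x - y, by omega, y, by rw [← h]; congr 1; omega⟩
  obtain ⟨hd, n, hn⟩ := Nat.find_spec hex
  have hmin : ∀ m, m < Nat.find hex → ¬ (0 < m ∧ ∃ n, v n = v (n + m)) := fun m => Nat.find_min hex
  generalize Nat.find hex = d at *
  have hk := hG.hk
  have inj' : ∀ l l', l < l' → l' < l + d → v l ≠ v l' := by
    intro l l' h1 h2 h3
    exact hmin (l' - l) (by omega) ⟨by omega, l, by rw [h3]; congr 1; omega⟩
  have hd1 : d ≠ 1 := by rintro rfl; exact (hR.jn n).ne hn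
  obtain ⟨Z, hZ⟩ := exists_Z hG
  have hf : seg e n (n + d) ∈ Qs a b := by
    rw [← QuotientAddGroup.eq_zero_iff, seg_mk hZ (by omega) (fun l _ _ => hR.jn l), hn, two_vq]
  have hfn : seg e n (n + d) (e n) = 1 := by
    apply seg_apply_eq le_rfl (by omega)
    intro l h1 h2 h
    by_contra hne
    have jl := hR.jn l
    rw [h] at jl
    rcases jl.cases (hR.jn n) with ⟨h3, h4⟩ | ⟨h3, h4⟩
    · exact inj' n l (by omega) (by omega) h3.symm
    · by_cases hl : l = n + 1
      · subst hl; exact hR.e_succ_ne hG n h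
      · exact inj' (n + 1) l (by omega) (by omega) h3.symm
  have h0 : seg e n (n + d) ≠ 0 := by intro h; rw [h] at hfn; simp at hfn
  obtain ⟨w, g, hw⟩ := window hG hf h0
  have hU : ∀ u, u ≠ v n → Uq v n (n + d) u := by
    intro u hu l l' h1 h2 h3 h4 h5 h6
    have g1 : l ≠ n := by rintro rfl; exact hu h5.symm
    have g2 : l' ≠ n := by rintro rfl; exact hu h6.symm
    rcases lt_trichotomy l l' with h | h | h
    · exact absurd (h5.trans h6.symm) (inj' _ _ h (by omega))
    · exact h
    · exact absurd (h6.trans h5.symm) (inj' _ _ h (by omega))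
  have hE : ∀ l, l < 2 * k - 2 → ∃ x, n ≤ x ∧ x < n + d ∧ g l = e x := by
    intro l hl
    obtain ⟨x, h1, h2, h3⟩ := seg_apply_ne (hw.supp l hl)
    exact ⟨x, h1, h2, h3.symm⟩
  by_cases hc : ∃ s, 1 ≤ s ∧ s ≤ 3 ∧ w s = v n
  · obtain ⟨s, s1, s2, s3⟩ := hc
    refine hR.no_four hG hw (l := 3) (by omega) (fun s hs => hE _ (by omega)) (fun s' h1 h2 => hU _ ?_)
    intro h
    have := hw.inj _ _ (by omega) (by omega) (h.trans s3.symm)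
    omega
  · push Not at hc
    refine hR.no_four hG hw (l := 0) (by omega) (fun s hs => hE _ (by omega)) (fun s' h1 h2 => hU _ ?_)
    rw [zero_add]
    exact hc s' h1 h2

theorem Ray.uq (hG : Geo a b i j k) {v : ℕ → Vt a b} {e : ℕ → T} {p : ℕ → ℤ} (hR : Ray v e p) (lo hi : ℕ)
    (u : Vt a b) : Uq v lo hi u :=
  fun _ _ _ _ _ _ h h' => hR.inj hG (h.trans h'.symm)

theorem Ray.e_inj (hG : Geo a b i j k) {v : ℕ → Vt a b} {e : ℕ → T} {p : ℕ → ℤ} (hR : Ray v e p) :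
    Function.Injective e := by
  intro x y h
  have jx := hR.jn x
  rw [h] at jx
  rcases jx.cases (hR.jn y) with ⟨h3, h4⟩ | ⟨h3, h4⟩
  · exact hR.inj hG h3
  · have := hR.inj hG h3
    have := hR.inj hG h4
    omega

theorem bigon (hG : Geo a b i j k) {v v' : ℕ → Vt a b} {e e' : ℕ → T} {p p' : ℕ → ℤ} (hR : Ray v e p)
    (hR' : Ray v' e' p') {n q n' q' : ℕ} (hnq : n < q) (hn : v n = v' n') (hq : v q = v' q')
    (hno : ∀ x, n < x → x < q → ∀ y, v x ≠ v' y) :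
    q = n + 1 ∧ ((q' = n' + 1 ∧ e n = e' n') ∨ (n' = q' + 1 ∧ e n = e' q')) := by
  classical
  have inj := hR.inj hG
  have inj' := hR'.inj hG
  have hk := hG.hk
  by_cases hs : ∃ x y, n ≤ x ∧ x < q ∧ e x = e' y
  · obtain ⟨x, y, h1, h2, h3⟩ := hs
    have jx := hR.jn x
    rw [h3] at jx
    have hx : x = n := by
      by_contra hne
      rcases jx.cases (hR'.jn y) with ⟨h4, h5⟩ | ⟨h4, h5⟩
      · exact hno x (by omega) (by omega) _ h4
      · exact hno x (by omega) (by omega) _ h4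
    have hx1 : x + 1 = q := by
      by_contra hne
      rcases jx.cases (hR'.jn y) with ⟨h4, h5⟩ | ⟨h4, h5⟩
      · exact hno (x + 1) (by omega) (by omega) _ h5
      · exact hno (x + 1) (by omega) (by omega) _ h5
    subst hx
    rcases jx.cases (hR'.jn y) with ⟨h4, h5⟩ | ⟨h4, h5⟩
    · rw [hx1] at h5
      have e1 := inj' (hn.symm.trans h4)
      have e2 := inj' (hq.symm.trans h5)
      exact ⟨hx1.symm, Or.inl ⟨by omega, by rw [h3, e1]⟩⟩
    · rw [hx1] at h5
      have e1 := inj' (hn.symm.trans h4)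
      have e2 := inj' (hq.symm.trans h5)
      exact ⟨hx1.symm, Or.inr ⟨by omega, by rw [h3, e2]⟩⟩
  · exfalso
    push Not at hs
    obtain ⟨Z, hZ⟩ := exists_Z hG
    obtain ⟨lo, hi, hlh, hZ2⟩ : ∃ lo hi, lo ≤ hi ∧ Z (v' lo) + Z (v' hi) = Z (v n) + Z (v q) := by
      rcases le_total n' q' with h | h
      · exact ⟨n', q', h, by rw [hn, hq]⟩
      · exact ⟨q', n', h, by rw [hn, hq, add_comm]⟩
    have hf : seg e n q + seg e' lo hi ∈ Qs a b := by
      rw [← QuotientAddGroup.eq_zero_iff, QuotientAddGroup.mk_add, seg_mk hZ (by omega) (fun l _ _ => hR.jn l),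
        seg_mk hZ hlh (fun l _ _ => hR'.jn l), hZ2, two_vq]
    have hfn : (seg e n q + seg e' lo hi) (e n) = 1 := by
      rw [Finsupp.add_apply, seg_apply_eq le_rfl hnq (fun l' _ _ h => hR.e_inj hG h)]
      by_cases h : seg e' lo hi (e n) = 0
      · rw [h]; simp
      · obtain ⟨l, _, _, h3⟩ := seg_apply_ne h
        exact absurd h3.symm (hs n l le_rfl hnq)
    have h0 : seg e n q + seg e' lo hi ≠ 0 := by intro h; rw [h] at hfn; simp at hfn
    obtain ⟨w, g, hw⟩ := window hG hf h0
    have hcol : ∀ l, l < 2 * k - 2 → (∃ x, n ≤ x ∧ x < q ∧ g l = e x) ∨ (∃ x, lo ≤ x ∧ x < hi ∧ g l = e' x) := by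
      intro l hl
      have h := hw.supp l hl
      by_cases h1 : seg e n q (g l) = 0
      · have h2 : seg e' lo hi (g l) ≠ 0 := by
          intro h2; apply h; rw [Finsupp.add_apply, h1, h2]; simp
        obtain ⟨x, a1, a2, a3⟩ := seg_apply_ne h2
        exact Or.inr ⟨x, a1, a2, a3.symm⟩
      · obtain ⟨x, a1, a2, a3⟩ := seg_apply_ne h1
        exact Or.inl ⟨x, a1, a2, a3.symm⟩
    have hvx : ∀ l, l < 2 * k - 2 → ∀ x, n ≤ x → x < q → g l = e x → ∀ m, m = l ∨ m = l + 1 →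
        ∃ y, n ≤ y ∧ y ≤ q ∧ w m = v y := by
      intro l hl x h1 h2 h3 m hm
      have jx := hR.jn x
      rw [← h3] at jx
      rcases (hw.jn l hl).cases jx with ⟨h4, h5⟩ | ⟨h4, h5⟩ <;> rcases hm with rfl | rfl
      · exact ⟨_, h1, h2.le, h4⟩
      · exact ⟨_, by omega, h2, h5⟩
      · exact ⟨_, by omega, h2, h4⟩
      · exact ⟨_, h1, h2.le, h5⟩
    have hvx' : ∀ l, l < 2 * k - 2 → ∀ x, g l = e' x → ∀ m, m = l ∨ m = l + 1 → ∃ y, w m = v' y := by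
      intro l hl x h3 m hm
      have jx := hR'.jn x
      rw [← h3] at jx
      rcases (hw.jn l hl).cases jx with ⟨h4, h5⟩ | ⟨h4, h5⟩ <;> rcases hm with rfl | rfl
      · exact ⟨_, h4⟩
      · exact ⟨_, h5⟩
      · exact ⟨_, h4⟩
      · exact ⟨_, h5⟩
    have hmeet : ∀ m y y', n ≤ y → y ≤ q → w m = v y → w m = v' y' → w m = v n ∨ w m = v q := by
      intro m y y' h1 h2 h3 h4
      by_contra hcon
      push Not at hcon
      have : y ≠ n := by rintro rfl; exact hcon.1 h3
      have : y ≠ q := by rintro rfl; exact hcon.2 h3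
      exact hno y (by omega) (by omega) y' (h3.symm.trans h4)
    -- a clean triple is impossible
    have hclean : ∀ l, l + 3 < 2 * k - 2 → (∀ s, 1 ≤ s → s ≤ 3 → w (l + s) ≠ v n ∧ w (l + s) ≠ v q) → False := by
      intro l hl hcl
      have prop1 : ∀ s, s < 3 → (∃ x, n ≤ x ∧ x < q ∧ g (l + s) = e x) → ∃ x, n ≤ x ∧ x < q ∧ g (l + (s + 1)) = e x := by
        rintro s hs3 ⟨x, h1, h2, h3⟩
        rcases hcol (l + (s + 1)) (by omega) with h | ⟨y, h4, h5, h6⟩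
        · exact h
        · exfalso
          obtain ⟨y1, a1, a2, a3⟩ := hvx (l + s) (by omega) x h1 h2 h3 (l + (s + 1)) (Or.inr rfl)
          obtain ⟨y2, a4⟩ := hvx' (l + (s + 1)) (by omega) y h6 (l + (s + 1)) (Or.inl rfl)
          have := hmeet _ _ _ a1 a2 a3 a4
          have := hcl (s + 1) (by omega) (by omega)
          tauto
      have prop2 : ∀ s, s < 3 → (∃ x, lo ≤ x ∧ x < hi ∧ g (l + s) = e' x) → ∃ x, lo ≤ x ∧ x < hi ∧ g (l + (s + 1)) = e' x := by
        rintro s hs3 ⟨x, h1, h2, h3⟩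
        rcases hcol (l + (s + 1)) (by omega) with ⟨y, h4, h5, h6⟩ | h
        · exfalso
          obtain ⟨y1, a1, a2, a3⟩ := hvx (l + (s + 1)) (by omega) y h4 h5 h6 (l + (s + 1)) (Or.inl rfl)
          obtain ⟨y2, a4⟩ := hvx' (l + s) (by omega) x h3 (l + (s + 1)) (Or.inr rfl)
          have := hmeet _ _ _ a1 a2 a3 a4
          have := hcl (s + 1) (by omega) (by omega)
          tauto
        · exact h
      rcases hcol (l + 0) (by omega) with h | h
      · refine hR.no_four hG hw hl (lo := n) (hi := q) (fun s hs => ?_) (fun _ _ _ => hR.uq hG _ _ _)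
        have h1 := prop1 0 (by omega) h
        have h2 := prop1 1 (by omega) h1
        have h3 := prop1 2 (by omega) h2
        interval_cases s <;> assumption
      · refine hR'.no_four hG hw hl (lo := lo) (hi := hi) (fun s hs => ?_) (fun _ _ _ => hR'.uq hG _ _ _)
        have h1 := prop2 0 (by omega) h
        have h2 := prop2 1 (by omega) h1
        have h3 := prop2 2 (by omega) h2
        interval_cases s <;> assumption
    -- pigeonhole
    have b1 : ∃ s, 1 ≤ s ∧ s ≤ 3 ∧ (w (0 + s) = v n ∨ w (0 + s) = v q) := by
      by_contra hcon; push Not at hcon; exact hclean 0 (by omega) hcon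
    have b2 : ∃ s, 1 ≤ s ∧ s ≤ 3 ∧ (w (3 + s) = v n ∨ w (3 + s) = v q) := by
      by_contra hcon; push Not at hcon; exact hclean 3 (by omega) hcon
    have b3 : ∃ s, 1 ≤ s ∧ s ≤ 3 ∧ (w (6 + s) = v n ∨ w (6 + s) = v q) := by
      by_contra hcon; push Not at hcon; exact hclean 6 (by omega) hcon
    obtain ⟨s1, c1, c2, c3⟩ := b1
    obtain ⟨s2, d1, d2, d3⟩ := b2
    obtain ⟨s3, f1, f2, f3⟩ := b3
    have i12 : w (0 + s1) ≠ w (3 + s2) := fun h => by have := hw.inj _ _ (by omega) (by omega) h; omega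
    have i13 : w (0 + s1) ≠ w (6 + s3) := fun h => by have := hw.inj _ _ (by omega) (by omega) h; omega
    have i23 : w (3 + s2) ≠ w (6 + s3) := fun h => by have := hw.inj _ _ (by omega) (by omega) h; omega
    rcases c3 with c3 | c3 <;> rcases d3 with d3 | d3 <;> rcases f3 with f3 | f3 <;>
      first | exact i12 (c3.trans d3.symm) | exact i13 (c3.trans f3.symm) | exact i23 (d3.trans f3.symm)

theorem merge (hG : Geo a b i j k) {v v' : ℕ → Vt a b} {e e' : ℕ → T} {p p' : ℕ → ℤ} (hR : Ray v e p)
    (hR' : Ray v' e' p') (hinf : ∀ N, ∃ n, N ≤ n ∧ ∃ n', v n = v' n') :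
    ∃ r s, ∀ z, v (r + z) = v' (s + z) ∧ e (r + z) = e' (s + z) ∧ p (r + z) = p' (s + z) := by
  classical
  have inj := hR.inj hG
  have inj' := hR'.inj hG
  obtain ⟨r0, -, hr0⟩ := hinf 0
  have hnext : ∀ n n', v n = v' n' → ∃ q', v (n + 1) = v' q' ∧
      ((q' = n' + 1 ∧ e n = e' n') ∨ (n' = q' + 1 ∧ e n = e' q')) := by
    intro n n' h
    have hex : ∃ q, n < q ∧ ∃ q', v q = v' q' := by
      obtain ⟨q, h1, h2⟩ := hinf (n + 1)
      exact ⟨q, by omega, h2⟩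
    obtain ⟨h1, q', h2⟩ := Nat.find_spec hex
    have hmin : ∀ m, m < Nat.find hex → ¬ (n < m ∧ ∃ q', v m = v' q') := fun m => Nat.find_min hex
    generalize Nat.find hex = q at *
    obtain ⟨h3, h4⟩ := bigon hG hR hR' h1 h h2 (fun x hx hx' y hy => hmin x hx' ⟨hx, y, hy⟩)
    subst h3
    exact ⟨q', h2, h4⟩
  have hall : ∀ z, ∃ n', v (r0 + z) = v' n' := by
    intro z
    induction z with
    | zero => exact hr0
    | succ z ih =>
      obtain ⟨n', hn'⟩ := ih
      obtain ⟨q', h1, _⟩ := hnext _ _ hn'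
      exact ⟨q', h1⟩
  choose φ hφ using hall
  have hstep : ∀ z, (φ (z + 1) = φ z + 1 ∧ e (r0 + z) = e' (φ z)) ∨
      (φ z = φ (z + 1) + 1 ∧ e (r0 + z) = e' (φ (z + 1))) := by
    intro z
    obtain ⟨q', h1, h2⟩ := hnext _ _ (hφ z)
    have : q' = φ (z + 1) := inj' (h1.symm.trans (hφ (z + 1)))
    subst this; exact h2
  have hup : ∃ z, φ (z + 1) = φ z + 1 := by
    by_contra hcon
    push Not at hcon
    have : ∀ z, φ z + z = φ 0 := by
      intro z
      induction z with
      | zero => simp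
      | succ z ih =>
        rcases hstep z with h | h
        · exact absurd h.1 (hcon z)
        · omega
    have := this (φ 0 + 1)
    omega
  obtain ⟨z0, hz0⟩ := hup
  have hinc : ∀ z, φ (z0 + z) = φ z0 + z ∧ φ (z0 + z + 1) = φ z0 + z + 1 := by
    intro z
    induction z with
    | zero => exact ⟨rfl, hz0⟩
    | succ z ih =>
      refine ⟨ih.2, ?_⟩
      rcases hstep (z0 + z + 1) with h | h
      · show φ (z0 + z + 1 + 1) = _
        rw [h.1, ih.2]; ring
      · exfalso
        have h1 : φ (z0 + z + 1 + 1) = φ (z0 + z) := by omega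
        have h2 := hφ (z0 + z + 1 + 1)
        rw [h1, ← hφ (z0 + z)] at h2
        have := inj h2
        omega
  have hve : ∀ z, v (r0 + z0 + z) = v' (φ z0 + z) ∧ e (r0 + z0 + z) = e' (φ z0 + z) := by
    intro z
    refine ⟨by rw [add_assoc, hφ, (hinc z).1], ?_⟩
    rcases hstep (z0 + z) with h | h
    · rw [add_assoc, h.2, (hinc z).1]
    · have := hinc z; omega
  refine ⟨r0 + z0, φ z0, fun z => ⟨(hve z).1, (hve z).2, ?_⟩⟩
  have h1 := hR.step (r0 + z0 + z)
  have h2 := hR'.step (φ z0 + z)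
  have h3 : e (r0 + z0 + z + 1) = e' (φ z0 + z + 1) := (hve (z + 1)).2
  have h4 : v (r0 + z0 + z + 1) = v' (φ z0 + z + 1) := (hve (z + 1)).1
  rw [h3, h2, (hve z).2, h4, mul_right_inj] at h1
  have := hR.exps (r0 + z0 + z)
  have := hR'.exps (φ z0 + z)
  exact (gn_inj hG _ _ _ h1 (by omega) (by omega)).symm

end rays
end TG


namespace TG

section meet
variable {T : Type} [Group T] {a b : T} {i j k : ℕ}

/-- there is a walk of length `n` -/
def Reach : ℕ → Vt a b → Vt a b → Prop
  | 0, x, y => x = y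
  | n + 1, x, y => ∃ z t, Jn t x z ∧ Reach n z y

theorem Reach.trans {n m : ℕ} {x y z : Vt a b} (h : Reach n x y) (h' : Reach m y z) : Reach (n + m) x z := by
  induction n generalizing x with
  | zero => cases h; rwa [zero_add]
  | succ n ih =>
    obtain ⟨w, t, h1, h2⟩ := h
    rw [show n + 1 + m = n + m + 1 by ring]
    exact ⟨w, t, h1, ih h2⟩

theorem Reach.one {t : T} {x y : Vt a b} (h : Jn t x y) : Reach 1 x y := ⟨y, t, h, rfl⟩

theorem Reach.symm {n : ℕ} {x y : Vt a b} (h : Reach n x y) : Reach n y x := by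
  induction n generalizing x with
  | zero => exact Eq.symm h
  | succ n ih =>
    obtain ⟨w, t, h1, h2⟩ := h
    exact (ih h2).trans (Reach.one h1.symm)

theorem Reach.smul {n : ℕ} {x y : Vt a b} (g : T) (h : Reach n x y) : Reach n (g • x) (g • y) := by
  induction n generalizing x with
  | zero => exact congrArg (g • ·) h
  | succ n ih =>
    obtain ⟨w, t, h1, h2⟩ := h
    exact ⟨g • w, g * t, h1.smul g, ih h2⟩

theorem Reach.path {n : ℕ} {x y : Vt a b} (h : Reach n x y) :
    ∃ (u : ℕ → Vt a b) (h : ℕ → T), u 0 = x ∧ u n = y ∧ ∀ l, l < n → Jn (h l) (u l) (u (l + 1)) := by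
  induction n generalizing x with
  | zero => exact ⟨fun _ => x, fun _ => 1, rfl, h, fun l hl => absurd hl (by omega)⟩
  | succ n ih =>
    obtain ⟨w, t, h1, h2⟩ := h
    obtain ⟨u, h, u0, un, hj⟩ := ih h2
    refine ⟨fun l => Nat.casesOn l x u, fun l => Nat.casesOn l t h, rfl, un, ?_⟩
    intro l hl
    rcases l with _ | l
    · show Jn t x (u 0)
      rwa [u0]
    · exact hj l (by omega)

theorem reach_of_path {u : ℕ → Vt a b} {h : ℕ → T} (n q : ℕ) (hnq : n ≤ q)
    (hj : ∀ l, n ≤ l → l < q → Jn (h l) (u l) (u (l + 1))) : Reach (q - n) (u n) (u q) := by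
  induction q, hnq using Nat.le_induction with
  | base => rw [Nat.sub_self]; rfl
  | succ q hq ih =>
    rw [show q + 1 - n = q - n + 1 by omega]
    exact (ih (fun l h1 h2 => hj l h1 (by omega))).trans (Reach.one (hj q hq (by omega)))

theorem connected (hG : Geo a b i j k) (x y : Vt a b) : ∃ n, Reach n x y := by
  have hC : ∀ t, ∃ n, Reach n (VB a b 1) (VB a b t) := by
    intro t
    have ht : t ∈ Subgroup.closure {a, b} := by rw [hG.gen]; trivial
    induction ht using Subgroup.closure_induction with
    | one => exact ⟨0, rfl⟩
    | mem t ht =>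
      rcases ht with rfl | rfl
      · refine ⟨2, VA t b 1, 1, Or.inr ⟨rfl, rfl⟩, _, t, Or.inl ⟨?_, rfl⟩, rfl⟩
        rw [← VA_mul, one_mul]
      · refine ⟨0, ?_⟩
        show VB a t 1 = VB a t t
        rw [← VB_mul, one_mul]
    | inv t _ ih =>
      obtain ⟨n, hn⟩ := ih
      have := (hn.smul t⁻¹).symm
      rw [smul_VB, smul_VB, inv_mul_cancel, mul_one] at this
      exact ⟨n, this⟩
    | mul s t _ _ h1 h2 =>
      obtain ⟨n, hn⟩ := h1
      obtain ⟨m, hm⟩ := h2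
      have := hm.smul s
      rw [smul_VB, smul_VB, mul_one] at this
      exact ⟨n + m, hn.trans this⟩
  have hC2 : ∀ x : Vt a b, ∃ n, Reach n (VB a b 1) x := by
    rintro (x | x)
    · induction x using QuotientGroup.induction_on with
      | H t =>
        obtain ⟨n, hn⟩ := hC t
        exact ⟨n + 1, hn.trans (Reach.one (t := t) (Or.inr ⟨rfl, rfl⟩))⟩
    · induction x using QuotientGroup.induction_on with
      | H t => exact hC t
  obtain ⟨n, hn⟩ := hC2 x
  obtain ⟨m, hm⟩ := hC2 y
  exact ⟨n + m, hn.symm.trans hm⟩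

theorem nbr_finite (hG : Geo a b i j k) (x : Vt a b) : {z : Vt a b | ∃ t, Jn t x z}.Finite := by
  have hi := hG.hi
  have hj := hG.hj
  have fa : (Subgroup.zpowers a : Set T).Finite :=
    finite_zpowers.2 (isOfFinOrder_iff_pow_eq_one.2 ⟨i, by omega, hG.ai⟩)
  have fb : (Subgroup.zpowers b : Set T).Finite :=
    finite_zpowers.2 (isOfFinOrder_iff_pow_eq_one.2 ⟨j, by omega, hG.bj⟩)
  rcases x with x | x
  · induction x using QuotientGroup.induction_on with
    | H t0 =>
      apply (fa.image (fun s => VB a b (t0 * s))).subset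
      rintro z ⟨t, ⟨h1, h2⟩ | ⟨h1, h2⟩⟩
      · obtain ⟨n, hn⟩ := (VA_eq (a := a) (b := b)).1 h1
        refine ⟨a ^ n, Subgroup.mem_zpowers_iff.2 ⟨n, rfl⟩, ?_⟩
        simp only; rw [h2, hn]
      · exact absurd h1 (VA_ne_VB a b _ _)
  · induction x using QuotientGroup.induction_on with
    | H t0 =>
      apply (fb.image (fun s => VA a b (t0 * s))).subset
      rintro z ⟨t, ⟨h1, h2⟩ | ⟨h1, h2⟩⟩
      · exact absurd h1.symm (VA_ne_VB a b _ _)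
      · obtain ⟨n, hn⟩ := (VB_eq (a := a) (b := b)).1 h1
        refine ⟨b ^ n, Subgroup.mem_zpowers_iff.2 ⟨n, rfl⟩, ?_⟩
        simp only; rw [h2, hn]

theorem ball_finite (hG : Geo a b i j k) (n : ℕ) (x : Vt a b) : {y : Vt a b | Reach n x y}.Finite := by
  induction n generalizing x with
  | zero => exact (Set.finite_singleton x).subset (fun y hy => (show x = y from hy).symm)
  | succ n ih =>
    apply ((nbr_finite hG x).biUnion (fun z _ => ih z)).subset
    rintro y ⟨z, t, h1, h2⟩
    exact Set.mem_biUnion ⟨t, h1⟩ h2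

/-- the oriented core of the argument -/
theorem lemQ_core (hG : Geo a b i j k) {v v' : ℕ → Vt a b} {e e' : ℕ → T} {p p' : ℕ → ℤ} (hR : Ray v e p)
    (hR' : Ray v' e' p') (hdis : ∀ n n', v n ≠ v' n') {D : ℕ}
    (hD : ∀ n r r', Reach n (v r) (v' r') → D ≤ n) {u : ℕ → Vt a b} {h : ℕ → T} {r0 r0' : ℕ}
    (u0 : u 0 = v r0) (uD : u D = v' r0') (hj : ∀ l, l < D → Jn (h l) (u l) (u (l + 1)))
    {W : ℕ} (hW : 10 ≤ W) {S : T → Prop} {w : ℕ → Vt a b} {g : ℕ → T} (hw : Win W S w g)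
    (hS : ∀ l, l < W → (∃ x, g l = e x) ∨ (∃ x, g l = e' x) ∨ ∃ x, x < D ∧ g l = h x)
    {l1 x1 : ℕ} (hl1 : l1 ≤ 3) (hx1 : x1 < D) (hg : g l1 = h x1)
    (hmin : ∀ l, l < l1 → ∀ x, x < D → g l ≠ h x)
    (ho1 : w l1 = u x1) (ho2 : w (l1 + 1) = u (x1 + 1)) : False := by
  have uL : ∀ l r, l ≤ D → u l = v r → l = 0 := by
    intro l r hl hu
    have := reach_of_path l D hl (fun l _ h2 => hj l h2)
    rw [hu, uD] at this
    have := hD _ _ _ this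
    omega
  have uL' : ∀ l r, l ≤ D → u l = v' r → l = D := by
    intro l r hl hu
    have := reach_of_path 0 l (by omega) (fun l _ h2 => hj l (by omega))
    rw [hu, u0] at this
    have := hD _ _ _ this
    omega
  have uinj : ∀ l l', l < l' → l' ≤ D → u l ≠ u l' := by
    intro l l' h1 h2 h3
    have a1 := reach_of_path 0 l (by omega) (fun l _ h2 => hj l (by omega))
    have a2 := reach_of_path l' D h2 (fun l _ h2 => hj l h2)
    rw [h3, u0] at a1
    rw [uD] at a2
    have := hD _ _ _ (a1.trans a2)
    omega
  have uinj2 : ∀ l l', l ≤ D → l' ≤ D → u l = u l' → l = l' := by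
    intro l l' h1 h2 h3
    rcases lt_trichotomy l l' with h | h | h
    · exact absurd h3 (uinj _ _ h h2)
    · exact h
    · exact absurd h3.symm (uinj _ _ h h1)
  have onL : ∀ l, l < W → ∀ x, g l = e x → (∃ y, w l = v y) ∧ ∃ y, w (l + 1) = v y := by
    intro l hl x hx
    have jx := hR.jn x
    rw [← hx] at jx
    rcases (hw.jn l hl).cases jx with ⟨h4, h5⟩ | ⟨h4, h5⟩
    · exact ⟨⟨_, h4⟩, ⟨_, h5⟩⟩
    · exact ⟨⟨_, h4⟩, ⟨_, h5⟩⟩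
  have onL' : ∀ l, l < W → ∀ x, g l = e' x → (∃ y, w l = v' y) ∧ ∃ y, w (l + 1) = v' y := by
    intro l hl x hx
    have jx := hR'.jn x
    rw [← hx] at jx
    rcases (hw.jn l hl).cases jx with ⟨h4, h5⟩ | ⟨h4, h5⟩
    · exact ⟨⟨_, h4⟩, ⟨_, h5⟩⟩
    · exact ⟨⟨_, h4⟩, ⟨_, h5⟩⟩
  -- backwards
  have hback : ∃ r, Reach x1 (v r) (w 0) := by
    rcases Nat.eq_zero_or_pos l1 with h0 | hpos
    · subst h0
      have a1 := reach_of_path 0 x1 (by omega) (fun l _ h2 => hj l (by omega))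
      rw [u0, ← ho1] at a1
      exact ⟨r0, a1⟩
    · have key : ∀ s, s < l1 → (∃ x, g (l1 - 1 - s) = e x) ∧ (x1 = 0) := by
        intro s
        induction s with
        | zero =>
          intro _
          have hlt : l1 - 1 < W := by omega
          have hsucc : l1 - 1 + 1 = l1 := by omega
          rcases hS (l1 - 1) hlt with ⟨x, hx⟩ | ⟨x, hx⟩ | ⟨x, hx, hx'⟩
          · obtain ⟨_, y, hy⟩ := onL _ hlt x hx
            rw [hsucc, ho1] at hy
            exact ⟨⟨x, hx⟩, uL _ _ hx1.le hy⟩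
          · obtain ⟨_, y, hy⟩ := onL' _ hlt x hx
            rw [hsucc, ho1] at hy
            have := uL' _ _ hx1.le hy
            omega
          · exact absurd hx' (hmin _ (by omega) x hx)
        | succ s ih =>
          intro hs
          obtain ⟨⟨x, hx⟩, h0⟩ := ih (by omega)
          refine ⟨?_, h0⟩
          obtain ⟨⟨y, hy⟩, _⟩ := onL _ (by omega) x hx
          rcases hS (l1 - 1 - (s + 1)) (by omega) with h | ⟨x', hx'⟩ | ⟨x', hx', hx''⟩
          · exact h
          · exfalso
            obtain ⟨_, y', hy'⟩ := onL' _ (by omega) x' hx'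
            rw [show l1 - 1 - (s + 1) + 1 = l1 - 1 - s by omega, hy] at hy'
            exact hdis _ _ hy'
          · exact absurd hx'' (hmin _ (by omega) x' hx')
      obtain ⟨⟨x, hx⟩, h0⟩ := key (l1 - 1) (by omega)
      rw [Nat.sub_self] at hx
      obtain ⟨⟨y, hy⟩, _⟩ := onL 0 (by omega) x hx
      refine ⟨y, ?_⟩
      rw [h0]; exact hy.symm
  obtain ⟨r, hr⟩ := hback
  -- forwards
  have hfwd : ∀ s, l1 + (s + 1) ≤ W →
      (x1 + (s + 1) ≤ D ∧ w (l1 + (s + 1)) = u (x1 + (s + 1)) ∧ g (l1 + s) = h (x1 + s)) ∨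
      (D - x1 ≤ s ∧ w (l1 + (D - x1)) = u D ∧ (∃ y, w (l1 + (s + 1)) = v' y) ∧
        ∀ t, D - x1 ≤ t → t ≤ s → ∃ x, g (l1 + t) = e' x) := by
    intro s
    induction s with
    | zero => intro _; exact Or.inl ⟨hx1, ho2, hg⟩
    | succ s ih =>
      intro hs
      rcases ih (by omega) with ⟨b1, b2, b3⟩ | ⟨b1, b2, ⟨y, b3⟩, b4⟩
      · rcases hS (l1 + (s + 1)) (by omega) with ⟨x, hx⟩ | ⟨x, hx⟩ | ⟨x, hx, hx'⟩
        · obtain ⟨⟨y, hy⟩, _⟩ := onL _ (by omega) x hx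
          rw [b2] at hy
          have := uL _ _ b1 hy
          omega
        · obtain ⟨⟨y, hy⟩, hy2⟩ := onL' _ (by omega) x hx
          rw [b2] at hy
          have := uL' _ _ b1 hy
          refine Or.inr ⟨by omega, ?_, hy2, ?_⟩
          · rw [show D - x1 = s + 1 by omega, b2, this]
          · intro t ht1 ht2
            have : t = s + 1 := by omega
            subst this; exact ⟨x, hx⟩
        · have jx := hj x hx
          rw [← hx'] at jx
          rcases (hw.jn (l1 + (s + 1)) (by omega)).cases jx with ⟨h4, h5⟩ | ⟨h4, h5⟩
          · rw [b2] at h4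
            have := uinj2 _ _ b1 (by omega) h4
            subst this
            exact Or.inl ⟨by omega, h5, hx'⟩
          · rw [b2] at h4
            have := uinj2 _ _ b1 (by omega) h4
            have hxx : x = x1 + s := by omega
            subst hxx
            have := hw.edge_inj (l := l1 + s) (l' := l1 + (s + 1)) (by omega) (by omega) (by rw [b3, hx'])
            omega
      · right
        rcases hS (l1 + (s + 1)) (by omega) with ⟨x, hx⟩ | ⟨x, hx⟩ | ⟨x, hx, hx'⟩
        · obtain ⟨⟨y', hy⟩, _⟩ := onL _ (by omega) x hx
          rw [b3] at hy
          exact absurd hy.symm (hdis _ _)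
        · obtain ⟨_, hy2⟩ := onL' _ (by omega) x hx
          refine ⟨by omega, b2, hy2, ?_⟩
          intro t ht1 ht2
          by_cases hts : t ≤ s
          · exact b4 t ht1 hts
          · have : t = s + 1 := by omega
            subst this; exact ⟨x, hx⟩
        · exfalso
          have jx := hj x hx
          rw [← hx'] at jx
          have : w (l1 + (s + 1)) = u D := by
            rcases (hw.jn (l1 + (s + 1)) (by omega)).cases jx with ⟨h4, h5⟩ | ⟨h4, h5⟩
            · rw [b3] at h4
              have := uL' _ _ (by omega) h4.symm
              omega
            · rw [h4]
              rw [b3] at h4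
              have := uL' _ _ (by omega) h4.symm
              rw [this]
          have := hw.inj _ _ (by omega) (by omega) (this.trans b2.symm)
          omega
  obtain ⟨x, t, t', c1, c2⟩ := hw.close
  have hr2 : Reach (x1 + 2) (v r) (w W) :=
    hr.trans ((Reach.one c2.symm).trans (Reach.one c1.symm))
  rcases hfwd (W - l1 - 1) (by omega) with ⟨b1, b2, b3⟩ | ⟨b1, b2, ⟨y, b3⟩, b4⟩
  · rw [show l1 + (W - l1 - 1 + 1) = W by omega] at b2
    have a2 := reach_of_path _ D b1 (fun l _ h2 => hj l h2)
    rw [← b2, uD] at a2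
    have := hD _ _ _ (hr2.trans a2)
    omega
  · rw [show l1 + (W - l1 - 1 + 1) = W by omega] at b3
    rw [b3] at hr2
    have h1 := hD _ _ _ hr2
    -- the last four edges
    have : ∀ s, s ≤ 3 → ∃ x, g (W - 4 + s) = e' x := by
      intro s hs
      obtain ⟨x, hx⟩ := b4 (W - l1 - 4 + s) (by omega) (by omega)
      exact ⟨x, by rw [← hx]; congr 1; omega⟩
    choose X hX using this
    let M := X 0 (by omega) + X 1 (by omega) + X 2 (by omega) + X 3 (by omega) + 1
    refine hR'.no_four hG hw (l := W - 4) (by omega) (lo := 0) (hi := M) (fun s hs => ⟨X s hs, by omega, ?_, hX s hs⟩)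
      (fun _ _ _ => hR'.uq hG _ _ _)
    interval_cases s <;> simp only [M] <;> omega

theorem lemQ (hG : Geo a b i j k) {v v' : ℕ → Vt a b} {e e' : ℕ → T} {p p' : ℕ → ℤ} (hR : Ray v e p)
    (hR' : Ray v' e' p') (hdis : ∀ n n', v n ≠ v' n') {D : ℕ}
    (hD : ∀ n r r', Reach n (v r) (v' r') → D ≤ n) {u : ℕ → Vt a b} {h : ℕ → T} {r0 r0' : ℕ}
    (u0 : u 0 = v r0) (uD : u D = v' r0') (hj : ∀ l, l < D → Jn (h l) (u l) (u (l + 1)))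
    {W : ℕ} (hW : 10 ≤ W) {S : T → Prop} {w : ℕ → Vt a b} {g : ℕ → T} (hw : Win W S w g)
    (hS : ∀ l, l < W → (∃ x, g l = e x) ∨ (∃ x, g l = e' x) ∨ ∃ x, x < D ∧ g l = h x) : False := by
  classical
  have hex : ∃ l, l ≤ 3 ∧ ∃ x, x < D ∧ g l = h x := by
    by_contra hcon
    push Not at hcon
    have hS2 : ∀ l, l ≤ 3 → (∃ x, g l = e x) ∨ ∃ x, g l = e' x := by
      intro l hl
      rcases hS l (by omega) with h | h | ⟨x, h1, h2⟩
      · exact Or.inl h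
      · exact Or.inr h
      · exact absurd h2 (hcon l hl x h1)
    have nosw : ∀ l, l + 1 < W → ∀ x y, g l = e x → g (l + 1) ≠ e' y := by
      intro l hl x y h1 h2
      have jx := hR.jn x
      have jy := hR'.jn y
      rw [← h1] at jx
      rw [← h2] at jy
      rcases (hw.jn l (by omega)).cases jx with ⟨h4, h5⟩ | ⟨h4, h5⟩ <;>
        rcases (hw.jn (l + 1) hl).cases jy with ⟨h6, h7⟩ | ⟨h6, h7⟩ <;>
        exact hdis _ _ (h5.symm.trans h6)
    have nosw' : ∀ l, l + 1 < W → ∀ x y, g l = e' x → g (l + 1) ≠ e y := by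
      intro l hl x y h1 h2
      have jx := hR'.jn x
      have jy := hR.jn y
      rw [← h1] at jx
      rw [← h2] at jy
      rcases (hw.jn l (by omega)).cases jx with ⟨h4, h5⟩ | ⟨h4, h5⟩ <;>
        rcases (hw.jn (l + 1) hl).cases jy with ⟨h6, h7⟩ | ⟨h6, h7⟩ <;>
        exact hdis _ _ (h6.symm.trans h5)
    rcases hS2 0 (by omega) with h | h
    · have : ∀ s, s ≤ 3 → ∃ x, g (0 + s) = e x := by
        intro s
        induction s with
        | zero => intro _; exact h
        | succ s ih =>
          intro hs
          obtain ⟨x, hx⟩ := ih (by omega)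
          rcases hS2 (0 + (s + 1)) (by omega) with h | ⟨y, h⟩
          · exact h
          · exact absurd h (nosw (0 + s) (by omega) x y hx)
      choose X hX using this
      let M := X 0 (by omega) + X 1 (by omega) + X 2 (by omega) + X 3 (by omega) + 1
      refine hR.no_four hG hw (l := 0) (by omega) (lo := 0) (hi := M) (fun s hs => ⟨X s hs, by omega, ?_, hX s hs⟩)
        (fun _ _ _ => hR.uq hG _ _ _)
      interval_cases s <;> simp only [M] <;> omega
    · have : ∀ s, s ≤ 3 → ∃ x, g (0 + s) = e' x := by
        intro s
        induction s with
        | zero => intro _; exact h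
        | succ s ih =>
          intro hs
          obtain ⟨x, hx⟩ := ih (by omega)
          rcases hS2 (0 + (s + 1)) (by omega) with ⟨y, h⟩ | h
          · exact absurd h (nosw' (0 + s) (by omega) x y hx)
          · exact h
      choose X hX using this
      let M := X 0 (by omega) + X 1 (by omega) + X 2 (by omega) + X 3 (by omega) + 1
      refine hR'.no_four hG hw (l := 0) (by omega) (lo := 0) (hi := M) (fun s hs => ⟨X s hs, by omega, ?_, hX s hs⟩)
        (fun _ _ _ => hR'.uq hG _ _ _)
      interval_cases s <;> simp only [M] <;> omega
  obtain ⟨hl1, x1, hx1, hg⟩ := Nat.find_spec hex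
  have hmin : ∀ m, m < Nat.find hex → ¬ (m ≤ 3 ∧ ∃ x, x < D ∧ g m = h x) := fun m => Nat.find_min hex
  generalize Nat.find hex = l1 at *
  have jx := hj x1 hx1
  rw [← hg] at jx
  rcases (hw.jn l1 (by omega)).cases jx with ⟨h4, h5⟩ | ⟨h4, h5⟩
  · exact lemQ_core hG hR hR' hdis hD u0 uD hj hW hw hS hl1 hx1 hg
      (fun l hl x hx hh => hmin l hl ⟨by omega, x, hx, hh⟩) h4 h5
  · refine lemQ_core hG hR' hR (fun n n' h => hdis n' n h.symm) (D := D)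
      (fun n r r' h => hD n r' r h.symm) (u := fun l => u (D - l)) (h := fun l => h (D - 1 - l))
      (r0 := r0') (r0' := r0) uD (by simpa using u0) ?_ hW hw ?_ hl1 (x1 := D - 1 - x1) (by omega) ?_ ?_ ?_ ?_
    · intro l hl
      have := (hj (D - 1 - l) (by omega)).symm
      rw [show D - 1 - l + 1 = D - l by omega] at this
      show Jn (h (D - 1 - l)) (u (D - l)) (u (D - (l + 1)))
      rwa [show D - (l + 1) = D - 1 - l by omega]
    · intro l hl
      rcases hS l hl with h | h | ⟨x, hx, hx'⟩
      · exact Or.inr (Or.inl h)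
      · exact Or.inl h
      · refine Or.inr (Or.inr ⟨D - 1 - x, by omega, ?_⟩)
        rw [hx']; congr 1; omega
    · rw [hg]; congr 1; omega
    · intro l hl x hx hh
      exact hmin l hl ⟨by omega, D - 1 - x, by omega, hh⟩
    · rw [h4]; congr 1; omega
    · rw [h5]; congr 1; omega

end meet
end TG


namespace TG

section meet2
variable {T : Type} [Group T] {a b : T} {i j k : ℕ}

theorem per_pow {v : ℕ → Vt a b} {m : T} {P : ℕ} (hP : ∀ n, v (n + P) = m • v n) (N n : ℕ) :
    v (n + N * P) = m ^ N • v n := by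
  induction N with
  | zero => simp
  | succ N ih => rw [show n + (N + 1) * P = n + N * P + P by ring, hP, ih, smul_smul, pow_succ']

theorem meet_once (hG : Geo a b i j k) {v v' : ℕ → Vt a b} {e e' : ℕ → T} {p p' : ℕ → ℤ} (hR : Ray v e p)
    (hR' : Ray v' e' p') {m : T} {P P' : ℕ} (hP0 : 0 < P) (hP : ∀ n, v (n + P) = m • v n)
    (hP' : ∀ n, v' (n + P') = m • v' n) : ∃ n n', v n = v' n' := by
  classical
  by_contra hcon
  have hdis : ∀ n n', v n ≠ v' n' := fun n n' h => hcon ⟨n, n', h⟩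
  have hk := hG.hk
  have inj := hR.inj hG
  have hex : ∃ n, ∃ r r', Reach n (v r) (v' r') := by
    obtain ⟨n, hn⟩ := connected hG (v 0) (v' 0)
    exact ⟨n, 0, 0, hn⟩
  set D := Nat.find hex with hDd
  obtain ⟨r0, r0', hr⟩ := Nat.find_spec hex
  have hD : ∀ n r r', Reach n (v r) (v' r') → D ≤ n := fun n r r' h => Nat.find_min' hex ⟨r, r', h⟩
  obtain ⟨u, h, u0, uD, hj⟩ := hr.path
  set W := 2 * k - 2 with hW
  -- choose N
  obtain ⟨N, hN0, hN⟩ : ∃ N, 0 < N ∧ ∀ n, n ≤ W + 2 * D → ¬ Reach n (v r0) (v (r0 + N * P)) := by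
    have hfin : (⋃ n ∈ Finset.range (W + 2 * D + 1), {y : Vt a b | Reach n (v r0) y}).Finite :=
      Set.Finite.biUnion (Finset.finite_toSet _) (fun n _ => ball_finite hG n (v r0))
    have hinj : Function.Injective (fun N : ℕ => v (r0 + N * P)) := by
      intro N N' hh
      have h1 := inj hh
      exact Nat.eq_of_mul_eq_mul_right hP0 (by omega)
    have hf2 := hfin.preimage (hinj.injOn)
    obtain ⟨N, hN⟩ := (hf2.union (Set.finite_singleton 0)).exists_notMem
    simp only [Set.mem_union, Set.mem_preimage, Set.mem_iUnion, Set.mem_singleton_iff, not_or,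
      Finset.mem_range, Set.mem_ofPred_eq, not_exists] at hN
    exact ⟨N, by omega, fun n hn => hN.1 n (by omega)⟩
  have pv := per_pow hP N
  have pv' := per_pow hP' N
  have uL : ∀ l r, l ≤ D → u l = v r → l = 0 := by
    intro l r hl hu
    have := reach_of_path l D hl (fun l _ h2 => hj l h2)
    rw [hu, uD] at this
    have := hD _ _ _ this
    omega
  have hj2 : ∀ l, l < D → Jn (m ^ N * h l) (m ^ N • u l) (m ^ N • u (l + 1)) := fun l hl => (hj l hl).smul _
  have u0' : m ^ N • u 0 = v (r0 + N * P) := by rw [u0, pv]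
  have uD' : m ^ N • u D = v' (r0' + N * P') := by rw [uD, pv']
  have uL2 : ∀ l r, l ≤ D → m ^ N • u l = v r → l = 0 := by
    intro l r hl hu
    have := reach_of_path (u := fun l => m ^ N • u l) l D hl (fun l _ h2 => hj2 l h2)
    rw [hu, uD'] at this
    have := hD _ _ _ this
    omega
  obtain ⟨Z, hZ⟩ := exists_Z hG
  set f : Ch T := seg e r0 (r0 + N * P) + seg e' r0' (r0' + N * P') + seg h 0 D
    + seg (fun l => m ^ N * h l) 0 D with hf
  have hmem : f ∈ Qs a b := by
    rw [← QuotientAddGroup.eq_zero_iff]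
    have e1 := seg_mk hZ (v := v) (e := e) (n := r0) (q := r0 + N * P) (by omega) (fun l _ _ => hR.jn l)
    have e2 := seg_mk hZ (v := v') (e := e') (n := r0') (q := r0' + N * P') (by omega) (fun l _ _ => hR'.jn l)
    have e3 := seg_mk hZ (v := u) (e := h) (n := 0) (q := D) (by omega) (fun l _ h2 => hj l h2)
    have e4 := seg_mk hZ (v := fun l => m ^ N • u l) (e := fun l => m ^ N * h l) (n := 0) (q := D) (by omega)
      (fun l _ h2 => hj2 l h2)
    rw [hf, QuotientAddGroup.mk_add, QuotientAddGroup.mk_add, QuotientAddGroup.mk_add]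
    erw [e1, e2, e3, e4]
    rw [u0', uD', u0, uD]
    have t1 := two_vq (Z (v r0))
    have t2 := two_vq (Z (v' r0'))
    have t3 := two_vq (Z (v (r0 + N * P)))
    have t4 := two_vq (Z (v' (r0' + N * P')))
    generalize Z (v r0) = z1 at *
    generalize Z (v' r0') = z2 at *
    generalize Z (v (r0 + N * P)) = z3 at *
    generalize Z (v' (r0' + N * P')) = z4 at *
    have : z1 + z3 + (z2 + z4) + (z1 + z2) + (z3 + z4) = (z1 + z1) + (z2 + z2) + (z3 + z3) + (z4 + z4) := by abel
    rw [this, t1, t2, t3, t4]; simp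
  have hne : f ≠ 0 := by
    intro h0
    have h1 : f (e r0) = 0 := by rw [h0]; rfl
    have hNP : 0 < N * P := Nat.mul_pos hN0 hP0
    have s1 : seg e r0 (r0 + N * P) (e r0) = 1 :=
      seg_apply_eq le_rfl (by omega) (fun l' _ _ hh => hR.e_inj hG hh)
    have s2 : seg e' r0' (r0' + N * P') (e r0) = 0 := by
      by_contra hh
      obtain ⟨l, _, _, hl⟩ := seg_apply_ne hh
      have jx := hR'.jn l
      rw [hl] at jx
      rcases (hR.jn r0).cases jx with ⟨h4, h5⟩ | ⟨h4, h5⟩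
      · exact hdis _ _ h4
      · exact hdis _ _ h4
    have s3 : seg h 0 D (e r0) = 0 := by
      by_contra hh
      obtain ⟨l, _, hl2, hl⟩ := seg_apply_ne hh
      have jx := hj l hl2
      rw [hl] at jx
      rcases jx.cases (hR.jn r0) with ⟨h4, h5⟩ | ⟨h4, h5⟩
      · have := uL _ _ (by omega) h5; omega
      · have := uL _ _ (by omega) h5; omega
    have s4 : seg (fun l => m ^ N * h l) 0 D (e r0) = 0 := by
      by_contra hh
      obtain ⟨l, _, hl2, hl⟩ := seg_apply_ne hh
      have jx := hj2 l hl2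
      rw [hl] at jx
      rcases jx.cases (hR.jn r0) with ⟨h4, h5⟩ | ⟨h4, h5⟩
      · have := uL2 _ _ (by omega) h5; omega
      · have := uL2 _ _ (by omega) h5; omega
    rw [hf, Finsupp.add_apply, Finsupp.add_apply, Finsupp.add_apply, s1, s2, s3, s4] at h1
    revert h1; decide
  obtain ⟨w, g, hw⟩ := window hG hmem hne
  have hS : ∀ l, l < W → (∃ x, g l = e x) ∨ (∃ x, g l = e' x) ∨ (∃ x, x < D ∧ g l = h x)
      ∨ ∃ x, x < D ∧ g l = m ^ N * h x := by
    intro l hl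
    have h1 := hw.supp l hl
    by_contra hh
    push Not at hh
    obtain ⟨q1, q2, q3, q4⟩ := hh
    apply h1
    have s1 : seg e r0 (r0 + N * P) (g l) = 0 := by
      by_contra hh
      obtain ⟨l, _, _, hl⟩ := seg_apply_ne hh
      exact q1 _ hl.symm
    have s2 : seg e' r0' (r0' + N * P') (g l) = 0 := by
      by_contra hh
      obtain ⟨l, _, _, hl⟩ := seg_apply_ne hh
      exact q2 _ hl.symm
    have s3 : seg h 0 D (g l) = 0 := by
      by_contra hh
      obtain ⟨l, _, hl2, hl⟩ := seg_apply_ne hh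
      exact q3 _ hl2 hl.symm
    have s4 : seg (fun l => m ^ N * h l) 0 D (g l) = 0 := by
      by_contra hh
      obtain ⟨l, _, hl2, hl⟩ := seg_apply_ne hh
      exact q4 _ hl2 hl.symm
    rw [hf, Finsupp.add_apply, Finsupp.add_apply, Finsupp.add_apply, s1, s2, s3, s4]
    simp
  have near : ∀ l x, l < W → x < D → g l = h x → ∃ n, n ≤ D ∧ Reach n (v r0) (w l) := by
    intro l x hl hx hg
    have jx := hj x hx
    rw [← hg] at jx
    rcases (hw.jn l hl).cases jx with ⟨h4, h5⟩ | ⟨h4, h5⟩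
    · refine ⟨_, ?_, by rw [h4, ← u0]; exact reach_of_path 0 x (by omega) (fun l _ h2 => hj l (by omega))⟩
      omega
    · refine ⟨_, ?_, by rw [h4, ← u0]; exact reach_of_path 0 (x+1) (by omega) (fun l _ h2 => hj l (by omega))⟩
      omega
  have near2 : ∀ l x, l < W → x < D → g l = m ^ N * h x → ∃ n, n ≤ D ∧ Reach n (v (r0 + N * P)) (w l) := by
    intro l x hl hx hg
    have jx := hj2 x hx
    rw [← hg] at jx
    rcases (hw.jn l hl).cases jx with ⟨h4, h5⟩ | ⟨h4, h5⟩
    · refine ⟨_, ?_, by rw [h4, ← u0']; exact reach_of_path (u := fun l => m ^ N • u l) 0 x (by omega) (fun l _ h2 => hj2 l (by omega))⟩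
      omega
    · refine ⟨_, ?_, by rw [h4, ← u0']; exact reach_of_path (u := fun l => m ^ N • u l) 0 (x+1) (by omega) (fun l _ h2 => hj2 l (by omega))⟩
      omega
  have wreach : ∀ l l', l < W → l' < W → ∃ n, n ≤ W ∧ Reach n (w l) (w l') := by
    intro l l' hl hl'
    rcases le_total l l' with hh | hh
    · exact ⟨l' - l, by omega, reach_of_path l l' hh (fun l _ h2 => hw.jn l (by omega))⟩
    · exact ⟨l - l', by omega, (reach_of_path l' l hh (fun l _ h2 => hw.jn l (by omega))).symm⟩
  have hboth : ¬ ((∃ l x, l < W ∧ x < D ∧ g l = h x) ∧ (∃ l x, l < W ∧ x < D ∧ g l = m ^ N * h x)) := by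
    rintro ⟨⟨l, x, h1, h2, h3⟩, ⟨l', x', h1', h2', h3'⟩⟩
    obtain ⟨n, hn, q⟩ := near l x h1 h2 h3
    obtain ⟨n', hn', q'⟩ := near2 l' x' h1' h2' h3'
    obtain ⟨n'', hn'', q''⟩ := wreach l l' h1 h1'
    exact hN _ (by omega) ((q.trans q'').trans q'.symm)
  by_cases hc : ∃ l x, l < W ∧ x < D ∧ g l = m ^ N * h x
  · refine lemQ hG hR hR' hdis hD (u := fun l => m ^ N • u l) (h := fun l => m ^ N * h l) u0' uD' hj2
      (W := W) (by omega) hw ?_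
    intro l hl
    rcases hS l hl with q | q | ⟨x, q, q'⟩ | q
    · exact Or.inl q
    · exact Or.inr (Or.inl q)
    · exact absurd ⟨⟨l, x, hl, q, q'⟩, hc⟩ hboth
    · exact Or.inr (Or.inr q)
  · refine lemQ hG hR hR' hdis hD (u := u) (h := h) u0 uD hj (W := W) (by omega) hw ?_
    intro l hl
    rcases hS l hl with q | q | q | ⟨x, q, q'⟩
    · exact Or.inl q
    · exact Or.inr (Or.inl q)
    · exact Or.inr (Or.inr q)
    · exact absurd ⟨l, x, hl, q, q'⟩ hc

/-- periodic rigid rays with the same period element eventually coincide -/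
theorem rays_merge (hG : Geo a b i j k) {v v' : ℕ → Vt a b} {e e' : ℕ → T} {p p' : ℕ → ℤ} (hR : Ray v e p)
    (hR' : Ray v' e' p') {m : T} {P P' : ℕ} (hP0 : 0 < P) (hP : ∀ n, v (n + P) = m • v n)
    (hP' : ∀ n, v' (n + P') = m • v' n) :
    ∃ r s, ∀ z, v (r + z) = v' (s + z) ∧ e (r + z) = e' (s + z) ∧ p (r + z) = p' (s + z) := by
  obtain ⟨n, n', hn⟩ := meet_once hG hR hR' hP0 hP hP'
  apply merge hG hR hR'
  intro N
  refine ⟨n + N * P, ?_, n' + N * P', ?_⟩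
  · have := Nat.mul_le_mul_left N hP0
    omega
  · rw [per_pow hP, per_pow hP', hn]

end meet2

end TG


namespace TG

/-- labels of steps along the words -/
inductive St : Type
  | f (m o : ℕ)
  | bk (m o : ℕ)
  | jxy
  | jyx
  | kxy
  | kyx

/-- exponent of the syllable at offset `o` of a block -/
def val (o : ℕ) : ℤ := if o % 2 = 1 then -1 else if o < 6 then 1 else 2

/-- exponent of a step -/
def ex : St → ℤ
  | .f _ o => val o
  | .bk _ o => - val o
  | .jxy => -1
  | .jyx => 1
  | .kxy => 1
  | .kyx => -1

/-- type of a step (`true` for `a`) -/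
def ty : St → Bool
  | .f _ o => decide (o % 2 = 0)
  | .bk _ o => decide (o % 2 = 0)
  | _ => true

/-- the next position inside the words -/
def Nxt (ρ m o m' o' : ℕ) : Prop :=
  3 ≤ m ∧ m ≤ 2 * ρ + 2 ∧ ((m' = m ∧ o' = o + 1 ∧ o + 1 < 6 + 2 * m) ∨ (o = 2 * m + 5 ∧ o' = 0 ∧
    ((m ≠ ρ + 2 ∧ m ≠ 2 * ρ + 2 ∧ m' = m + 1) ∨
      ((m = ρ + 2 ∨ m = 2 * ρ + 2) ∧ (m' = 3 ∨ m' = ρ + 3)))))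

/-- allowed consecutive steps -/
def RR (ρ : ℕ) : St → St → Prop
  | .f m o, .f m' o' => Nxt ρ m o m' o'
  | .bk m o, .bk m' o' => Nxt ρ m' o' m o
  | .f m o, .jxy => m = ρ + 2 ∧ o = 3
  | .jxy, .bk m o => m = 2 * ρ + 2 ∧ o = 2 * ρ + 3
  | .f m o, .jyx => m = 2 * ρ + 2 ∧ o = 2 * ρ + 3
  | .jyx, .bk m o => m = ρ + 2 ∧ o = 3
  | .bk m o, .kxy => m = 4 ∧ o = 1
  | .kxy, .f m o => m = ρ + 3 ∧ o = 13
  | .bk m o, .kyx => m = ρ + 3 ∧ o = 13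
  | .kyx, .f m o => m = 4 ∧ o = 1
  | _, _ => False

/-- reversal of steps -/
def rv : St → St
  | .f m o => .bk m o
  | .bk m o => .f m o
  | .jxy => .jyx
  | .jyx => .jxy
  | .kxy => .kyx
  | .kyx => .kxy

theorem RR_rv {ρ : ℕ} {s s' : St} (h : RR ρ s s') : RR ρ (rv s') (rv s) := by
  cases s <;> cases s' <;> simp only [RR, rv] at h ⊢ <;> exact h

theorem RR_ty {ρ : ℕ} {s s' : St} (h : RR ρ s s') : ty s' = !ty s := by
  cases s <;> cases s' <;> simp only [RR, ty, Nxt] at h ⊢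
  all_goals (rw [Bool.eq_iff_iff]; simp; omega)

theorem ex_cases (s : St) : ex s = 1 ∨ ex s = -1 ∨ ex s = 2 ∨ ex s = -2 := by
  cases s <;> simp only [ex, val] <;> first | split_ifs <;> simp | simp

theorem RR_rig {ρ : ℕ} (hρ : 6 ≤ ρ) {s s' s'' : St} (h : RR ρ s s') (h' : RR ρ s' s'') :
    ¬ (ex s = 1 ∧ ex s' = 1 ∧ ex s'' = 1) ∧ ¬ (ex s = -1 ∧ ex s' = -1 ∧ ex s'' = -1) := by
  cases s <;> cases s' <;> simp only [RR] at h
  all_goals cases s'' <;> simp only [RR] at h'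
  all_goals simp only [ex, val, Nxt] at *
  all_goals constructor <;> (rintro ⟨h1, h2, h3⟩; split_ifs at h1 h2 h3 <;> omega)

section words
variable {T : Type} [Group T] (a b : T)

/-- group element of a step -/
def sl (s : St) : T := (if ty s then a else b) ^ ex s

/-- group element of a syllable -/
def sy (o : ℕ) : T := (if o % 2 = 0 then a else b) ^ val o

/-- product of the first syllables of a block -/
def om : ℕ → T
  | 0 => 1
  | o + 1 => om o * sy a b o

/-- product of earlier blocks -/
def base (ρ : ℕ) : ℕ → T
  | 0 => 1
  | m + 1 => if m + 1 ≤ 3 ∨ m + 1 = ρ + 3 then 1 else base ρ m * om a b (6 + 2 * m)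

/-- position of a step -/
def src (ρ : ℕ) : St → T
  | .f m o => base a b ρ m * om a b o
  | .bk m o => base a b ρ m * om a b (o + 1)
  | .jxy => base a b ρ (ρ + 2) * om a b 4
  | .jyx => base a b ρ (2 * ρ + 2) * om a b (2 * ρ + 4)
  | .kxy => base a b ρ 4 * om a b 1
  | .kyx => base a b ρ (ρ + 3) * om a b 13

/-- the element `x` -/
def xx (ρ : ℕ) : T := base a b ρ (ρ + 2) * om a b (6 + 2 * (ρ + 2))
/-- the element `y` -/
def yy (ρ : ℕ) : T := base a b ρ (2 * ρ + 2) * om a b (6 + 2 * (2 * ρ + 2))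

theorem sl_f (m o : ℕ) : sl a b (.f m o) = sy a b o := by simp [sl, sy, ty, ex]
theorem sl_bk (m o : ℕ) : sl a b (.bk m o) = (sy a b o)⁻¹ := by
  simp only [sl, sy, ty, ex, zpow_neg, decide_eq_true_eq]

theorem sl_rv (s : St) : sl a b (rv s) = (sl a b s)⁻¹ := by
  cases s <;> simp only [sl, rv, ty, ex, zpow_neg, inv_inv, if_true, zpow_one] <;> rfl

theorem om_blk (m : ℕ) : om a b (6 + 2 * m) = (a * b⁻¹) ^ 3 * (a ^ 2 * b⁻¹) ^ m := by
  induction m with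
  | zero => simp [om, sy, val, pow_succ, mul_assoc]
  | succ m ih =>
    rw [show 6 + 2 * (m + 1) = 6 + 2 * m + 1 + 1 by ring, om, om, ih, pow_succ _ m]
    have h1 : sy a b (6 + 2 * m) = a ^ 2 := by
      unfold sy val
      rw [if_pos (by omega), if_neg (by omega), if_neg (by omega)]; norm_cast
    have h2 : sy a b (6 + 2 * m + 1) = b⁻¹ := by
      unfold sy val
      rw [if_neg (by omega), if_pos (by omega)]; simp
    rw [h1, h2]; simp only [mul_assoc]

theorem om_x (ρ : ℕ) : om a b (6 + 2 * (ρ + 2)) = om a b 4 * a * (b⁻¹ * (a ^ 2 * b⁻¹) ^ (ρ + 2)) := by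
  rw [om_blk]
  simp [om, sy, val, pow_succ, mul_assoc]

theorem om_y (ρ : ℕ) (hρ : 6 ≤ ρ) :
    om a b (6 + 2 * (2 * ρ + 2)) = om a b (2 * ρ + 4) * a ^ 2 * (b⁻¹ * (a ^ 2 * b⁻¹) ^ (ρ + 2)) := by
  obtain ⟨r, rfl⟩ : ∃ r, ρ = r + 1 := ⟨ρ - 1, by omega⟩
  rw [show 2 * (r + 1) + 4 = 6 + 2 * r by ring, om_blk, om_blk,
    show 2 * (r + 1) + 2 = r + 1 + (r + 1 + 2) by ring, pow_add, pow_succ _ r]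
  simp only [mul_assoc]

theorem base_three (ρ : ℕ) : base a b ρ 3 = 1 := by simp [base]
theorem base_r3 (ρ : ℕ) : base a b ρ (ρ + 3) = 1 := by simp [base]
theorem base_succ (ρ m : ℕ) (h1 : 3 ≤ m) (h2 : m ≠ ρ + 2) :
    base a b ρ (m + 1) = base a b ρ m * om a b (6 + 2 * m) := by
  rw [base, if_neg (by omega)]

theorem kk_eq (ρ : ℕ) (hρ : 6 ≤ ρ) : base a b ρ 4 * om a b 1 * a = base a b ρ (ρ + 3) * om a b 13 := by
  rw [base_r3, base_succ a b ρ 3 (by omega) (by omega), base_three]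
  simp only [om]
  simp [sy, val, pow_succ, mul_assoc]

variable {a b}

theorem src_mem {ρ : ℕ} (hρ : 6 ≤ ρ) {M : Subgroup T} (hx : xx a b ρ ∈ M) (hy : yy a b ρ ∈ M) {s s' : St}
    (h : RR ρ s s') : src a b ρ s * sl a b s * (src a b ρ s')⁻¹ ∈ M := by
  have hN : ∀ m o m' o', Nxt ρ m o m' o' →
      base a b ρ m * om a b (o + 1) * (base a b ρ m' * om a b o')⁻¹ ∈ M := by
    rintro m o m' o' ⟨h1, h2, ⟨rfl, rfl, h3⟩ | ⟨rfl, rfl, ⟨h3, h4, rfl⟩ | ⟨h3, h4⟩⟩⟩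
    · rw [mul_inv_cancel]; exact M.one_mem
    · rw [base_succ a b ρ m h1 h3, show 2 * m + 5 + 1 = 6 + 2 * m by ring]
      simp only [om, mul_one, mul_inv_cancel]; exact M.one_mem
    · have : base a b ρ m' * om a b 0 = 1 := by
        rcases h4 with rfl | rfl
        · rw [base_three]; simp [om]
        · rw [base_r3]; simp [om]
      rw [this, show 2 * m + 5 + 1 = 6 + 2 * m by ring]
      rcases h3 with rfl | rfl
      · simpa [xx] using hx
      · simpa [yy] using hy
  have hj : xx a b ρ * (yy a b ρ)⁻¹ = base a b ρ (ρ + 2) * om a b 4 * a⁻¹ *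
      (base a b ρ (2 * ρ + 2) * om a b (2 * ρ + 4))⁻¹ := by
    rw [xx, yy, om_x, om_y a b ρ hρ]; group
  have hk := kk_eq a b ρ hρ
  have hxy := M.mul_mem hx (M.inv_mem hy)
  cases s <;> cases s' <;> simp only [RR] at h
  case f.f m o m' o' =>
    rw [sl_f]
    simp only [src]
    rw [mul_assoc (base a b ρ m)]
    exact hN _ _ _ _ h
  case bk.bk m o m' o' =>
    rw [sl_bk]
    have := M.inv_mem (hN _ _ _ _ h)
    simp only [src, om] at this ⊢
    convert this using 1
    group
  case f.jxy m o =>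
    obtain ⟨rfl, rfl⟩ := h
    rw [sl_f]
    simp only [src]
    rw [mul_assoc (base a b ρ _)]
    change base a b ρ (ρ + 2) * om a b 4 * _ ∈ M
    rw [mul_inv_cancel]; exact M.one_mem
  case f.jyx m o =>
    obtain ⟨rfl, rfl⟩ := h
    rw [sl_f]
    simp only [src]
    rw [mul_assoc (base a b ρ _)]
    change base a b ρ (2 * ρ + 2) * om a b (2 * ρ + 4) * _ ∈ M
    rw [mul_inv_cancel]; exact M.one_mem
  case jxy.bk m o =>
    obtain ⟨rfl, rfl⟩ := h
    rw [hj] at hxy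
    simpa [src, sl, ty, ex] using hxy
  case jyx.bk m o =>
    obtain ⟨rfl, rfl⟩ := h
    rw [hj] at hxy
    have := M.inv_mem hxy
    simp only [src, sl, ty, ex] at this ⊢
    convert this using 1
    simp [mul_assoc]
  case bk.kxy m o =>
    obtain ⟨rfl, rfl⟩ := h
    rw [sl_bk]
    simp only [src]
    rw [show om a b (1 + 1) = om a b 1 * sy a b 1 from rfl, ← mul_assoc, mul_inv_cancel_right, mul_inv_cancel]
    exact M.one_mem
  case bk.kyx m o =>
    obtain ⟨rfl, rfl⟩ := h
    rw [sl_bk]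
    simp only [src]
    rw [show om a b (13 + 1) = om a b 13 * sy a b 13 from rfl, ← mul_assoc, mul_inv_cancel_right, mul_inv_cancel]
    exact M.one_mem
  case kxy.f m o =>
    obtain ⟨rfl, rfl⟩ := h
    have : sl a b .kxy = a := by simp [sl, ty, ex]
    simp only [src]
    rw [this, hk, mul_inv_cancel]; exact M.one_mem
  case kyx.f m o =>
    obtain ⟨rfl, rfl⟩ := h
    have : sl a b .kyx = a⁻¹ := by simp [sl, ty, ex]
    simp only [src]
    rw [this, ← hk, mul_inv_cancel_right, mul_inv_cancel]; exact M.one_mem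

end words

end TG


namespace TG

section tracks
variable {T : Type} [Group T] {a b : T} {i j k ρ : ℕ}

/-- one step of a walk -/
def Mv (a b : T) (ρ : ℕ) (q q' : T × St) : Prop := RR ρ q.2 q'.2 ∧ q'.1 = q.1 * sl a b q.2

theorem Mv.lmul (g : T) {q q' : T × St} (h : Mv a b ρ q q') : Mv a b ρ (g * q.1, q.2) (g * q'.1, q'.2) :=
  ⟨h.1, by simp only [h.2, mul_assoc]⟩

theorem Mv.rev {q q' : T × St} (h : Mv a b ρ q q') :
    Mv a b ρ (q'.1 * sl a b q'.2, rv q'.2) (q.1 * sl a b q.2, rv q.2) := by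
  refine ⟨RR_rv h.1, ?_⟩
  simp only
  rw [sl_rv, mul_inv_cancel_right, h.2]

/-- an infinite walk -/
def Track (a b : T) (ρ : ℕ) (e : ℕ → T) (s : ℕ → St) : Prop :=
  ∀ n, RR ρ (s n) (s (n + 1)) ∧ e (n + 1) = e n * sl a b (s n)

/-- vertices of a walk -/
def vx (a b : T) (e : ℕ → T) (s : ℕ → St) (n : ℕ) : Vt a b := if ty (s n) then VB a b (e n) else VA a b (e n)

theorem Track.ray (hρ : 6 ≤ ρ) {e : ℕ → T} {s : ℕ → St} (h : Track a b ρ e s) :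
    Ray (vx a b e s) e (fun n => ex (s n)) := by
  have key : ∀ n, (ty (s n) = true ∧ vx a b e s (n + 1) = VA a b (e n)) ∨
      (ty (s n) = false ∧ vx a b e s (n + 1) = VB a b (e n)) := by
    intro n
    have ht := RR_ty (h n).1
    cases hs : ty (s n)
    · right
      refine ⟨rfl, ?_⟩
      rw [hs] at ht
      simp only [vx, ht, Bool.not_false, if_true, (h n).2, sl, hs]
      exact (VB_eq.2 ⟨ex (s n), rfl⟩).symm
    · left
      refine ⟨rfl, ?_⟩
      rw [hs] at ht
      simp only [vx, ht, Bool.not_true, if_true, (h n).2, sl, hs]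
      exact (VA_eq.2 ⟨ex (s n), rfl⟩).symm
  refine ⟨?_, ?_, fun n => ex_cases _, fun n => (RR_rig hρ (h n).1 (h (n + 1)).1).1,
    fun n => (RR_rig hρ (h n).1 (h (n + 1)).1).2⟩
  · intro n
    rcases key n with ⟨h1, h2⟩ | ⟨h1, h2⟩
    · right; exact ⟨by simp [vx, h1], h2⟩
    · left; exact ⟨by simp [vx, h1], h2⟩
  · intro n
    rw [(h n).2]
    rcases key n with ⟨h1, h2⟩ | ⟨h1, h2⟩
    · rw [h2, gn_VA, sl, h1]; rfl
    · rw [h2, gn_VB, sl, h1]; rfl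

theorem vx_ty {e e' : ℕ → T} {s s' : ℕ → St} {n n' : ℕ} (h : vx a b e s n = vx a b e' s' n') :
    ty (s n) = ty (s' n') := by
  unfold vx at h
  cases h1 : ty (s n) <;> cases h2 : ty (s' n') <;> simp only [h1, h2] at h ⊢
  · exact absurd h (VA_ne_VB a b _ _)
  · exact absurd h.symm (VA_ne_VB a b _ _)

theorem Track.mem (hρ : 6 ≤ ρ) {e : ℕ → T} {s : ℕ → St} (h : Track a b ρ e s) {M : Subgroup T}
    (hx : xx a b ρ ∈ M) (hy : yy a b ρ ∈ M) (h0 : e 0 * (src a b ρ (s 0))⁻¹ ∈ M) (n : ℕ) :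
    e n * (src a b ρ (s n))⁻¹ ∈ M := by
  induction n with
  | zero => exact h0
  | succ n ih =>
    have := M.mul_mem ih (src_mem hρ hx hy (h n).1)
    rw [(h n).2]
    convert this using 1
    group

theorem Track.lmul {e : ℕ → T} {s : ℕ → St} (h : Track a b ρ e s) (g : T) :
    Track a b ρ (fun n => g * e n) s := fun n => ⟨(h n).1, by simp only [(h n).2, mul_assoc]⟩

theorem path_of {q q' : T × St} (h : Relation.TransGen (Mv a b ρ) q q') :
    ∃ (P : ℕ) (c : ℕ → T × St), 0 < P ∧ c 0 = q ∧ c P = q' ∧ ∀ l, l < P → Mv a b ρ (c l) (c (l + 1)) := by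
  induction h with
  | single h => exact ⟨1, fun l => if l = 0 then q else _, one_pos, by simp, by simp; rfl, by
      intro l hl
      obtain rfl : l = 0 := by omega
      simpa using h⟩
  | @tail q1 q2 _ h ih =>
    obtain ⟨P, c, h1, h2, h3, h4⟩ := ih
    refine ⟨P + 1, fun l => if l ≤ P then c l else q2, by omega, by simpa using h2, by simp, ?_⟩
    intro l hl
    rcases Nat.lt_or_ge l P with h5 | h5
    · simp only
      rw [if_pos (by omega), if_pos (by omega)]
      exact h4 l h5
    · obtain rfl : l = P := by omega
      simp only
      rw [if_pos le_rfl, if_neg (by omega), h3]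
      exact h

theorem periodic_of {x m : T} {s : St} (h : Relation.TransGen (Mv a b ρ) (x, s) (m * x, s)) :
    ∃ (P : ℕ) (e : ℕ → T) (σ : ℕ → St), 0 < P ∧ Track a b ρ e σ ∧ e 0 = x ∧ σ 0 = s ∧
      (∀ n, e (n + P) = m * e n) ∧ ∀ n, σ (n + P) = σ n := by
  obtain ⟨P, c, h1, h2, h3, h4⟩ := path_of h
  refine ⟨P, fun n => m ^ (n / P) * (c (n % P)).1, fun n => (c (n % P)).2, h1, ?_, ?_, ?_, ?_, ?_⟩
  · intro n
    have hl := Nat.mod_lt n h1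
    have hn := Nat.div_add_mod n P
    have hm := h4 _ hl
    simp only
    generalize n / P = q at *
    generalize n % P = l at *
    subst hn
    rcases Nat.lt_or_ge (l + 1) P with h5 | h5
    · have e1 : (P * q + l + 1) % P = l + 1 := by
        rw [add_assoc, Nat.mul_add_mod, Nat.mod_eq_of_lt h5]
      have e2 : (P * q + l + 1) / P = q := by
        rw [add_assoc, Nat.mul_add_div h1, Nat.div_eq_of_lt h5, add_zero]
      rw [e1, e2]
      exact ⟨hm.1, by rw [hm.2, mul_assoc]⟩
    · obtain h6 : l + 1 = P := by omega
      have e0 : P * q + l + 1 = P * (q + 1) := by rw [mul_add, mul_one]; omega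
      rw [e0, Nat.mul_mod_right, Nat.mul_div_cancel_left _ h1, h2]
      rw [h6, h3] at hm
      refine ⟨hm.1, ?_⟩
      have := hm.2
      simp only at this ⊢
      rw [pow_succ, mul_assoc, this, mul_assoc]
  · simp [h2]
  · simp [h2]
  · intro n
    simp only [Nat.add_mod_right, Nat.add_div_right n h1, pow_succ', mul_assoc]
  · intro n
    simp

theorem fwd_run {s : ℕ → St} (hs : ∀ n, RR ρ (s n) (s (n + 1))) {n m o : ℕ} (h : s n = .f m o)
    (h1 : m ≠ ρ + 2) (h2 : m ≠ 2 * ρ + 2) (t : ℕ) (ht : o + t < 6 + 2 * m) : s (n + t) = .f m (o + t) := by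
  induction t with
  | zero => exact h
  | succ t ih =>
    have h3 := hs (n + t)
    rw [ih (by omega)] at h3
    rw [← add_assoc, ← add_assoc]
    cases h4 : s (n + t + 1) <;> rw [h4] at h3 <;> simp only [RR, Nxt] at h3
    · congr 1 <;> omega
    · omega
    · omega

theorem fwd_next {s : ℕ → St} (hs : ∀ n, RR ρ (s n) (s (n + 1))) {n m : ℕ} (h : s n = .f m (2 * m + 5))
    (h1 : m ≠ ρ + 2) (h2 : m ≠ 2 * ρ + 2) : s (n + 1) = .f (m + 1) 0 := by
  have h3 := hs n
  rw [h] at h3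
  cases h4 : s (n + 1) <;> rw [h4] at h3 <;> simp only [RR, Nxt] at h3
  · congr 1 <;> omega
  · omega
  · omega

/-- from an entry point of a positive letter a full block is read -/
theorem marker (hρ : 6 ≤ ρ) {s : ℕ → St} (hs : ∀ n, RR ρ (s n) (s (n + 1))) {n m o : ℕ} (h : s n = .f m o)
    (h1 : m = 4 ∧ o = 1 ∨ m = ρ + 3 ∧ o = 13) :
    ∃ q, (∀ t, 3 + t < 6 + 2 * (m + 1) → s (n + q + t) = .f (m + 1) (3 + t)) ∧
      s (n + q + (3 + 2 * (m + 1))) = .f (m + 2) 0 := by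
  obtain ⟨t, ht⟩ : ∃ t, o + t = 2 * m + 5 := ⟨2 * m + 5 - o, by omega⟩
  have e1 := fwd_run hs h (by omega) (by omega) t (by omega)
  rw [ht] at e1
  have e2 := fwd_next hs e1 (by omega) (by omega)
  have e3 := fwd_run hs e2 (by omega) (by omega)
  refine ⟨t + 1 + 3, ?_, ?_⟩
  · intro t' ht'
    have := e3 (3 + t') (by omega)
    rw [show n + (t + 1 + 3) + t' = n + t + 1 + (3 + t') by ring, this]
    congr 1; omega
  · have := e3 (2 * (m + 1) + 5) (by omega)
    rw [Nat.zero_add] at this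
    have := fwd_next hs this (by omega) (by omega)
    rw [← this]; congr 1; ring

theorem sync (hρ : 6 ≤ ρ) {s s' : ℕ → St} (hs' : ∀ n, RR ρ (s' n) (s' (n + 1)))
    {n n' M : ℕ} (hM : 3 ≤ M) (hM2 : M + 1 ≠ ρ) (h1 : ∀ t, 3 + t < 6 + 2 * M → s (n + t) = .f M (3 + t))
    (h2 : s (n + (3 + 2 * M)) = .f (M + 1) 0)
    (hty : ty (s n) = ty (s' n')) (hex : ∀ t, ex (s (n + t)) = ex (s' (n' + t))) : s' n' = .f M 3 := by
  have g0 := h1 0 (by omega)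
  have x0 := hex 0
  have x1 := hex 1
  have x2 := hex 2
  have x3 := hex 3
  have r0 := hs' n'
  have r1 := hs' (n' + 1)
  have r2 := hs' (n' + 2)
  rw [g0] at x0
  rw [add_zero] at g0
  rw [g0] at hty
  rw [h1 1 (by omega)] at x1
  rw [h1 2 (by omega)] at x2
  rw [h1 3 (by omega)] at x3
  have hv0 : val 3 = -1 := rfl
  have hv1 : val 4 = 1 := rfl
  have hv2 : val 5 = -1 := rfl
  have hv3 : val 6 = 2 := rfl
  simp only [ex, add_zero, hv0, hv1, hv2, hv3, Nat.reduceAdd] at x0 x1 x2 x3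
  have hm : ∃ m, s' n' = .f m 3 := by
    cases c0 : s' n' with
    | f m o =>
      rw [c0] at r0 x0 hty
      cases c1 : s' (n' + 1) with
      | f m1 o1 =>
        rw [c1] at r0 r1 x1
        cases c2 : s' (n' + 2) with
        | f m2 o2 =>
          rw [c2] at r1 r2 x2
          cases c3 : s' (n' + 3) with
          | f m3 o3 =>
            rw [c3] at r2 x3
            refine ⟨m, ?_⟩
            simp only [RR, Nxt, ex, val] at *
            congr 1
            split_ifs at x0 x1 x2 x3 <;> omega
          | bk m3 o3 => rw [c3] at r2; simp only [RR] at r2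
          | jxy => rw [c3] at x3; simp [ex] at x3
          | jyx => rw [c3] at x3; simp [ex] at x3
          | kxy => rw [c3] at x3; simp [ex] at x3
          | kyx => rw [c3] at x3; simp [ex] at x3
        | bk m2 o2 => rw [c2] at r1; simp only [RR] at r1
        | jxy =>
          rw [c2] at r1; simp only [RR] at r0 r1
          simp only [ex, val, Nxt] at *
          split_ifs at * <;> omega
        | jyx =>
          rw [c2] at x2; simp [ex] at x2
        | kxy => rw [c2] at r1; simp only [RR] at r1
        | kyx => rw [c2] at r1; simp only [RR] at r1
      | bk m1 o1 => rw [c1] at r0; simp only [RR] at r0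
      | jxy => rw [c1] at x1; simp [ex] at x1
      | jyx =>
        rw [c1] at r1
        cases c2 : s' (n' + 2) <;> rw [c2] at r1 x2 <;> simp only [RR] at r1
        obtain ⟨rfl, rfl⟩ := r1
        simp [ex, val] at x2
      | kxy => rw [c1] at r0; simp only [RR] at r0
      | kyx => rw [c1] at r0; simp only [RR] at r0
    | bk m o =>
      rw [c0] at x0 hty
      simp only [ex, val, ty] at x0 hty
      rw [Bool.eq_iff_iff] at hty
      simp at hty
      split_ifs at x0 <;> omega
    | jxy => rw [c0] at hty; simp [ty] at hty
    | jyx => rw [c0] at hty; simp [ty] at hty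
    | kxy => rw [c0] at hty; simp [ty] at hty
    | kyx => rw [c0] at hty; simp [ty] at hty
  obtain ⟨m, hm⟩ := hm
  have run : ∀ t, 3 + t < 6 + 2 * m → 3 + t < 6 + 2 * M → s' (n' + t) = .f m (3 + t) := by
    intro t
    induction t with
    | zero => intro _ _; exact hm
    | succ t ih =>
      intro q1 q2
      have h3 := hs' (n' + t)
      rw [ih (by omega) (by omega)] at h3
      have x := hex (t + 1)
      rw [h1 (t + 1) q2, ← add_assoc n'] at x
      rw [← add_assoc]
      cases h4 : s' (n' + t + 1) <;> rw [h4] at h3 x <;> simp only [RR, Nxt, ex, val] at h3 x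
      · congr 1 <;> omega
      · split_ifs at x <;> omega
      · split_ifs at x <;> omega
  rcases lt_trichotomy m M with hlt | heq | hlt
  · exfalso
    have l1 := run (2 * m + 2) (by omega) (by omega)
    have x := hex (2 * m + 3)
    rw [h1 _ (by omega)] at x
    have h3 := hs' (n' + (2 * m + 2))
    rw [l1] at h3
    rw [show n' + (2 * m + 3) = n' + (2 * m + 2) + 1 by ring] at x
    cases h4 : s' (n' + (2 * m + 2) + 1) <;> rw [h4] at h3 x <;> simp only [RR, Nxt, ex, val] at h3 x
    · split_ifs at x <;> omega
    · split_ifs at x <;> omega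
    · split_ifs at x <;> omega
  · rw [hm, heq]
  · exfalso
    have l1 := run (2 * M + 2) (by omega) (by omega)
    have x := hex (3 + 2 * M)
    rw [h2] at x
    have h3 := hs' (n' + (2 * M + 2))
    rw [l1] at h3
    rw [show n' + (3 + 2 * M) = n' + (2 * M + 2) + 1 by ring] at x
    cases h4 : s' (n' + (2 * M + 2) + 1) <;> rw [h4] at h3 x <;> simp only [RR, Nxt, ex, val] at h3 x
    · split_ifs at x <;> omega
    · split_ifs at x <;> omega
    · omega

end tracks

end TG


namespace TG

section letters
open Relation
variable {T : Type} [Group T] {a b : T} {ρ : ℕ}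

theorem rtg_lmul (g : T) {q q' : T × St} (h : ReflTransGen (Mv a b ρ) q q') :
    ReflTransGen (Mv a b ρ) (g * q.1, q.2) (g * q'.1, q'.2) :=
  h.lift (fun q => (g * q.1, q.2)) (fun _ _ h => h.lmul g)

theorem tg_lmul (g : T) {q q' : T × St} (h : TransGen (Mv a b ρ) q q') :
    TransGen (Mv a b ρ) (g * q.1, q.2) (g * q'.1, q'.2) :=
  h.lift (fun q => (g * q.1, q.2)) (fun _ _ h => h.lmul g)

theorem rtg_rev {q q' : T × St} (h : ReflTransGen (Mv a b ρ) q q') :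
    ReflTransGen (Mv a b ρ) (q'.1 * sl a b q'.2, rv q'.2) (q.1 * sl a b q.2, rv q.2) := by
  induction h with
  | refl => exact ReflTransGen.refl
  | tail _ h ih => exact ReflTransGen.head h.rev ih

theorem tg_rev {q q' : T × St} (h : TransGen (Mv a b ρ) q q') :
    TransGen (Mv a b ρ) (q'.1 * sl a b q'.2, rv q'.2) (q.1 * sl a b q.2, rv q.2) := by
  induction h with
  | single h => exact TransGen.single h.rev
  | tail _ h ih => exact TransGen.head h.rev ih

theorem src_f_sl (m o : ℕ) : src a b ρ (.f m o) * sl a b (.f m o) = src a b ρ (.bk m o) := by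
  rw [sl_f]; simp only [src, om, mul_assoc]

theorem src_bk_sl (m o : ℕ) : src a b ρ (.bk m o) * sl a b (.bk m o) = src a b ρ (.f m o) := by
  rw [sl_bk]; simp only [src, om, mul_assoc, mul_inv_cancel, mul_one]

theorem in_block {m o : ℕ} (h3 : 3 ≤ m) (h4 : m ≤ 2 * ρ + 2) (o' : ℕ) (h1 : o ≤ o') (h2 : o' < 6 + 2 * m) :
    ReflTransGen (Mv a b ρ) (src a b ρ (.f m o), .f m o) (src a b ρ (.f m o'), .f m o') := by
  induction o', h1 using Nat.le_induction with
  | base => exact ReflTransGen.refl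
  | succ o' ho ih =>
    refine (ih (by omega)).tail ⟨?_, ?_⟩
    · show Nxt _ _ _ _ _; unfold Nxt; omega
    · simp only; rw [src_f_sl]; rfl

theorem next_block {m : ℕ} (h3 : 3 ≤ m) (h4 : m ≤ 2 * ρ + 2) (h1 : m ≠ ρ + 2) (h2 : m ≠ 2 * ρ + 2) :
    Mv a b ρ (src a b ρ (.f m (2 * m + 5)), .f m (2 * m + 5)) (src a b ρ (.f (m + 1) 0), .f (m + 1) 0) := by
  refine ⟨?_, ?_⟩
  · show Nxt _ _ _ _ _; unfold Nxt; omega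
  · simp only; rw [src_f_sl]; simp only [src]
    rw [base_succ a b ρ m h3 h1, show 2 * m + 5 + 1 = 6 + 2 * m by ring]; simp [om]

theorem blocks {m : ℕ} (m' : ℕ) (h : m ≤ m') (h3 : 3 ≤ m) (h4 : m' ≤ 2 * ρ + 2) (h5 : m' ≤ ρ + 2 ∨ ρ + 3 ≤ m) :
    ReflTransGen (Mv a b ρ) (src a b ρ (.f m 0), .f m 0) (src a b ρ (.f m' 0), .f m' 0) := by
  induction m', h using Nat.le_induction with
  | base => exact ReflTransGen.refl
  | succ m' hm ih =>
    exact ((ih (by omega) (by omega)).trans (in_block (by omega) (by omega) (2 * m' + 5) (by omega) (by omega))).tail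
      (next_block (by omega) (by omega) (by omega) (by omega))

theorem fwd_path {m o m' o' : ℕ} (h : m < m') (h3 : 3 ≤ m) (h4 : m' ≤ 2 * ρ + 2) (h5 : m' ≤ ρ + 2 ∨ ρ + 3 ≤ m)
    (ho : o < 6 + 2 * m) (ho' : o' < 6 + 2 * m') :
    ReflTransGen (Mv a b ρ) (src a b ρ (.f m o), .f m o) (src a b ρ (.f m' o'), .f m' o') :=
  (((in_block (by omega) (by omega) (2 * m + 5) (by omega) (by omega)).tail
    (next_block (by omega) (by omega) (by omega) (by omega))).trans
    (blocks m' (by omega) (by omega) (by omega) (by omega))).trans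
    (in_block (by omega) (by omega) o' (by omega) ho')

/-- generators -/
def gx (a b : T) (ρ : ℕ) (c : Fin 2) : T := if c = 0 then xx a b ρ else yy a b ρ
/-- value of a letter -/
def gv (a b : T) (ρ : ℕ) (l : Fin 2 × Bool) : T := if l.2 then gx a b ρ l.1 else (gx a b ρ l.1)⁻¹
/-- entry step of a letter -/
def ent (ρ : ℕ) (l : Fin 2 × Bool) : St :=
  if l.2 then (if l.1 = 0 then .f 4 1 else .f (ρ + 3) 13)
  else (if l.1 = 0 then .bk (ρ + 2) 3 else .bk (2 * ρ + 2) (2 * ρ + 3))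
/-- exit step of a positive letter -/
def ext (ρ : ℕ) (c : Fin 2) : St := if c = 0 then .f (ρ + 2) 3 else .f (2 * ρ + 2) (2 * ρ + 3)
/-- entry position of a letter -/
def kp (a b : T) (ρ : ℕ) (l : Fin 2 × Bool) : T :=
  if l.2 then src a b ρ (ent ρ l) else (gx a b ρ l.1)⁻¹ * src a b ρ (ent ρ l)

theorem ent_ext (hρ : 6 ≤ ρ) (c : Fin 2) :
    ReflTransGen (Mv a b ρ) (src a b ρ (ent ρ (c, true)), ent ρ (c, true)) (src a b ρ (ext ρ c), ext ρ c) := by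
  unfold ent ext
  by_cases hc : c = 0
  · simp only [hc, if_true]
    exact fwd_path (by omega) (by omega) (by omega) (by omega) (by omega) (by omega)
  · simp only [hc, if_true, if_false]
    exact fwd_path (by omega) (by omega) (by omega) (by omega) (by omega) (by omega)

theorem ext_ent (hρ : 6 ≤ ρ) (c c' : Fin 2) :
    TransGen (Mv a b ρ) (src a b ρ (ext ρ c), ext ρ c)
      (gx a b ρ c * src a b ρ (ent ρ (c', true)), ent ρ (c', true)) := by
  -- last step of the letter
  obtain ⟨E, hE, hE2, q1⟩ : ∃ E, (E = ρ + 2 ∨ E = 2 * ρ + 2) ∧ gx a b ρ c = base a b ρ E * om a b (6 + 2 * E) ∧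
      ReflTransGen (Mv a b ρ) (src a b ρ (ext ρ c), ext ρ c) (src a b ρ (.f E (2 * E + 5)), .f E (2 * E + 5)) := by
    unfold ext gx
    by_cases hc : c = 0
    · refine ⟨ρ + 2, Or.inl rfl, by simp [hc, xx], ?_⟩
      simp only [hc, if_true]
      exact in_block (by omega) (by omega) _ (by omega) (by omega)
    · refine ⟨2 * ρ + 2, Or.inr rfl, by simp [hc, yy], ?_⟩
      simp only [hc, if_false]
      exact in_block (by omega) (by omega) _ (by omega) (by omega)
  obtain ⟨F, hF, hF2, q2⟩ : ∃ F, (F = 3 ∨ F = ρ + 3) ∧ base a b ρ F = 1 ∧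
      ReflTransGen (Mv a b ρ) (src a b ρ (.f F 0), .f F 0) (src a b ρ (ent ρ (c', true)), ent ρ (c', true)) := by
    unfold ent
    by_cases hc : c' = 0
    · refine ⟨3, Or.inl rfl, base_three a b ρ, ?_⟩
      simp only [hc, if_true]
      exact fwd_path (by omega) (by omega) (by omega) (by omega) (by omega) (by omega)
    · refine ⟨ρ + 3, Or.inr rfl, base_r3 a b ρ, ?_⟩
      simp only [hc, if_true, if_false]
      exact in_block (by omega) (by omega) _ (by omega) (by omega)
  have q3 := rtg_lmul (gx a b ρ c) q2
  refine TransGen.trans_left (TransGen.tail' q1 ?_) q3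
  refine ⟨?_, ?_⟩
  · show Nxt _ _ _ _ _; unfold Nxt; omega
  · simp only; rw [src_f_sl, hE2]; simp only [src]
    rw [hF2, show 2 * E + 5 + 1 = 6 + 2 * E by ring]; simp [om]

theorem rv_ext (c : Fin 2) : rv (ext ρ c) = ent ρ (c, false) := by
  unfold ext ent; by_cases hc : c = 0 <;> simp [hc, rv]

theorem src_ext (c : Fin 2) : src a b ρ (ext ρ c) * sl a b (ext ρ c) = src a b ρ (ent ρ (c, false)) := by
  unfold ext ent; by_cases hc : c = 0
  · simp only [hc, if_true]; exact src_f_sl _ _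
  · simp only [hc, if_false]; exact src_f_sl _ _

theorem jj_eq (hρ : 6 ≤ ρ) : src a b ρ .jxy * a⁻¹ = xx a b ρ * ((yy a b ρ)⁻¹ * src a b ρ .jyx) := by
  rw [xx, yy, om_x, om_y a b ρ hρ]; simp only [src]; group

theorem hop (hρ : 6 ≤ ρ) (l l' : Fin 2 × Bool) (h : l.1 = l'.1 → l.2 = l'.2) :
    TransGen (Mv a b ρ) (kp a b ρ l, ent ρ l) (gv a b ρ l * kp a b ρ l', ent ρ l') := by
  obtain ⟨c, β⟩ := l
  obtain ⟨c', β'⟩ := l'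
  cases β <;> cases β'
  · have q := tg_rev (TransGen.trans_left (ext_ent (a := a) (b := b) hρ c' c)
      (rtg_lmul (gx a b ρ c') (ent_ext (a := a) (b := b) hρ c)))
    have q2 := tg_lmul ((gx a b ρ c)⁻¹ * (gx a b ρ c')⁻¹) q
    simp only [rv_ext, src_ext, mul_assoc, inv_mul_cancel_left] at q2
    simp only [kp, gv]
    exact q2
  · have q := rtg_rev (ent_ext (a := a) (b := b) hρ c)
    simp only [rv_ext, src_ext] at q
    have hk := kk_eq a b ρ hρ
    have key : TransGen (Mv a b ρ) (src a b ρ (ent ρ (c, true)) * sl a b (ent ρ (c, true)), rv (ent ρ (c, true)))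
        (src a b ρ (ent ρ (c', true)), ent ρ (c', true)) := by
      have hcc : ¬ (c = c') := fun h1 => absurd (h h1) (by simp)
      by_cases hc : c = 0
      · have hc' : ¬ (c' = 0) := fun h2 => hcc (hc.trans h2.symm)
        simp only [ent, hc, hc', if_true, if_false, src_f_sl, rv]
        refine TransGen.head (b := (src a b ρ .kxy, .kxy)) ⟨?_, ?_⟩ (TransGen.single ⟨?_, ?_⟩)
        · simp [RR]
        · simp only [src_bk_sl]; rfl
        · simp [RR]
        · have : sl a b .kxy = a := by simp [sl, ty, ex]
          simp only [this]
          exact hk.symm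
      · have hc' : c' = 0 := by omega
        simp only [ent, hc, hc', if_true, if_false, src_f_sl, rv]
        refine TransGen.head (b := (src a b ρ .kyx, .kyx)) ⟨?_, ?_⟩ (TransGen.single ⟨?_, ?_⟩)
        · simp [RR]
        · simp only [src_bk_sl]; rfl
        · simp [RR]
        · have : sl a b .kyx = a⁻¹ := by simp [sl, ty, ex]
          simp only [this]
          rw [eq_mul_inv_iff_mul_eq]
          exact hk
    have q2 := tg_lmul (gx a b ρ c)⁻¹ (TransGen.trans_right q key)
    simp only [kp, gv]
    exact q2
  · have q := ent_ext (a := a) (b := b) hρ c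
    have hj := jj_eq (a := a) (b := b) (ρ := ρ) hρ
    have key : TransGen (Mv a b ρ) (src a b ρ (ext ρ c), ext ρ c)
        (gx a b ρ c * ((gx a b ρ c')⁻¹ * src a b ρ (ent ρ (c', false))), ent ρ (c', false)) := by
      have hcc : ¬ (c = c') := fun h1 => absurd (h h1) (by simp)
      by_cases hc : c = 0
      · have hc' : ¬ (c' = 0) := fun h2 => hcc (hc.trans h2.symm)
        simp only [ent, ext, gx, hc, hc', if_true, if_false]
        refine TransGen.head (b := (src a b ρ .jxy, .jxy)) ⟨?_, ?_⟩ (TransGen.single ⟨?_, ?_⟩)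
        · simp [RR]
        · simp only [src_f_sl]; rfl
        · simp [RR]
        · have : sl a b .jxy = a⁻¹ := by simp [sl, ty, ex]
          simp only [this]
          exact hj.symm
      · have hc' : c' = 0 := by omega
        simp only [ent, ext, gx, hc, hc', if_true, if_false]
        refine TransGen.head (b := (src a b ρ .jyx, .jyx)) ⟨?_, ?_⟩ (TransGen.single ⟨?_, ?_⟩)
        · simp [RR]
        · simp only [src_f_sl]; rfl
        · simp [RR]
        · have : sl a b .jyx = a := by simp [sl, ty, ex]
          simp only [this]
          change yy a b ρ * ((xx a b ρ)⁻¹ * src a b ρ .jxy) = _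
          rw [mul_inv_eq_iff_eq_mul] at hj
          rw [hj]; group
    simp only [kp, gv]
    exact TransGen.trans_right q key
  · simp only [kp, gv]
    exact TransGen.trans_right (ent_ext hρ c) (ext_ent hρ c c')

/-- product of letters -/
def pv (a b : T) (ρ : ℕ) (L : List (Fin 2 × Bool)) : T := (L.map (gv a b ρ)).prod

theorem walk (hρ : 6 ≤ ρ) (L : List (Fin 2 × Bool)) : ∀ l l' : Fin 2 × Bool,
    List.IsChain (fun l l' : Fin 2 × Bool => l.1 = l'.1 → l.2 = l'.2) (l :: (L ++ [l'])) →
    TransGen (Mv a b ρ) (kp a b ρ l, ent ρ l) (pv a b ρ (l :: L) * kp a b ρ l', ent ρ l') := by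
  induction L with
  | nil =>
    intro l l' h
    simp at h
    simpa [pv] using hop hρ l l' h
  | cons l1 L ih =>
    intro l l' h
    rw [List.cons_append, List.isChain_cons_cons] at h
    have q := tg_lmul (gv a b ρ l) (ih l1 l' h.2)
    refine (hop hρ l l1 h.1).trans ?_
    simpa [pv, mul_assoc] using q

end letters

end TG


namespace TG

section final
variable {T : Type} [Group T] {a b : T} {i j k ρ : ℕ}

/-- cyclically reduced words, as a chain condition -/
def Cyc (l : Fin 2 × Bool) (L : List (Fin 2 × Bool)) : Prop :=
  List.IsChain (fun l l' : Fin 2 × Bool => l.1 = l'.1 → l.2 = l'.2) (l :: (L ++ [l]))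

theorem exists_cyc (w : FreeGroup (Fin 2)) (hw : w ≠ 1) :
    ∃ c l L, Cyc l L ∧ w = c * FreeGroup.mk (l :: L) * c⁻¹ := by
  have h1 := FreeGroup.reduceCyclically.isCyclicallyReduced (FreeGroup.isReduced_toWord (x := w))
  have h2 := FreeGroup.reduceCyclically.conj_conjugator_reduceCyclically w.toWord
  have h3 : w = FreeGroup.mk (FreeGroup.reduceCyclically.conjugator w.toWord) *
      FreeGroup.mk (FreeGroup.reduceCyclically w.toWord) *
      (FreeGroup.mk (FreeGroup.reduceCyclically.conjugator w.toWord))⁻¹ := by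
    rw [FreeGroup.inv_mk, FreeGroup.mul_mk, FreeGroup.mul_mk, h2, FreeGroup.mk_toWord]
  cases h4 : FreeGroup.reduceCyclically w.toWord with
  | nil =>
    rw [h4] at h3
    exfalso; apply hw
    rw [show FreeGroup.mk ([] : List (Fin 2 × Bool)) = 1 from rfl, mul_one, mul_inv_cancel] at h3
    exact h3
  | cons l L =>
    rw [h4] at h3 h1
    refine ⟨_, l, L, ?_, h3⟩
    unfold Cyc
    rw [← List.cons_append, List.isChain_append]
    refine ⟨h1.1, by simp, ?_⟩
    intro x hx y hy
    simp at hy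
    subst hy
    exact h1.2 x hx l (by simp)

theorem exists_pos (w : FreeGroup (Fin 2)) (hw : w ≠ 1) :
    ∃ c l L, Cyc l L ∧ l.2 = true ∧ (w = c * FreeGroup.mk (l :: L) * c⁻¹ ∨ w⁻¹ = c * FreeGroup.mk (l :: L) * c⁻¹) := by
  obtain ⟨c, l, L, hc, he⟩ := exists_cyc w hw
  by_cases hp : ∃ q ∈ l :: L, q.2 = true
  · obtain ⟨q, hq, hq2⟩ := hp
    obtain ⟨L1, L2, hL⟩ := List.append_of_mem hq
    cases L1 with
    | nil =>
      simp only [List.nil_append, List.cons.injEq] at hL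
      obtain ⟨rfl, rfl⟩ := hL
      exact ⟨c, l, L, hc, hq2, Or.inl he⟩
    | cons l1 L1 =>
      simp only [List.cons_append, List.cons.injEq] at hL
      obtain ⟨rfl, rfl⟩ := hL
      refine ⟨c * FreeGroup.mk (l :: L1), q, L2 ++ l :: L1, ?_, hq2, Or.inl ?_⟩
      · unfold Cyc at hc ⊢
        have e1 : l :: (L1 ++ q :: L2 ++ [l]) = (l :: L1) ++ q :: (L2 ++ [l]) := by simp
        rw [e1, List.isChain_split] at hc
        have e2 : q :: (L2 ++ l :: L1 ++ [q]) = (q :: L2) ++ l :: (L1 ++ [q]) := by simp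
        rw [e2, List.isChain_split]
        exact ⟨by simpa using hc.2, by simpa using hc.1⟩
      · rw [he]
        have e3 : FreeGroup.mk (l :: (L1 ++ q :: L2)) = FreeGroup.mk (l :: L1) * FreeGroup.mk (q :: L2) := by
          rw [FreeGroup.mul_mk]; rfl
        have e4 : FreeGroup.mk (q :: (L2 ++ l :: L1)) = FreeGroup.mk (q :: L2) * FreeGroup.mk (l :: L1) := by
          rw [FreeGroup.mul_mk]; rfl
        rw [e3, e4]; group
  · have hneg : ∀ q ∈ l :: L, q.2 = false := by
      intro q hq
      by_contra h
      exact hp ⟨q, hq, by simpa using h⟩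
    have hne : FreeGroup.invRev (l :: L) ≠ [] := by
      intro h
      have := congrArg List.length h
      simp at this
    have hpos : ∀ q ∈ FreeGroup.invRev (l :: L), q.2 = true := by
      intro q hq
      unfold FreeGroup.invRev at hq
      rw [List.mem_reverse, List.mem_map] at hq
      obtain ⟨q', h1, rfl⟩ := hq
      simp [hneg q' h1]
    obtain ⟨l', L', hl'⟩ := List.exists_cons_of_ne_nil hne
    rw [hl'] at hpos
    refine ⟨c, l', L', ?_, hpos _ (by simp), Or.inr ?_⟩
    · unfold Cyc
      apply List.Pairwise.isChain
      rw [List.pairwise_iff_forall_sublist]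
      intro x y hxy _
      have hall : ∀ z ∈ l' :: (L' ++ [l']), z.2 = true := by
        intro z hz
        apply hpos
        simp at hz ⊢
        tauto
      rw [hall x (hxy.subset (by simp)), hall y (hxy.subset (by simp))]
    · rw [he, ← hl', ← FreeGroup.inv_mk]; group

/-- the homomorphism from the free group -/
def phi (a b : T) (ρ : ℕ) : FreeGroup (Fin 2) →* T := FreeGroup.lift (gx a b ρ)

theorem phi_mk (L : List (Fin 2 × Bool)) : phi a b ρ (FreeGroup.mk L) = pv a b ρ L := by
  rw [phi, FreeGroup.lift_mk, pv]
  congr 1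
  apply List.map_congr_left
  rintro ⟨c, β⟩ _
  cases β <;> simp [gv]

theorem phi_range : (phi a b ρ).range = Subgroup.closure {xx a b ρ, yy a b ρ} := by
  rw [phi, FreeGroup.range_lift_eq_closure]
  congr 1
  ext t
  simp only [Set.mem_range, Set.mem_insert_iff, Set.mem_singleton_iff, gx]
  constructor
  · rintro ⟨c, rfl⟩
    by_cases hc : c = 0 <;> simp [hc]
  · rintro (rfl | rfl)
    · exact ⟨0, by simp⟩
    · exact ⟨1, by simp⟩

theorem xx_mem : xx a b ρ ∈ (phi a b ρ).range := by
  rw [phi_range]; exact Subgroup.subset_closure (by simp)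

theorem yy_mem : yy a b ρ ∈ (phi a b ρ).range := by
  rw [phi_range]; exact Subgroup.subset_closure (by simp)

theorem ray_of (hρ : 6 ≤ ρ) {l : Fin 2 × Bool} {L : List (Fin 2 × Bool)} (h : Cyc l L) :
    ∃ (P : ℕ) (e : ℕ → T) (σ : ℕ → St), 0 < P ∧ Track a b ρ e σ ∧
      (∀ n, e n * (src a b ρ (σ n))⁻¹ ∈ (phi a b ρ).range) ∧ σ 0 = ent ρ l ∧
      (∀ n, e (n + P) = phi a b ρ (FreeGroup.mk (l :: L)) * e n) ∧ ∀ n, σ (n + P) = σ n := by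
  obtain ⟨P, e, σ, h1, h2, h3, h4, h5, h6⟩ := periodic_of (walk (a := a) (b := b) hρ L l l h)
  refine ⟨P, e, σ, h1, h2, ?_, h4, ?_, h6⟩
  · apply h2.mem hρ xx_mem yy_mem
    rw [h3, h4, kp]
    split_ifs
    · rw [mul_inv_cancel]; exact Subgroup.one_mem _
    · rw [mul_inv_cancel_right]
      apply Subgroup.inv_mem
      exact ⟨FreeGroup.of l.1, by simp [phi]⟩
  · intro n; rw [phi_mk]; exact h5 n

theorem vx_per {e : ℕ → T} {σ : ℕ → St} {P : ℕ} {m : T} (h1 : ∀ n, e (n + P) = m * e n)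
    (h2 : ∀ n, σ (n + P) = σ n) (n : ℕ) : vx a b e σ (n + P) = m • vx a b e σ n := by
  unfold vx
  rw [h1, h2]
  split_ifs
  · rw [smul_VB]
  · rw [smul_VA]

theorem phi_inj (hG : Geo a b i j k) (hρ : 6 ≤ ρ) : Function.Injective (phi a b ρ) := by
  rw [injective_iff_map_eq_one]
  intro w hw
  by_contra hne
  obtain ⟨c, l, L, hc, he⟩ := exists_cyc w hne
  obtain ⟨P, e, σ, h1, h2, _, _, h5, h6⟩ := ray_of (a := a) (b := b) hρ hc
  have hm : phi a b ρ (FreeGroup.mk (l :: L)) = 1 := by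
    have e1 : FreeGroup.mk (l :: L) = c⁻¹ * w * c := by rw [he]; group
    rw [e1, map_mul, map_mul, hw, map_inv]; simp
  have := vx_per (a := a) (b := b) h5 h6 0
  rw [hm, one_smul] at this
  have := (h2.ray hρ).inj hG this
  omega

theorem core (hG : Geo a b i j k) (hρ : 7 ≤ ρ) {w w' c : FreeGroup (Fin 2)} {l : Fin 2 × Bool}
    {L : List (Fin 2 × Bool)} (hc : Cyc l L) (hl : l.2 = true) (hw : w = c * FreeGroup.mk (l :: L) * c⁻¹)
    (hw' : w' ≠ 1) (g : T) (hg : phi a b ρ w * g = g * phi a b ρ w') : g ∈ (phi a b ρ).range := by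
  have hρ6 : 6 ≤ ρ := by omega
  obtain ⟨c', l', L', hc', he'⟩ := exists_cyc w' hw'
  obtain ⟨P, e, σ, h1, h2, h3, h4, h5, h6⟩ := ray_of (a := a) (b := b) hρ6 hc
  obtain ⟨P', e', σ', h1', h2', h3', h4', h5', h6'⟩ := ray_of (a := a) (b := b) hρ6 hc'
  set m := phi a b ρ (FreeGroup.mk (l :: L)) with hm
  set m' := phi a b ρ (FreeGroup.mk (l' :: L')) with hm'
  set g1 := (phi a b ρ c)⁻¹ * g * phi a b ρ c' with hg1
  have hmg : m * g1 = g1 * m' := by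
    rw [hw, he'] at hg
    simp only [map_mul, map_inv] at hg
    rw [← hm, ← hm'] at hg
    have : m = (phi a b ρ c)⁻¹ * (phi a b ρ c * m * (phi a b ρ c)⁻¹ * g) * g⁻¹ * phi a b ρ c := by group
    rw [this, hg, hg1]; group
  suffices hs : g1 ∈ (phi a b ρ).range by
    have : g = phi a b ρ c * g1 * (phi a b ρ c')⁻¹ := by rw [hg1]; group
    rw [this]
    exact Subgroup.mul_mem _ (Subgroup.mul_mem _ ⟨c, rfl⟩ hs) (Subgroup.inv_mem _ ⟨c', rfl⟩)
  have ht := h2'.lmul g1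
  have p1 := vx_per (a := a) (b := b) h5 h6
  have p2 : ∀ n, vx a b (fun n => g1 * e' n) σ' (n + P') = m • vx a b (fun n => g1 * e' n) σ' n := by
    apply vx_per _ h6'
    intro n
    rw [h5', ← mul_assoc, ← hmg, mul_assoc]
  obtain ⟨r, s, hrs⟩ := rays_merge hG (h2.ray hρ6) (ht.ray hρ6) h1 p1 p2
  have hper : ∀ N, σ (N * P) = σ 0 := by
    intro N
    induction N with
    | zero => simp
    | succ N ih => rw [add_mul, one_mul, h6, ih]
  have hn0 := hper r
  rw [h4] at hn0
  have hn1 : r ≤ r * P := Nat.le_mul_of_pos_right r h1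
  obtain ⟨m0, o0, hmo, hent⟩ : ∃ m0 o0, (m0 = 4 ∧ o0 = 1 ∨ m0 = ρ + 3 ∧ o0 = 13) ∧ ent ρ l = .f m0 o0 := by
    unfold ent
    rw [hl]
    by_cases hl0 : l.1 = 0
    · exact ⟨4, 1, Or.inl ⟨rfl, rfl⟩, by simp [hl0]⟩
    · exact ⟨ρ + 3, 13, Or.inr ⟨rfl, rfl⟩, by simp [hl0]⟩
  rw [hent] at hn0
  obtain ⟨q, k1, k2⟩ := marker hρ6 (fun n => (h2 n).1) hn0 hmo
  obtain ⟨z, hz⟩ : ∃ z, r * P + q = r + z := ⟨r * P + q - r, by omega⟩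
  rw [hz] at k1 k2
  have hsy := sync hρ6 (s := σ) (s' := σ') (n := r + z) (n' := s + z) (fun n => (h2' n).1) (by omega) (by omega) k1 k2
    (vx_ty (hrs z).1) (fun t => by
      have := (hrs (z + t)).2.2
      simpa only [add_assoc] using this)
  have k0 := k1 0 (by omega)
  rw [add_zero, add_zero] at k0
  have m1 := h3 (r + z)
  have m2 := h3' (s + z)
  have m3 := (hrs z).2.1
  rw [k0] at m1
  rw [hsy] at m2
  rw [m3] at m1
  have := Subgroup.mul_mem _ m1 (Subgroup.inv_mem _ m2)
  convert this using 1
  group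

theorem main_alg (hG : Geo a b i j k) (hρ : 7 ≤ ρ) :
    (∀ g : T, (∃ x ∈ Subgroup.closure {xx a b ρ, yy a b ρ}, x ≠ 1 ∧
      g⁻¹ * x * g ∈ Subgroup.closure {xx a b ρ, yy a b ρ}) → g ∈ Subgroup.closure {xx a b ρ, yy a b ρ}) ∧
    Nonempty (↥(Subgroup.closure {xx a b ρ, yy a b ρ}) ≃* FreeGroup (Fin 2)) := by
  rw [← phi_range]
  refine ⟨?_, ⟨(MonoidHom.ofInjective (phi_inj hG (by omega))).symm⟩⟩
  rintro g ⟨x, ⟨w, rfl⟩, hx, ⟨w', hw'⟩⟩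
  have hw : w ≠ 1 := by rintro rfl; exact hx (map_one _)
  have hg : phi a b ρ w * g = g * phi a b ρ w' := by rw [hw']; group
  have hw1 : w' ≠ 1 := by
    rintro rfl
    rw [map_one, mul_one, mul_eq_right] at hg
    exact hx hg
  obtain ⟨c, l, L, hc, hl, he | he⟩ := exists_pos w hw
  · exact core hG hρ hc hl he hw1 g hg
  · refine core hG hρ hc hl he (inv_ne_one.2 hw1) g ?_
    rw [map_inv, map_inv, inv_mul_eq_iff_eq_mul, ← mul_assoc, hg, mul_inv_cancel_right]

theorem word_x (a b : T) (ρ : ℕ) (hρ : 6 ≤ ρ) :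
    ((List.range ρ).map fun m => (a * b⁻¹) ^ 3 * (a ^ 2 * b⁻¹) ^ (m + 3)).prod = xx a b ρ := by
  have key : ∀ n, n < ρ → base a b ρ (n + 3) =
      ((List.range n).map fun m => (a * b⁻¹) ^ 3 * (a ^ 2 * b⁻¹) ^ (m + 3)).prod := by
    intro n
    induction n with
    | zero => intro _; rw [zero_add, base_three]; simp
    | succ n ih =>
      intro h
      rw [show n + 1 + 3 = n + 3 + 1 by ring, base_succ a b ρ _ (by omega) (by omega), ih (by omega), om_blk,
        List.range_succ, List.map_append, List.prod_append]
      simp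
  obtain ⟨r, rfl⟩ : ∃ r, ρ = r + 1 := ⟨ρ - 1, by omega⟩
  rw [xx, show r + 1 + 2 = r + 3 by ring, key r (by omega), om_blk, List.range_succ, List.map_append,
    List.prod_append]
  simp

theorem word_y (a b : T) (ρ : ℕ) (hρ : 6 ≤ ρ) :
    ((List.range ρ).map fun m => (a * b⁻¹) ^ 3 * (a ^ 2 * b⁻¹) ^ (m + ρ + 3)).prod = yy a b ρ := by
  have key : ∀ n, base a b ρ (n + ρ + 3) =
      ((List.range n).map fun m => (a * b⁻¹) ^ 3 * (a ^ 2 * b⁻¹) ^ (m + ρ + 3)).prod := by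
    intro n
    induction n with
    | zero => rw [zero_add, base_r3]; simp
    | succ n ih =>
      rw [show n + 1 + ρ + 3 = n + ρ + 3 + 1 by ring, base_succ a b ρ _ (by omega) (by omega), ih, om_blk,
        List.range_succ, List.map_append, List.prod_append]
      simp
  obtain ⟨r, hr⟩ : ∃ r, ρ = r + 1 := ⟨ρ - 1, by omega⟩
  rw [yy, show 2 * ρ + 2 = r + ρ + 3 by omega, key r, om_blk, hr, List.range_succ, List.map_append,
    List.prod_append]
  simp

end final

end TG


theorem lem_malnormal_triangle (i j k : ℕ) (hi : 6 ≤ i) (hj : 6 ≤ j) (hk : 6 ≤ k) :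
    ∃ ρ₀ : ℕ, max i (max j k) ≤ ρ₀ ∧ ∀ ρ : ℕ, ρ₀ ≤ ρ →
      Malnormal (Subgroup.closure
        {PresentedGroup.mk (triangleRels i j k) (wordX ρ),
         PresentedGroup.mk (triangleRels i j k) (wordY ρ)}) ∧
      Nonempty (↥(Subgroup.closure
        {PresentedGroup.mk (triangleRels i j k) (wordX ρ),
         PresentedGroup.mk (triangleRels i j k) (wordY ρ)}) ≃* FreeGroup (Fin 2)) := by
  refine ⟨max i (max j k) + 1, Nat.le_succ _, fun ρ hρ => ?_⟩
  have hρ7 : 7 ≤ ρ := by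
    have := le_max_left i (max j k)
    omega
  have hrel : ∀ r ∈ triangleRels i j k, PresentedGroup.mk (triangleRels i j k) r = 1 :=
    fun r hr => (PresentedGroup.one_of_mem hr)
  have hG : TG.Geo (PresentedGroup.mk (triangleRels i j k) fa)
      (PresentedGroup.mk (triangleRels i j k) fb) i j k := by
    apply TG.exists_geo i j k hi hj hk
    · rw [← map_pow]
      exact hrel _ (by simp [triangleRels, fa])
    · rw [← map_pow]
      exact hrel _ (by simp [triangleRels, fb])
    · rw [← map_mul, ← map_pow]
      exact hrel _ (by simp [triangleRels, fa, fb])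
    · intro G _ A B hA hB hC
      have hf : ∀ r ∈ triangleRels i j k, FreeGroup.lift ![A, B] r = 1 := by
        intro r hr
        rcases hr with rfl | rfl | rfl
        · simpa using hA
        · simpa using hB
        · simpa using hC
      refine ⟨PresentedGroup.toGroup hf, ?_, ?_⟩
      · exact PresentedGroup.toGroup.of hf (x := 0)
      · exact PresentedGroup.toGroup.of hf (x := 1)
    · rw [← PresentedGroup.closure_range_of]
      congr 1
      ext z
      constructor
      · rintro (rfl | rfl)
        · exact ⟨0, rfl⟩
        · exact ⟨1, rfl⟩
      · rintro ⟨q, rfl⟩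
        fin_cases q
        · exact Or.inl rfl
        · exact Or.inr rfl
  have hx : PresentedGroup.mk (triangleRels i j k) (wordX ρ) =
      TG.xx (PresentedGroup.mk (triangleRels i j k) fa)
        (PresentedGroup.mk (triangleRels i j k) fb) ρ := by
    rw [← TG.word_x _ _ ρ (by omega), wordX, map_list_prod, List.map_map]
    simp [Function.comp_def]
  have hy : PresentedGroup.mk (triangleRels i j k) (wordY ρ) =
      TG.yy (PresentedGroup.mk (triangleRels i j k) fa)
        (PresentedGroup.mk (triangleRels i j k) fb) ρ := by
    rw [← TG.word_y _ _ ρ (by omega), wordY, map_list_prod, List.map_map]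
    simp [Function.comp_def]
  rw [hx, hy]
  exact TG.main_alg hG hρ7
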